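/- Let d ≥ 2 and 0 < α < ∞, and let E(α) = {2^k(1 + ν^{−α}) : k ∈ ℤ, ν ∈ ℤ, ν ≥ 1}. Then for every p with 1 < p < ∞, the spherical maximal operator M_{E(α)} is of weak type (p,p) if and only if p ≥ 1 + 1/((d−1)(α+1)). -/

import Mathlib

open MeasureTheory Metric Set Filter
open scoped ENNReal NNReal Topology

noncomputable section

abbrev Ed (d : ℕ) := EuclideanSpace ℝ (Fin d)

/-- The rotation-invariant probability measure on the unit sphere. -/
def sphereProb (d : ℕ) : Measure (sphere (0 : Ed d) 1) :=
  ((volume : Measure (Ed d)).toSphere Set.univ)⁻¹ • (volume : Measure (Ed d)).toSphere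

/-- Spherical mean `A_t f`. -/
def sphMean (d : ℕ) (t : ℝ) (f : Ed d → ℂ) (x : Ed d) : ℂ :=
  ∫ y : sphere (0 : Ed d) 1, f (x - t • (y : Ed d)) ∂(sphereProb d)

/-- Spherical maximal function, with values in `ℝ≥0∞`. -/
def maxFn (d : ℕ) (E : Set ℝ) (f : Ed d → ℂ) (x : Ed d) : ℝ≥0∞ :=
  ⨆ t ∈ E, (‖sphMean d t f x‖₊ : ℝ≥0∞)

/-- `N(S,δ)`: minimal number of intervals of length `δ` needed to cover `S`
(with the value `1` for the empty set). -/
def covN (S : Set ℝ) (δ : ℝ) : ℕ :=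
  max 1 (sInf {n : ℕ | ∃ c : Fin n → ℝ, S ⊆ ⋃ i, Set.Icc (c i) (c i + δ)})

def Ek (E : Set ℝ) (k : ℤ) : Set ℝ := E ∩ Set.Ico ((2:ℝ)^k) ((2:ℝ)^(k+1))

/-- weak type (p,p) for the spherical maximal operator. -/
def WeakTypePP (d : ℕ) (E : Set ℝ) (p : ℝ) : Prop :=
  ∃ C : ℝ, ∀ f : Ed d → ℂ, Continuous f → HasCompactSupport f → ∀ a : ℝ, 0 < a →
    volume {x | ENNReal.ofReal a < maxFn d E f x} ≤
      ENNReal.ofReal (C * a ^ (-p) * ∫ x, ‖f x‖ ^ p)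

section

open FourierTransform

variable {d : ℕ}

/-- The `L²` Fourier transform agrees with the Fourier integral on `L¹ ∩ L²`. -/
theorem fourier_toLp_ae_eq {f : Ed d → ℂ} (hf : Integrable f) (h2 : MemLp f 2) :
    (𝓕 (h2.toLp f) : Lp ℂ 2 (volume : Measure (Ed d))) =ᵐ[volume] 𝓕 f := by
  have hc : Continuous (𝓕 f) :=
    VectorFourier.fourierIntegral_continuous Real.continuous_fourierChar continuous_inner hf
  refine ae_eq_of_integral_contDiff_smul_eq ?_ hc.locallyIntegrable ?_
  · exact (Lp.memLp _).locallyIntegrable (by norm_num)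
  · intro g hg hgc
    have hg' : ContDiff ℝ (↑(⊤ : ℕ∞)) (fun x => (g x : ℂ)) :=
      Complex.ofRealCLM.contDiff.comp hg
    have hgc' : HasCompactSupport (fun x => (g x : ℂ)) := hgc.comp_left (g := fun x : ℝ => (x : ℂ)) rfl
    set G : SchwartzMap (Ed d) ℂ := hgc'.toSchwartzMap hg' with hG
    have hGx : ∀ x, G x = (g x : ℂ) := fun x => rfl
    have h1 := congrArg (fun T => T G) (Lp.fourier_toTemperedDistribution_eq (h2.toLp f))
    simp only [TemperedDistribution.fourier_apply, Lp.toTemperedDistribution_apply] at h1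
    have e1 : ∫ x, g x • ((𝓕 (h2.toLp f) : Lp ℂ 2 (volume : Measure (Ed d))) : Ed d → ℂ) x
        = ∫ x, G x • ((𝓕 (h2.toLp f) : Lp ℂ 2 (volume : Measure (Ed d))) : Ed d → ℂ) x := by
      refine integral_congr_ae (ae_of_all _ fun x => ?_)
      simp [hGx]
    have e2 : ∫ x, g x • 𝓕 f x = ∫ x, G x • 𝓕 f x := by
      refine integral_congr_ae (ae_of_all _ fun x => ?_)
      simp [hGx]
    rw [e1, e2, ← h1]
    have e3 : ∫ x, (𝓕 G) x • (h2.toLp f : Ed d → ℂ) x = ∫ x, (𝓕 (G : Ed d → ℂ)) x • f x := by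
      refine integral_congr_ae ?_
      filter_upwards [h2.coeFn_toLp] with x hx
      rw [hx, SchwartzMap.fourier_coe]
    rw [e3]
    have := VectorFourier.integral_fourierIntegral_smul_eq_flip (μ := (volume : Measure (Ed d)))
      (ν := (volume : Measure (Ed d))) (L := innerₗ (Ed d)) Real.continuous_fourierChar
      (by simpa using continuous_inner) G.integrable hf
    rw [flip_innerₗ] at this
    exact this

/-- **Plancherel** on `L¹ ∩ L²`. -/
theorem lintegral_fourier_sq {f : Ed d → ℂ} (hf : Integrable f) (h2 : MemLp f 2) :
    ∫⁻ x, ‖𝓕 f x‖ₑ ^ 2 = ∫⁻ x, ‖f x‖ₑ ^ 2 := by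
  have key : eLpNorm (𝓕 f) 2 volume = eLpNorm f 2 volume := by
    have h := Lp.norm_fourier_eq (h2.toLp f)
    rw [Lp.norm_toLp, Lp.norm_def, eLpNorm_congr_ae (fourier_toLp_ae_eq hf h2)] at h
    refine (ENNReal.toReal_eq_toReal_iff' ?_ h2.2.ne).1 h
    have := (Lp.memLp (𝓕 (h2.toLp f) : Lp ℂ 2 (volume : Measure (Ed d)))).2
    rw [eLpNorm_congr_ae (fourier_toLp_ae_eq hf h2)] at this
    exact this.ne
  have conv : ∀ g : Ed d → ℂ, ∫⁻ x, ‖g x‖ₑ ^ 2 = eLpNorm g 2 volume ^ 2 := by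
    intro g
    have := eLpNorm_nnreal_pow_eq_lintegral (μ := (volume : Measure (Ed d))) (f := g)
      (p := 2) (by norm_num)
    simp only [NNReal.coe_ofNat, ENNReal.coe_ofNat, ENNReal.rpow_ofNat] at this
    exact this.symm
  rw [conv, conv, key]

theorem lintegral_fourierInv_sq {f : Ed d → ℂ} (hf : Integrable f) (h2 : MemLp f 2) :
    ∫⁻ x, ‖𝓕⁻ f x‖ₑ ^ 2 = ∫⁻ x, ‖f x‖ₑ ^ 2 := by
  rw [← lintegral_fourier_sq hf h2]
  have : ∀ x, 𝓕⁻ f x = 𝓕 f (-x) := fun x => Real.fourierInv_eq_fourier_neg f x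
  simp_rw [this]
  exact lintegral_neg_eq_self (μ := (volume : Measure (Ed d))) (fun x => ‖𝓕 f x‖ₑ ^ 2)

end

section

open scoped Pointwise

variable {d : ℕ}

theorem isProbabilityMeasure_sphereProb (hd : 1 ≤ d) : IsProbabilityMeasure (sphereProb d) := by
  have : NeZero d := ⟨by omega⟩
  have : Nontrivial (Ed d) := by
    have : Nonempty (Fin d) := ⟨⟨0, by omega⟩⟩
    infer_instance
  refine ⟨?_⟩
  rw [sphereProb, Measure.smul_apply, smul_eq_mul]
  refine ENNReal.inv_mul_cancel ?_ (measure_ne_top _ _)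
  rw [Ne, Measure.measure_univ_eq_zero]
  exact Measure.toSphere_ne_zero _

/-- The action of a linear isometry on the unit sphere. -/
def sphereMap (L : Ed d ≃ₗᵢ[ℝ] Ed d) (y : sphere (0 : Ed d) 1) : sphere (0 : Ed d) 1 :=
  ⟨L y, by simp⟩

theorem continuous_sphereMap (L : Ed d ≃ₗᵢ[ℝ] Ed d) : Continuous (sphereMap L) :=
  Continuous.subtype_mk (L.continuous.comp continuous_subtype_val) _

theorem measurePreserving_sphereMap (L : Ed d ≃ₗᵢ[ℝ] Ed d) :
    MeasurePreserving (sphereMap L) (sphereProb d) (sphereProb d) := by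
  refine ⟨(continuous_sphereMap L).measurable, ?_⟩
  rw [sphereProb, Measure.map_smul]
  congr 1
  ext s hs
  rw [Measure.map_apply (continuous_sphereMap L).measurable hs,
    Measure.toSphere_apply' _ hs,
    Measure.toSphere_apply' _ ((continuous_sphereMap L).measurable hs)]
  congr 1
  have : Ioo (0 : ℝ) 1 • ((↑) '' (sphereMap L ⁻¹' s) : Set (Ed d))
      = L ⁻¹' (Ioo (0 : ℝ) 1 • ((↑) '' s : Set (Ed d))) := by
    ext z
    simp only [Set.mem_smul, Set.mem_image, Set.mem_preimage]
    constructor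
    · rintro ⟨c, hc, _, ⟨y, hy, rfl⟩, rfl⟩
      exact ⟨c, hc, L y, ⟨sphereMap L y, hy, rfl⟩, by simp⟩
    · rintro ⟨c, hc, _, ⟨y, hy, rfl⟩, h⟩
      refine ⟨c, hc, L.symm y, ⟨sphereMap L.symm y, ?_, rfl⟩, ?_⟩
      · have : sphereMap L (sphereMap L.symm y) = y := by
          apply Subtype.ext; simp [sphereMap]
        rw [this]; exact hy
      · apply L.injective; simp [h]
  rw [this]
  exact L.measurePreserving.measure_preimage_equiv (f := L.toMeasurableEquiv) _

theorem integral_sphere_comp (L : Ed d ≃ₗᵢ[ℝ] Ed d) {F : Type*} [NormedAddCommGroup F]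
    [NormedSpace ℝ F] (g : Ed d → F) :
    ∫ y : sphere (0 : Ed d) 1, g (L y) ∂(sphereProb d)
      = ∫ y : sphere (0 : Ed d) 1, g y ∂(sphereProb d) := by
  have hm : MeasurableEmbedding (sphereMap L) := by
    have : Function.LeftInverse (sphereMap L.symm) (sphereMap L) := fun y => by
      apply Subtype.ext; simp [sphereMap]
    have h2 : Function.LeftInverse (sphereMap L) (sphereMap L.symm) := fun y => by
      apply Subtype.ext; simp [sphereMap]
    exact (Homeomorph.measurableEmbedding
      { toFun := sphereMap L, invFun := sphereMap L.symm, left_inv := this, right_inv := h2,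
        continuous_toFun := continuous_sphereMap L,
        continuous_invFun := continuous_sphereMap L.symm })
  exact (measurePreserving_sphereMap L).integral_comp hm (fun y => g y)

/-- Real part of the Fourier transform of the surface measure. -/
def sphereCos (d : ℕ) (x : Ed d) : ℝ :=
  ∫ y : sphere (0 : Ed d) 1, Real.cos (inner ℝ (y : Ed d) x) ∂(sphereProb d)

theorem exists_isometry_map_eq {x x' : Ed d} (h : ‖x‖ = ‖x'‖) : ∃ L : Ed d ≃ₗᵢ[ℝ] Ed d, L x = x' :=
  ⟨_, Submodule.reflection_sub h⟩

theorem sphereCos_eq_of_norm_eq {x x' : Ed d} (h : ‖x‖ = ‖x'‖) :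
    sphereCos d x = sphereCos d x' := by
  obtain ⟨L, hL⟩ := exists_isometry_map_eq h
  rw [sphereCos, sphereCos, ← integral_sphere_comp L (fun y => Real.cos (inner ℝ y x'))]
  simp_rw [← hL, LinearIsometryEquiv.inner_map_map]

theorem integral_sphere_exp (x : Ed d) :
    ∫ y : sphere (0 : Ed d) 1, Complex.exp (((inner ℝ (y : Ed d) x : ℝ) : ℂ) * Complex.I)
      ∂(sphereProb d) = sphereCos d x := by
  by_cases hd : 1 ≤ d
  swap
  · have : d = 0 := by omega
    subst this
    have h0 : ∀ y : sphere (0 : Ed 0) 1, inner ℝ (y : Ed 0) x = 0 := fun y => by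
      rw [Subsingleton.elim x 0, inner_zero_right]
    rw [sphereCos]
    simp_rw [h0]
    simp
  have := isProbabilityMeasure_sphereProb hd
  have h1 : ∫ y : sphere (0 : Ed d) 1, Real.sin (inner ℝ (y : Ed d) x) ∂(sphereProb d) = 0 := by
    have := integral_sphere_comp (LinearIsometryEquiv.neg ℝ) (fun y : Ed d => Real.sin (inner ℝ y x))
    simp only [LinearIsometryEquiv.coe_neg, inner_neg_left, Real.sin_neg, integral_neg] at this
    linarith
  have hi : ∀ g : ℝ → ℝ, Continuous g → (∀ r, |g r| ≤ 1) →
      Integrable (fun y : sphere (0 : Ed d) 1 => ((g (inner ℝ (y : Ed d) x) : ℝ) : ℂ))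
      (sphereProb d) := by
    intro g hg hb
    refine Integrable.of_bound (C := 1) ?_ (ae_of_all _ fun y => ?_)
    · exact (by fun_prop : Continuous _).aestronglyMeasurable
    · simpa using hb _
  simp_rw [Complex.exp_mul_I, ← Complex.ofReal_cos, ← Complex.ofReal_sin]
  rw [integral_add (hi _ Real.continuous_cos Real.abs_cos_le_one)
    ((hi _ Real.continuous_sin Real.abs_sin_le_one).mul_const _), integral_mul_const,
    integral_complex_ofReal, integral_complex_ofReal, h1, sphereCos]
  simp

/-- Differentiation under the integral for bounded derivatives. -/
theorem hasDerivAt_integral_sphere (hd : 1 ≤ d) {F F' : ℝ → sphere (0 : Ed d) 1 → ℝ} {C : ℝ} (t : ℝ)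
    (hF : ∀ s, Continuous (F s)) (hF' : ∀ s, Continuous (F' s))
    (hD : ∀ s y, HasDerivAt (F · y) (F' s y) s) (hb : ∀ s y, |F' s y| ≤ C) :
    HasDerivAt (fun s => ∫ y, F s y ∂(sphereProb d)) (∫ y, F' t y ∂(sphereProb d)) t := by
  have := isProbabilityMeasure_sphereProb hd
  have hInt : ∀ s, Integrable (F s) (sphereProb d) := fun s =>
    ((hF s).integrable_of_hasCompactSupport (HasCompactSupport.of_compactSpace _))
  exact (hasDerivAt_integral_of_dominated_loc_of_deriv_le (bound := fun _ => C) (Filter.univ_mem)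
    (Eventually.of_forall fun s => (hF s).aestronglyMeasurable) (hInt t)
    (hF' t).aestronglyMeasurable (ae_of_all _ fun y s _ => hb s y) (integrable_const _)
    (ae_of_all _ fun y s _ => hD s y)).2

theorem abs_apply_le_one (y : sphere (0 : Ed d) 1) (i : Fin d) : |(y : Ed d) i| ≤ 1 := by
  have h := PiLp.norm_apply_le (y : Ed d) i
  have : ‖(y : Ed d)‖ = 1 := by simp
  rwa [this, Real.norm_eq_abs] at h

/-- `∫ cos (r y_i)` and its first two derivatives. -/
def besselU (d : ℕ) (i : Fin d) (r : ℝ) : ℝ :=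
  ∫ y : sphere (0 : Ed d) 1, Real.cos (r * (y : Ed d) i) ∂(sphereProb d)

def besselU' (d : ℕ) (i : Fin d) (r : ℝ) : ℝ :=
  ∫ y : sphere (0 : Ed d) 1, -((y : Ed d) i * Real.sin (r * (y : Ed d) i)) ∂(sphereProb d)

def besselU'' (d : ℕ) (i : Fin d) (r : ℝ) : ℝ :=
  ∫ y : sphere (0 : Ed d) 1, -((y : Ed d) i ^ 2 * Real.cos (r * (y : Ed d) i)) ∂(sphereProb d)

theorem hasDerivAt_besselU (i : Fin d) (r : ℝ) :
    HasDerivAt (besselU d i) (besselU' d i r) r := by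
  refine hasDerivAt_integral_sphere (C := 1) i.pos r
    (F := fun r y => Real.cos (r * (y : Ed d) i)) (fun s => by fun_prop)
    (F' := fun r y => -((y : Ed d) i * Real.sin (r * (y : Ed d) i))) (fun s => by fun_prop) ?_ ?_
  · intro s y
    refine ((hasDerivAt_id s).mul_const ((y : Ed d) i)).cos.congr_deriv ?_
    simp only [id]; ring
  · intro s y
    rw [abs_neg, abs_mul]
    exact mul_le_one₀ (abs_apply_le_one y i) (abs_nonneg _) (Real.abs_sin_le_one _)

theorem hasDerivAt_besselU' (i : Fin d) (r : ℝ) :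
    HasDerivAt (besselU' d i) (besselU'' d i r) r := by
  refine hasDerivAt_integral_sphere (C := 1) i.pos r
    (F := fun r y => -((y : Ed d) i * Real.sin (r * (y : Ed d) i))) (fun s => by fun_prop)
    (F' := fun r y => -((y : Ed d) i ^ 2 * Real.cos (r * (y : Ed d) i))) (fun s => by fun_prop) ?_ ?_
  · intro s y
    refine ((((hasDerivAt_id s).mul_const ((y : Ed d) i)).sin).const_mul
      ((y : Ed d) i)).neg.congr_deriv ?_
    simp only [id]; ring
  · intro s y
    rw [abs_neg, abs_mul, abs_pow]
    exact mul_le_one₀ (pow_le_one₀ (abs_nonneg _) (abs_apply_le_one y i)) (abs_nonneg _)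
      (Real.abs_cos_le_one _)

theorem abs_integral_sphere_le_one (hd : 1 ≤ d) {F : sphere (0 : Ed d) 1 → ℝ}
    (hF : ∀ y, |F y| ≤ 1) : |∫ y, F y ∂(sphereProb d)| ≤ 1 := by
  have := isProbabilityMeasure_sphereProb hd
  have := norm_integral_le_of_norm_le_const (μ := sphereProb d) (C := 1) (f := F)
    (ae_of_all _ fun y => by simpa using hF y)
  simpa using this

theorem abs_besselU_le (i : Fin d) (r : ℝ) : |besselU d i r| ≤ 1 :=
  abs_integral_sphere_le_one i.pos fun _ => Real.abs_cos_le_one _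

theorem abs_besselU'_le (i : Fin d) (r : ℝ) : |besselU' d i r| ≤ 1 :=
  abs_integral_sphere_le_one i.pos fun y => by
    rw [abs_neg, abs_mul]
    exact mul_le_one₀ (abs_apply_le_one y i) (abs_nonneg _) (Real.abs_sin_le_one _)

theorem sphere_rotation_identity {i j : Fin d} (hij : i ≠ j) {r : ℝ} (hr : 0 < r) :
    r * ∫ y : sphere (0 : Ed d) 1, (y : Ed d) j ^ 2 * Real.cos (r * (y : Ed d) i) ∂(sphereProb d)
      = - besselU' d i r := by
  have hd : 1 ≤ d := i.pos
  set a : ℝ → sphere (0 : Ed d) 1 → ℝ := fun θ y =>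
    r * Real.cos θ * (y : Ed d) i + r * Real.sin θ * (y : Ed d) j with ha
  set a' : ℝ → sphere (0 : Ed d) 1 → ℝ := fun θ y =>
    -(r * Real.sin θ * (y : Ed d) i) + r * Real.cos θ * (y : Ed d) j with ha'
  have hda : ∀ θ y, HasDerivAt (a · y) (a' θ y) θ := by
    intro θ y
    refine ((((Real.hasDerivAt_cos θ).const_mul r).mul_const ((y : Ed d) i)).add
      (((Real.hasDerivAt_sin θ).const_mul r).mul_const ((y : Ed d) j))).congr_deriv ?_
    simp only [ha']; ring
  have hda' : ∀ θ y, HasDerivAt (a' · y) (- a θ y) θ := by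
    intro θ y
    refine ((((Real.hasDerivAt_sin θ).const_mul r).mul_const ((y : Ed d) i)).neg.add
      (((Real.hasDerivAt_cos θ).const_mul r).mul_const ((y : Ed d) j))).congr_deriv ?_
    simp only [ha]; ring
  have hbd : ∀ u v : ℝ, |u| ≤ 1 → |v| ≤ 1 → |r * u * v| ≤ r := by
    intro u v hu hv
    rw [mul_assoc, abs_mul, abs_of_pos hr, abs_mul]
    have : |u| * |v| ≤ 1 := mul_le_one₀ hu (abs_nonneg _) hv
    nlinarith
  have hba : ∀ θ y, |a θ y| ≤ 2 * r := by
    intro θ y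
    refine (abs_add_le _ _).trans ?_
    have h1 := hbd _ _ (Real.abs_cos_le_one θ) (abs_apply_le_one y i)
    have h2 := hbd _ _ (Real.abs_sin_le_one θ) (abs_apply_le_one y j)
    linarith
  have hba' : ∀ θ y, |a' θ y| ≤ 2 * r := by
    intro θ y
    refine (abs_add_le _ _).trans ?_
    rw [abs_neg]
    have h1 := hbd _ _ (Real.abs_sin_le_one θ) (abs_apply_le_one y i)
    have h2 := hbd _ _ (Real.abs_cos_le_one θ) (abs_apply_le_one y j)
    linarith
  have hca : ∀ θ, Continuous (a θ) := fun θ => by simp only [ha]; fun_prop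
  have hca' : ∀ θ, Continuous (a' θ) := fun θ => by simp only [ha']; fun_prop
  have hconst : ∀ θ, ∫ y, Real.cos (a θ y) ∂(sphereProb d) = besselU d i r := by
    intro θ
    have key := sphereCos_eq_of_norm_eq (d := d)
      (x := EuclideanSpace.single i (r * Real.cos θ) + EuclideanSpace.single j (r * Real.sin θ))
      (x' := EuclideanSpace.single i r) ?_
    · rw [sphereCos, sphereCos] at key
      simp only [inner_add_right, EuclideanSpace.inner_single_right] at key
      rw [besselU]
      simpa [ha, mul_assoc] using key
    · have h0 : inner ℝ (EuclideanSpace.single i (r * Real.cos θ) : Ed d)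
          (EuclideanSpace.single j (r * Real.sin θ)) = 0 := by
        simp [EuclideanSpace.inner_single_right, hij.symm]
      have := norm_add_sq_real (EuclideanSpace.single i (r * Real.cos θ) : Ed d)
          (EuclideanSpace.single j (r * Real.sin θ))
      rw [h0] at this
      simp only [PiLp.norm_single, Real.norm_eq_abs, sq_abs] at this
      have h3 : (r * Real.cos θ) ^ 2 + 2 * 0 + (r * Real.sin θ) ^ 2 = r ^ 2 := by
        nlinarith [Real.sin_sq_add_cos_sq θ]
      rw [h3] at this
      rw [PiLp.norm_single, Real.norm_eq_abs, abs_of_pos hr]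
      exact (pow_left_inj₀ (norm_nonneg _) hr.le two_ne_zero).1 this
  have hd1 : ∀ θ, ∫ y, -(Real.sin (a θ y) * a' θ y) ∂(sphereProb d) = 0 := by
    intro θ
    have h1 := hasDerivAt_integral_sphere (C := 2 * r) hd θ (F := fun θ y => Real.cos (a θ y))
      (F' := fun θ y => -(Real.sin (a θ y) * a' θ y))
      (fun s => Real.continuous_cos.comp (hca s))
      (fun s => ((Real.continuous_sin.comp (hca s)).mul (hca' s)).neg)
      (fun s y => by convert (hda s y).cos using 1; ring)
      (fun s y => by
        rw [abs_neg, abs_mul]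
        have := Real.abs_sin_le_one (a s y)
        have := hba' s y
        nlinarith [abs_nonneg (a' s y), abs_nonneg (Real.sin (a s y))])
    simp_rw [hconst] at h1
    exact h1.unique (hasDerivAt_const _ _)
  have h2 := hasDerivAt_integral_sphere (C := (2 * r) ^ 2 + 2 * r) hd 0
      (F := fun θ y => -(Real.sin (a θ y) * a' θ y))
      (F' := fun θ y => -(Real.cos (a θ y) * a' θ y ^ 2) + Real.sin (a θ y) * a θ y)
      (fun s => ((Real.continuous_sin.comp (hca s)).mul (hca' s)).neg)
      (fun s => (((Real.continuous_cos.comp (hca s)).mul ((hca' s).pow 2)).neg).add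
        ((Real.continuous_sin.comp (hca s)).mul (hca s)))
      (fun s y => by 
        refine ((hda s y).sin.mul (hda' s y)).neg.congr_deriv ?_; ring)
      (fun s y => by
        refine (abs_add_le _ _).trans ?_
        rw [abs_neg, abs_mul, abs_mul, abs_pow]
        have h1 := Real.abs_sin_le_one (a s y)
        have h2 := Real.abs_cos_le_one (a s y)
        have h3 := hba' s y
        have h4 := hba s y
        have h5 : |a' s y| ^ 2 ≤ (2 * r) ^ 2 := pow_le_pow_left₀ (abs_nonneg _) h3 2
        nlinarith [abs_nonneg (a' s y), abs_nonneg (a s y), abs_nonneg (Real.sin (a s y)),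
          sq_nonneg (|a' s y|), abs_nonneg (Real.cos (a s y))])
  simp_rw [hd1] at h2
  have h3 := h2.unique (hasDerivAt_const _ _)
  have hprob := isProbabilityMeasure_sphereProb hd
  have hInt : ∀ F : sphere (0 : Ed d) 1 → ℝ, Continuous F → Integrable F (sphereProb d) :=
    fun F hF => hF.integrable_of_hasCompactSupport (HasCompactSupport.of_compactSpace _)
  have h4 : ∫ y : sphere (0 : Ed d) 1, (-r ^ 2 * ((y : Ed d) j ^ 2 * Real.cos (r * (y : Ed d) i))
      + (-r) * (-((y : Ed d) i * Real.sin (r * (y : Ed d) i)))) ∂(sphereProb d) = 0 := by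
    rw [← h3]
    refine integral_congr_ae (ae_of_all _ fun y => ?_)
    simp [ha, ha']; ring
  rw [integral_add (hInt _ (by fun_prop)) (hInt _ (by fun_prop)), integral_const_mul,
    integral_const_mul] at h4
  rw [besselU']
  have : r * (r * ∫ y : sphere (0 : Ed d) 1, (y : Ed d) j ^ 2 * Real.cos (r * (y : Ed d) i)
    ∂(sphereProb d)) = r * (- ∫ y : sphere (0 : Ed d) 1, -((y : Ed d) i * Real.sin (r * (y : Ed d) i))
    ∂(sphereProb d)) := by linarith
  exact mul_left_cancel₀ hr.ne' this

theorem bessel_ode (i : Fin d) {r : ℝ} (hr : 0 < r) :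
    r * (besselU d i r + besselU'' d i r) = -((d : ℝ) - 1) * besselU' d i r := by
  have hd : 1 ≤ d := i.pos
  have hprob := isProbabilityMeasure_sphereProb hd
  have hInt : ∀ F : sphere (0 : Ed d) 1 → ℝ, Continuous F → Integrable F (sphereProb d) :=
    fun F hF => hF.integrable_of_hasCompactSupport (HasCompactSupport.of_compactSpace _)
  have h1 : besselU d i r + besselU'' d i r = ∑ j ∈ Finset.univ.erase i,
      ∫ y : sphere (0 : Ed d) 1, (y : Ed d) j ^ 2 * Real.cos (r * (y : Ed d) i) ∂(sphereProb d) := by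
    rw [besselU, besselU'', ← integral_add (hInt _ (by fun_prop)) (hInt _ (by fun_prop)),
      ← integral_finsetSum _ (fun j _ => hInt _ (by fun_prop))]
    refine integral_congr_ae (ae_of_all _ fun y => ?_)
    have hy : ∑ j, (y : Ed d) j ^ 2 = 1 := by
      have h := EuclideanSpace.real_norm_sq_eq (y : Ed d)
      have h' : ‖(y : Ed d)‖ = 1 := by simp
      rw [h'] at h; linarith
    rw [← Finset.add_sum_erase _ _ (Finset.mem_univ i)] at hy
    simp only
    rw [← Finset.sum_mul]
    have : ∑ j ∈ Finset.univ.erase i, (y : Ed d) j ^ 2 = 1 - (y : Ed d) i ^ 2 := by linarith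
    rw [this]; ring
  rw [h1, Finset.mul_sum, Finset.sum_congr rfl (fun j hj =>
    sphere_rotation_identity (Finset.ne_of_mem_erase hj).symm hr), Finset.sum_const,
    Finset.card_erase_of_mem (Finset.mem_univ i), Finset.card_univ, Fintype.card_fin,
    nsmul_eq_mul, Nat.cast_sub hd]
  push_cast
  ring

end

section

variable {d : ℕ}

theorem exists_bessel_energy_le (i : Fin d) : ∃ C : ℝ, 0 < C ∧ ∀ r : ℝ, 0 ≤ r →
    r ^ (d - 1) * (besselU d i r ^ 2 + besselU' d i r ^ 2) ≤ C := by
  have hd : 1 ≤ d := i.pos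
  set u := besselU d i with hu
  set u' := besselU' d i with hu'
  set u'' := besselU'' d i with hu''
  set a : ℝ := ((d : ℝ) - 1) / 2 with ha
  have ha0 : 0 ≤ a := by
    have : (1 : ℝ) ≤ d := by exact_mod_cast hd
    rw [ha]; linarith
  have h2a : ((d - 1 : ℕ) : ℝ) = 2 * a := by
    rw [Nat.cast_sub hd, ha]; push_cast; ring
  set c : ℝ := a ^ 2 - a with hc
  set v : ℝ → ℝ := fun r => u' r + a / r * u r with hv
  set En : ℝ → ℝ := fun r => r ^ (d - 1) * (v r ^ 2 + u r ^ 2) with hEn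
  have hode : ∀ r, 0 < r → u'' r = - u r - 2 * a / r * u' r := by
    intro r hr
    have := bessel_ode i hr
    rw [← hu, ← hu', ← hu''] at this
    field_simp
    rw [ha]
    linarith
  have hdv : ∀ r, 0 < r → HasDerivAt v (- u r - a / r * v r + c / r ^ 2 * u r) r := by
    intro r hr
    have h1 := (hasDerivAt_besselU' i r).add
      (((hasDerivAt_inv hr.ne').const_mul a).mul (hasDerivAt_besselU i r))
    refine (h1.congr_deriv ?_).congr_of_eventuallyEq ?_
    · rw [← hu, ← hu', ← hu'', hode r hr]
      simp only [hv, hc]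
      field_simp
      ring
    · exact Eventually.of_forall fun s => by simp [hv, div_eq_mul_inv, hu, hu']
  have hdE : ∀ r, 0 < r → HasDerivAt En (r ^ (d - 1) * (2 * c / r ^ 2 * (u r * v r))) r := by
    intro r hr
    have h1 := (hasDerivAt_pow (d - 1) r).mul (((hdv r hr).pow 2).add
      ((hasDerivAt_besselU i r).pow 2))
    refine h1.congr_deriv ?_
    have hpow : ((d - 1 : ℕ) : ℝ) * r ^ (d - 1 - 1) = 2 * a / r * r ^ (d - 1) := by
      rcases Nat.eq_zero_or_pos (d - 1) with h | h
      · rw [← h2a, h]; simp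
      · obtain ⟨n, hn⟩ : ∃ n, d - 1 = n + 1 := ⟨d - 1 - 1, by omega⟩
        rw [← h2a, hn, Nat.add_sub_cancel, pow_succ]; field_simp
    have hu'v : besselU' d i r = v r - a / r * u r := by simp only [hv]; ring
    rw [hpow, hu'v, ← hu]
    simp only [Pi.pow_apply, Pi.add_apply, Nat.cast_ofNat, Nat.add_one_sub_one, pow_one]
    field_simp
    ring
  have hEnonneg : ∀ r, 0 < r → 0 ≤ En r := fun r hr => by simp only [hEn]; positivity
  have hmono : AntitoneOn (fun r => En r * Real.exp (|c| / r)) (Ici 1) := by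
    have hD : ∀ r, 0 < r → HasDerivAt (fun r => En r * Real.exp (|c| / r))
        (r ^ (d - 1) * (2 * c / r ^ 2 * (u r * v r)) * Real.exp (|c| / r)
          + En r * (Real.exp (|c| / r) * (|c| * (-(r ^ 2)⁻¹)))) r := by
      intro r hr
      refine (hdE r hr).mul ?_
      have := ((hasDerivAt_inv hr.ne').const_mul |c|).exp
      simpa [div_eq_mul_inv] using this
    refine antitoneOn_of_deriv_nonpos (convex_Ici 1) ?_ ?_ ?_
    · intro r hr
      exact (hD r (zero_lt_one.trans_le hr)).continuousAt.continuousWithinAt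
    · intro r hr
      rw [interior_Ici] at hr
      exact (hD r (zero_lt_one.trans hr)).differentiableAt.differentiableWithinAt
    · intro r hr
      rw [interior_Ici] at hr
      have hr0 : 0 < r := zero_lt_one.trans hr
      rw [(hD r hr0).deriv]
      have h1 : 2 * c * (u r * v r) ≤ |c| * (v r ^ 2 + u r ^ 2) := by
        have h2 : |2 * (u r * v r)| ≤ v r ^ 2 + u r ^ 2 := by
          rw [abs_le]; constructor <;> nlinarith [sq_nonneg (u r + v r), sq_nonneg (u r - v r)]
        calc 2 * c * (u r * v r) = c * (2 * (u r * v r)) := by ring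
          _ ≤ |c * (2 * (u r * v r))| := le_abs_self _
          _ = |c| * |2 * (u r * v r)| := abs_mul _ _
          _ ≤ _ := mul_le_mul_of_nonneg_left h2 (abs_nonneg _)
      have h3 : r ^ (d - 1) * (2 * c / r ^ 2 * (u r * v r)) * Real.exp (|c| / r)
          + En r * (Real.exp (|c| / r) * (|c| * (-(r ^ 2)⁻¹)))
          = (r ^ (d - 1) * Real.exp (|c| / r) * (r ^ 2)⁻¹) *
            (2 * c * (u r * v r) - |c| * (v r ^ 2 + u r ^ 2)) := by
        simp only [hEn]; field_simp; ring
      rw [h3]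
      exact mul_nonpos_of_nonneg_of_nonpos (by positivity) (by linarith)
  have habs : ∀ r, u r ^ 2 ≤ 1 ∧ u' r ^ 2 ≤ 1 := fun r =>
    ⟨(sq_le_one_iff_abs_le_one _).2 (abs_besselU_le i r),
      (sq_le_one_iff_abs_le_one _).2 (abs_besselU'_le i r)⟩
  set K : ℝ := (2 + 2 * a ^ 2) * (En 1 * Real.exp |c|) with hK
  have hK0 : 0 ≤ K := by
    have := hEnonneg 1 one_pos
    positivity
  refine ⟨K + 2, by positivity, fun r hr => ?_⟩
  obtain ⟨h1, h2⟩ := habs r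
  rcases le_or_gt r 1 with hr1 | hr1
  · have := pow_le_one₀ (n := d - 1) hr hr1
    have h0 : 0 ≤ r ^ (d - 1) := by positivity
    nlinarith [sq_nonneg (u r), sq_nonneg (u' r)]
  · have hr0 : 0 < r := by linarith
    have h3 := hmono (mem_Ici.2 le_rfl) (mem_Ici.2 hr1.le) hr1.le
    simp only [div_one] at h3
    have h4 : En r ≤ En 1 * Real.exp |c| := by
      refine le_trans ?_ h3
      exact le_mul_of_one_le_right (hEnonneg r hr0) (Real.one_le_exp (by positivity))
    have h5 : u r ^ 2 + u' r ^ 2 ≤ (2 + 2 * a ^ 2) * (v r ^ 2 + u r ^ 2) := by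
      have e : u' r = v r - a / r * u r := by simp only [hv]; ring
      have h6 : (a / r * u r) ^ 2 ≤ a ^ 2 * u r ^ 2 := by
        rw [mul_pow]
        refine mul_le_mul_of_nonneg_right ?_ (sq_nonneg _)
        exact pow_le_pow_left₀ (by positivity) (div_le_self ha0 hr1.le) 2
      rw [e]
      nlinarith [sq_nonneg (v r + a / r * u r), sq_nonneg (u r), mul_nonneg (sq_nonneg a) (sq_nonneg (v r))]
    calc r ^ (d - 1) * (u r ^ 2 + u' r ^ 2)
        ≤ r ^ (d - 1) * ((2 + 2 * a ^ 2) * (v r ^ 2 + u r ^ 2)) :=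
          mul_le_mul_of_nonneg_left h5 (by positivity)
      _ = (2 + 2 * a ^ 2) * En r := by simp only [hEn]; ring
      _ ≤ (2 + 2 * a ^ 2) * (En 1 * Real.exp |c|) := by gcongr
      _ ≤ K + 2 := by rw [hK]; linarith

end

section

variable {d : ℕ}

/-- The index of the dyadic cube of side length `2 ^ j` containing `x`. -/
def cell (j : ℤ) (x : Ed d) : Fin d → ℤ := fun i => ⌊x i / (2 : ℝ) ^ j⌋

theorem measurable_cell (j : ℤ) : Measurable (cell j : Ed d → Fin d → ℤ) := by
  refine measurable_pi_iff.2 fun i => ?_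
  exact Int.measurable_floor.comp (by fun_prop)

theorem volume_cell (j : ℤ) (x : Ed d) :
    volume {z : Ed d | cell j x = cell j z} = ENNReal.ofReal (2 ^ j) ^ d := by
  have h2 : (0 : ℝ) < 2 ^ j := by positivity
  have : {z : Ed d | cell j x = cell j z} = (WithLp.ofLp : Ed d → Fin d → ℝ) ⁻¹'
      (Set.univ.pi fun i => Set.Ico (2 ^ j * (cell j x i : ℝ)) (2 ^ j * (cell j x i + 1))) := by
    ext z
    simp only [mem_ofPred_eq, Set.mem_preimage, Set.mem_pi, Set.mem_univ, true_imp_iff, funext_iff]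
    refine forall_congr' fun i => ?_
    rw [eq_comm]
    show ⌊z i / (2 : ℝ) ^ j⌋ = _ ↔ _
    rw [Int.floor_eq_iff, Set.mem_Ico, le_div_iff₀' h2, div_lt_iff₀' h2]
  rw [this, (PiLp.volume_preserving_ofLp (Fin d)).measure_preimage
    (MeasurableSet.univ_pi fun i => measurableSet_Ico).nullMeasurableSet, Real.volume_pi_Ico]
  have : ∀ i : Fin d, ENNReal.ofReal (2 ^ j * ((cell j x i : ℝ) + 1) - 2 ^ j * (cell j x i : ℝ))
      = ENNReal.ofReal (2 ^ j) := fun i => by congr 1; ring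
  simp [this]

theorem cell_succ_eq {j : ℤ} {x z : Ed d} (h : cell j x = cell j z) :
    cell (j + 1) x = cell (j + 1) z := by
  have key : ∀ y : Ed d, ∀ i, cell (j + 1) y i = cell j y i / 2 := by
    intro y i
    have := Int.floor_div_natCast (y i / (2 : ℝ) ^ j) 2
    rw [cell, cell, zpow_add₀ two_ne_zero, ← div_div]
    simpa using this
  ext i
  rw [key, key, h]

theorem abs_sub_lt_of_cell_eq {j : ℤ} {x z : Ed d} (h : cell j x = cell j z) (i : Fin d) :
    |x i - z i| < 2 ^ j := by
  have h2 : (0 : ℝ) < 2 ^ j := by positivity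
  have := Int.abs_sub_lt_one_of_floor_eq_floor (congrFun h i)
  rwa [← sub_div, abs_div, abs_of_pos h2, div_lt_one h2] at this

theorem norm_sub_le_of_cell_eq {j : ℤ} {x z : Ed d} (h : cell j x = cell j z) :
    ‖x - z‖ ≤ d * 2 ^ j := by
  have h1 : ‖x - z‖ ≤ ∑ i, ‖(x - z) i‖ := by
    have := norm_sum_le (Finset.univ : Finset (Fin d))
      (fun i => (EuclideanSpace.single i ((x - z) i) : Ed d))
    simp only [PiLp.norm_single] at this
    refine le_trans (le_of_eq ?_) this
    congr 1
    ext i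
    simp
  refine h1.trans ?_
  calc ∑ i, ‖(x - z) i‖ ≤ ∑ i : Fin d, (2 : ℝ) ^ j :=
        Finset.sum_le_sum fun i _ => (abs_sub_lt_of_cell_eq h i).le
    _ = d * 2 ^ j := by simp

/-- The kernel of the conditional expectation onto dyadic cubes of side length `2 ^ j`. -/
def cellKer (j : ℤ) (x z : Ed d) : ℝ≥0∞ :=
  {p : Ed d × Ed d | cell j p.1 = cell j p.2}.indicator (fun _ => (ENNReal.ofReal (2 ^ j) ^ d)⁻¹) (x, z)

theorem measurable_cellKer (j : ℤ) : Measurable fun p : Ed d × Ed d => cellKer j p.1 p.2 :=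
  Measurable.indicator measurable_const (measurableSet_eq_fun
    ((measurable_cell j).comp measurable_fst) ((measurable_cell j).comp measurable_snd))

theorem cellKer_comm (j : ℤ) (x z : Ed d) : cellKer j x z = cellKer j z x := by
  simp only [cellKer, Set.indicator, mem_ofPred_eq, eq_comm]

theorem ofReal_two_zpow_pow_ne_zero (j : ℤ) : ENNReal.ofReal (2 ^ j) ^ d ≠ 0 :=
  pow_ne_zero _ (by rw [Ne, ENNReal.ofReal_eq_zero, not_le]; positivity)

theorem ofReal_two_zpow_pow_ne_top (j : ℤ) : ENNReal.ofReal (2 ^ j) ^ d ≠ ∞ :=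
  ENNReal.pow_ne_top ENNReal.ofReal_ne_top

theorem cellKer_le (j : ℤ) (x z : Ed d) : cellKer j x z ≤ (ENNReal.ofReal (2 ^ j) ^ d)⁻¹ :=
  Set.indicator_le_self' (fun _ _ => zero_le) _

theorem cellKer_ne_top (j : ℤ) (x z : Ed d) : cellKer j x z ≠ ∞ :=
  ((cellKer_le j x z).trans_lt (ENNReal.inv_lt_top.2
    (pos_iff_ne_zero.2 (ofReal_two_zpow_pow_ne_zero j)))).ne

theorem cellKer_eq_zero {j : ℤ} {x z : Ed d} (h : cell j x ≠ cell j z) : cellKer j x z = 0 :=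
  Set.indicator_of_notMem (by simpa using h) _

theorem lintegral_cellKer (j : ℤ) (x : Ed d) : ∫⁻ z, cellKer j x z = 1 := by
  have : ∀ z, cellKer j x z = {z : Ed d | cell j x = cell j z}.indicator
      (fun _ => (ENNReal.ofReal (2 ^ j) ^ d)⁻¹) z := fun z => rfl
  simp_rw [this]
  rw [lintegral_indicator_const, volume_cell,
    ENNReal.inv_mul_cancel (ofReal_two_zpow_pow_ne_zero j) (ofReal_two_zpow_pow_ne_top j)]
  exact measurableSet_eq_fun measurable_const (measurable_cell j)

theorem cellKer_succ (j : ℤ) (x z : Ed d) : cellKer j x z ≤ 2 ^ d * cellKer (j + 1) x z := by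
  by_cases h : cell j x = cell j z
  · have h1 : cellKer j x z = (ENNReal.ofReal (2 ^ j) ^ d)⁻¹ :=
      Set.indicator_of_mem (by exact h) _
    have h2 : cellKer (j + 1) x z = (ENNReal.ofReal (2 ^ (j + 1)) ^ d)⁻¹ :=
      Set.indicator_of_mem (by exact cell_succ_eq h) _
    rw [h1, h2, zpow_add₀ two_ne_zero, zpow_one, ENNReal.ofReal_mul (by positivity), mul_pow,
      ENNReal.mul_inv (Or.inl (ofReal_two_zpow_pow_ne_zero j))
      (Or.inl (ofReal_two_zpow_pow_ne_top j)), mul_left_comm]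
    simp only [ENNReal.ofReal_ofNat]
    rw [ENNReal.mul_inv_cancel (by simp) (by simp), mul_one]
  · rw [cellKer_eq_zero h]; exact zero_le

/-- Averages over dyadic cubes. -/
def cellAvg (j : ℤ) (h : Ed d → ℝ≥0∞) (x : Ed d) : ℝ≥0∞ := ∫⁻ z, cellKer j x z * h z

theorem measurable_cellAvg (j : ℤ) {h : Ed d → ℝ≥0∞} (hh : Measurable h) :
    Measurable (cellAvg j h) :=
  ((measurable_cellKer j).mul (hh.comp measurable_snd)).lintegral_prod_right'

theorem cellKer_congr {j : ℤ} {x x' : Ed d} (h : cell j x = cell j x') (z : Ed d) :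
    cellKer j x z = cellKer j x' z := by
  simp only [cellKer, Set.indicator, mem_ofPred_eq, h]

theorem cellAvg_congr {j : ℤ} {x x' : Ed d} (h : cell j x = cell j x') (f : Ed d → ℝ≥0∞) :
    cellAvg j f x = cellAvg j f x' := by
  simp only [cellAvg, cellKer_congr h]

theorem cellAvg_le_succ (j : ℤ) (h : Ed d → ℝ≥0∞) (x : Ed d) :
    cellAvg j h x ≤ 2 ^ d * cellAvg (j + 1) h x := by
  rw [cellAvg, cellAvg, ← lintegral_const_mul' _ _ (by simp)]
  refine lintegral_mono fun z => ?_
  rw [← mul_assoc]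
  gcongr
  exact cellKer_succ j x z

theorem cell_eq_of_le {i j : ℤ} (hij : i ≤ j) {x z : Ed d} (h : cell i x = cell i z) :
    cell j x = cell j z := by
  induction j, hij using Int.leInduction with
  | base => exact h
  | succ k _ ih => exact cell_succ_eq ih

/-- `S` is a union of dyadic cubes of side length `2 ^ j`. -/
def IsCellUnion (j : ℤ) (S : Set (Ed d)) : Prop :=
  ∀ x z, cell j x = cell j z → x ∈ S → z ∈ S

theorem IsCellUnion.lintegral_cellAvg {j : ℤ} {S : Set (Ed d)} (hS : IsCellUnion j S)
    (hm : MeasurableSet S) {h : Ed d → ℝ≥0∞} (hh : Measurable h) :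
    ∫⁻ x in S, cellAvg j h x = ∫⁻ x in S, h x := by
  rw [← lintegral_indicator hm, ← lintegral_indicator hm]
  have h1 : ∀ x, S.indicator (cellAvg j h) x = ∫⁻ z, cellKer j x z * S.indicator h z := by
    intro x
    by_cases hx : x ∈ S
    · rw [Set.indicator_of_mem hx]
      refine lintegral_congr fun z => ?_
      by_cases hz : cell j x = cell j z
      · rw [Set.indicator_of_mem (hS x z hz hx)]
      · rw [cellKer_eq_zero hz, zero_mul, zero_mul]
    · rw [Set.indicator_of_notMem hx]
      symm
      rw [lintegral_eq_zero_iff' (by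
        exact (((measurable_cellKer j).comp (measurable_const.prodMk measurable_id)).mul
          (hh.indicator hm)).aemeasurable)]
      refine ae_of_all _ fun z => ?_
      by_cases hz : cell j x = cell j z
      · show cellKer j x z * S.indicator h z = 0
        rw [Set.indicator_of_notMem (fun h' => hx (hS z x hz.symm h')), mul_zero]
      · simp [cellKer_eq_zero hz]
  simp_rw [h1]
  rw [lintegral_lintegral_swap (by
    exact ((measurable_cellKer j).mul ((hh.indicator hm).comp measurable_snd)).aemeasurable)]
  refine lintegral_congr fun z => ?_
  simp_rw [cellKer_comm j _ z]
  rw [lintegral_mul_const _ (by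
    exact (measurable_cellKer j).comp (measurable_const.prodMk measurable_id)),
    lintegral_cellKer, one_mul]

/-- The union of the translates of `S` by vectors `2 ^ j v`, with `v` in `{-1, 0, 1} ^ d`. -/
def fatten (j : ℤ) (S : Set (Ed d)) : Set (Ed d) :=
  ⋃ v : Fin d → Fin 3,
    (fun x : Ed d => x - WithLp.toLp 2 fun i => (2 : ℝ) ^ j * (((v i : ℕ) : ℝ) - 1)) ⁻¹' S

theorem measurableSet_fatten (j : ℤ) {S : Set (Ed d)} (hS : MeasurableSet S) :
    MeasurableSet (fatten j S) :=
  MeasurableSet.iUnion fun v => hS.preimage (by fun_prop)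

theorem volume_fatten_le (j : ℤ) {S : Set (Ed d)} (hS : MeasurableSet S) :
    volume (fatten j S) ≤ 3 ^ d * volume S := by
  refine (measure_iUnion_le _).trans ?_
  rw [tsum_fintype]
  have : ∀ w : Ed d, volume ((fun x : Ed d => x - w) ⁻¹' S) = volume S := fun w =>
    (measurePreserving_sub_right volume w).measure_preimage hS.nullMeasurableSet
  simp_rw [this]
  simp

theorem IsCellUnion.le_norm_sub {j : ℤ} {S : Set (Ed d)} (hS : IsCellUnion j S) {x y : Ed d}
    (hx : x ∉ fatten j S) (hy : y ∈ S) : 2 ^ j ≤ ‖x - y‖ := by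
  by_contra! hlt
  apply hx
  have h2 : (0 : ℝ) < 2 ^ j := by positivity
  have hi : ∀ i, ∃ v : Fin 3, cell j x i = cell j y i + ((v : ℕ) : ℤ) - 1 := by
    intro i
    have h1 : |x i - y i| < 2 ^ j := lt_of_le_of_lt (by simpa using PiLp.norm_apply_le (x - y) i) hlt
    have h3 : |x i / 2 ^ j - y i / 2 ^ j| < 1 := by
      rwa [← sub_div, abs_div, abs_of_pos h2, div_lt_one h2]
    rw [abs_lt] at h3
    have ha : cell j x i ≤ cell j y i + 1 := by
      rw [cell, cell, ← Int.floor_add_one]; exact Int.floor_mono (by linarith)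
    have hb : cell j y i ≤ cell j x i + 1 := by
      rw [cell, cell, ← Int.floor_add_one]; exact Int.floor_mono (by linarith)
    refine ⟨⟨(cell j x i - cell j y i + 1).toNat, by omega⟩, ?_⟩
    simp only
    omega
  choose v hv using hi
  refine Set.mem_iUnion.2 ⟨v, hS y _ ?_ hy⟩
  ext i
  have : (x - WithLp.toLp 2 fun i => (2 : ℝ) ^ j * (((v i : ℕ) : ℝ) - 1)) i / 2 ^ j
      = x i / 2 ^ j - ((((v i : ℕ) : ℤ) - 1 : ℤ) : ℝ) := by
    simp; field_simp
  have h4 := hv i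
  simp only [cell] at h4 ⊢
  rw [this, Int.floor_sub_intCast]
  omega

end

section

variable {d : ℕ}

/-- Dilates of a nonnegative kernel to scale `2 ^ k`. -/
def edil (k : ℤ) (χ : Ed d → ℝ≥0∞) (x : Ed d) : ℝ≥0∞ :=
  (ENNReal.ofReal (2 ^ k) ^ d)⁻¹ * χ (((2 : ℝ) ^ k)⁻¹ • x)

/-- Dilates of a complex kernel to scale `2 ^ k`. -/
def dil (k : ℤ) (Ψ : Ed d → ℂ) (x : Ed d) : ℂ :=
  (((2 : ℝ) ^ k) ^ d)⁻¹ • Ψ (((2 : ℝ) ^ k)⁻¹ • x)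

theorem lintegral_edil (k : ℤ) {χ : Ed d → ℝ≥0∞} (hχ : Measurable χ) :
    ∫⁻ x, edil k χ x = ∫⁻ x, χ x := by
  have h2 : ((2 : ℝ) ^ k)⁻¹ ≠ 0 := by positivity
  have h := Measure.map_addHaar_smul (volume : Measure (Ed d)) h2
  have h3 : ∫⁻ x, χ x ∂(Measure.map (((2 : ℝ) ^ k)⁻¹ • ·) (volume : Measure (Ed d)))
      = ∫⁻ x, χ (((2 : ℝ) ^ k)⁻¹ • x) :=
    lintegral_map hχ (measurable_const_smul _)
  simp only [edil]
  rw [lintegral_const_mul' _ _ (ENNReal.inv_ne_top.2 (ofReal_two_zpow_pow_ne_zero k)), ← h3, h,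
    lintegral_smul_measure, smul_eq_mul, ← mul_assoc, finrank_euclideanSpace, Fintype.card_fin,
    inv_pow, inv_inv, abs_of_pos (by positivity), ENNReal.ofReal_pow (by positivity),
    ENNReal.inv_mul_cancel (ofReal_two_zpow_pow_ne_zero k) (ofReal_two_zpow_pow_ne_top k), one_mul]

theorem enorm_dil (k : ℤ) (Ψ : Ed d → ℂ) (x : Ed d) :
    ‖dil k Ψ x‖ₑ = edil k (fun x => ‖Ψ x‖ₑ) x := by
  have h2 : (0 : ℝ) < (2 ^ k) ^ d := by positivity
  rw [dil, edil, enorm_smul, Real.enorm_of_nonneg (by positivity), ENNReal.ofReal_inv_of_pos h2,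
    ENNReal.ofReal_pow (by positivity)]

theorem Measurable.edil {k : ℤ} {χ : Ed d → ℝ≥0∞} (hχ : Measurable χ) : Measurable (edil k χ) :=
  (hχ.comp (measurable_const_smul _)).const_mul _

theorem enorm_eq_two_zpow_mul (k : ℤ) (x : Ed d) :
    ‖x‖ₑ = ENNReal.ofReal (2 ^ k) * ‖((2 : ℝ) ^ k)⁻¹ • x‖ₑ := by
  have h2 : (0 : ℝ) < 2 ^ k := by positivity
  rw [← Real.enorm_of_nonneg h2.le, ← enorm_smul, smul_inv_smul₀ h2.ne']

theorem lintegral_enorm_mul_edil (k : ℤ) {χ : Ed d → ℝ≥0∞} (hχ : Measurable χ) :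
    ∫⁻ x, ‖x‖ₑ * edil k χ x = ENNReal.ofReal (2 ^ k) * ∫⁻ x, ‖x‖ₑ * χ x := by
  rw [← lintegral_edil k (χ := fun x => ‖x‖ₑ * χ x) (by fun_prop),
    ← lintegral_const_mul' _ _ (by simp)]
  refine lintegral_congr fun x => ?_
  simp only [edil]
  rw [enorm_eq_two_zpow_mul k x]
  ring

/-- Convolution of a kernel with a function. -/
def kconv (K f : Ed d → ℂ) (x : Ed d) : ℂ := ∫ z, K (x - z) * f z

/-- Bounded, integrable, measurable functions. -/
structure Nice (f : Ed d → ℂ) : Prop where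
  measurable : Measurable f
  integrable : Integrable f
  bounded : ∃ M : ℝ, ∀ x, ‖f x‖ ≤ M

/-- Kernels admissible for Calderón–Zygmund theory. -/
structure GoodKernel (Ψ : Ed d → ℂ) : Prop where
  continuous : Continuous Ψ
  bounded : ∃ M : ℝ, ∀ x, ‖Ψ x‖ ≤ M
  integral_ne_top : ∫⁻ x, ‖Ψ x‖ₑ ≠ ∞
  moment_ne_top : ∫⁻ x, ‖x‖ₑ * ‖Ψ x‖ₑ ≠ ∞
  modulus : ∃ A : ℝ≥0∞, A ≠ ∞ ∧ ∀ h, ∫⁻ x, ‖Ψ (x - h) - Ψ x‖ₑ ≤ A * ‖h‖ₑ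

/-- Nonnegative kernels with finite first moment. -/
structure GoodMajorant (χ : Ed d → ℝ≥0∞) : Prop where
  measurable : Measurable χ
  integral_ne_top : ∫⁻ x, χ x ≠ ∞
  moment_ne_top : ∫⁻ x, ‖x‖ₑ * χ x ≠ ∞

theorem GoodKernel.continuous_dil {Ψ : Ed d → ℂ} (h : GoodKernel Ψ) (k : ℤ) :
    Continuous (dil k Ψ) := by
  have := h.continuous
  unfold dil
  fun_prop

theorem GoodKernel.bounded_dil {Ψ : Ed d → ℂ} (h : GoodKernel Ψ) (k : ℤ) :
    ∃ M : ℝ, ∀ x, ‖dil k Ψ x‖ ≤ M := by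
  obtain ⟨M, hM⟩ := h.bounded
  refine ⟨‖(((2 : ℝ) ^ k) ^ d)⁻¹‖ * M, fun x => ?_⟩
  rw [dil, norm_smul]
  gcongr
  exact hM _

theorem GoodKernel.lintegral_dil {Ψ : Ed d → ℂ} (h : GoodKernel Ψ) (k : ℤ) :
    ∫⁻ x, ‖dil k Ψ x‖ₑ = ∫⁻ x, ‖Ψ x‖ₑ := by
  simp_rw [enorm_dil]
  exact lintegral_edil k h.continuous.measurable.enorm

theorem GoodKernel.lintegral_enorm_mul_dil {Ψ : Ed d → ℂ} (h : GoodKernel Ψ) (k : ℤ) :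
    ∫⁻ x, ‖x‖ₑ * ‖dil k Ψ x‖ₑ = ENNReal.ofReal (2 ^ k) * ∫⁻ x, ‖x‖ₑ * ‖Ψ x‖ₑ := by
  simp_rw [enorm_dil]
  exact lintegral_enorm_mul_edil k h.continuous.measurable.enorm

theorem lintegral_dil_sub_le {Ψ : Ed d → ℂ} (hc : Continuous Ψ) {A : ℝ≥0∞}
    (hA : ∀ h, ∫⁻ x, ‖Ψ (x - h) - Ψ x‖ₑ ≤ A * ‖h‖ₑ) (k : ℤ) (y z : Ed d) :
    ∫⁻ x, ‖dil k Ψ (x - y) - dil k Ψ (x - z)‖ₑ ≤ A * (ENNReal.ofReal (2 ^ k))⁻¹ * ‖y - z‖ₑ := by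
  have h1 : ∀ x, ‖dil k Ψ (x - y) - dil k Ψ (x - z)‖ₑ = edil k (fun u =>
      ‖Ψ (u - ((2 : ℝ) ^ k)⁻¹ • (y - z)) - Ψ u‖ₑ) (x - z) := by
    intro x
    have h2 : (0 : ℝ) < (2 ^ k) ^ d := by positivity
    rw [dil, dil, edil, ← smul_sub, enorm_smul, Real.enorm_of_nonneg (by positivity),
      ENNReal.ofReal_inv_of_pos h2, ENNReal.ofReal_pow (by positivity), ← smul_sub]
    congr 5
    abel_nf
  simp_rw [h1]
  rw [lintegral_sub_right_eq_self (μ := volume) (fun x => edil k (fun u =>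
      ‖Ψ (u - ((2 : ℝ) ^ k)⁻¹ • (y - z)) - Ψ u‖ₑ) x) z, lintegral_edil k (by fun_prop)]
  refine (hA _).trans (le_of_eq ?_)
  rw [enorm_smul, Real.enorm_of_nonneg (by positivity), ENNReal.ofReal_inv_of_pos (by positivity),
    mul_assoc]

theorem Nice.integrable_mul {f K : Ed d → ℂ} (hf : Nice f) (hK : Continuous K)
    (hb : ∃ M : ℝ, ∀ x, ‖K x‖ ≤ M) (x : Ed d) : Integrable fun z => K (x - z) * f z := by
  obtain ⟨M, hM⟩ := hb
  exact hf.integrable.bdd_mul (c := M) (by fun_prop) (ae_of_all _ fun z => hM _)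

theorem measurable_kconv {f K : Ed d → ℂ} (hf : Measurable f) (hK : Measurable K) :
    Measurable (kconv K f) := by
  have : Measurable fun p : Ed d × Ed d => K (p.1 - p.2) * f p.2 :=
    (hK.comp (measurable_fst.sub measurable_snd)).mul (hf.comp measurable_snd)
  exact (this.stronglyMeasurable.integral_prod_right').measurable

theorem enorm_kconv_le (K f : Ed d → ℂ) (x : Ed d) :
    ‖kconv K f x‖ₑ ≤ ∫⁻ z, ‖K (x - z)‖ₑ * ‖f z‖ₑ := by
  refine (enorm_integral_le_lintegral_enorm _).trans (le_of_eq ?_)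
  simp_rw [enorm_mul]

/-- The averaged Littlewood–Paley pieces. -/
def lpMaj (χ : Ed d → ℝ≥0∞) (Ψ : Ed d → ℂ) (k : ℤ) (f : Ed d → ℂ) (x : Ed d) : ℝ≥0∞ :=
  ∫⁻ z, edil k χ (x - z) * ‖kconv (dil k Ψ) f z‖ₑ

theorem measurable_lpMaj {χ : Ed d → ℝ≥0∞} {Ψ f : Ed d → ℂ} (hχ : GoodMajorant χ)
    (hΨ : GoodKernel Ψ) (hf : Nice f) (k : ℤ) : Measurable (lpMaj χ Ψ k f) := by
  have h1 := measurable_kconv hf.measurable (hΨ.continuous_dil k).measurable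
  have : Measurable fun p : Ed d × Ed d => edil k χ (p.1 - p.2) * ‖kconv (dil k Ψ) f p.2‖ₑ :=
    (hχ.measurable.edil.comp (measurable_fst.sub measurable_snd)).mul
      ((h1.comp measurable_snd).enorm)
  exact this.lintegral_prod_right'

theorem Nice.add {f g : Ed d → ℂ} (hf : Nice f) (hg : Nice g) : Nice fun x => f x + g x := by
  obtain ⟨M, hM⟩ := hf.bounded
  obtain ⟨N, hN⟩ := hg.bounded
  exact ⟨hf.measurable.add hg.measurable, hf.integrable.add hg.integrable, M + N,
    fun x => (norm_add_le _ _).trans (add_le_add (hM x) (hN x))⟩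

theorem Nice.zero : Nice (fun _ : Ed d => (0 : ℂ)) :=
  ⟨measurable_const, integrable_zero _ _ _, 0, fun _ => by simp⟩

theorem Nice.sum {ι : Type*} (s : Finset ι) {f : ι → Ed d → ℂ} (hf : ∀ i ∈ s, Nice (f i)) :
    Nice fun x => ∑ i ∈ s, f i x := by
  classical
  induction s using Finset.induction_on with
  | empty => simpa using Nice.zero
  | insert a s ha ih =>
    simp_rw [Finset.sum_insert ha]
    exact (hf a (Finset.mem_insert_self a s)).add
      (ih fun i hi => hf i (Finset.mem_insert_of_mem hi))

theorem lpMaj_sum_le {χ : Ed d → ℝ≥0∞} {Ψ : Ed d → ℂ} (hχ : GoodMajorant χ)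
    (hΨ : GoodKernel Ψ) {ι : Type*} (s : Finset ι) {f : ι → Ed d → ℂ} (hf : ∀ i ∈ s, Nice (f i))
    (k : ℤ) (x : Ed d) :
    lpMaj χ Ψ k (fun x => ∑ i ∈ s, f i x) x ≤ ∑ i ∈ s, lpMaj χ Ψ k (f i) x := by
  simp only [lpMaj]
  rw [← lintegral_finsetSum']
  · refine lintegral_mono fun z => ?_
    have h1 : kconv (dil k Ψ) (fun x => ∑ i ∈ s, f i x) z = ∑ i ∈ s, kconv (dil k Ψ) (f i) z := by
      simp only [kconv, Finset.mul_sum]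
      exact integral_finsetSum _ fun i hi =>
        (hf i hi).integrable_mul (hΨ.continuous_dil k) (hΨ.bounded_dil k) z
    simp only [h1]
    rw [← Finset.mul_sum]
    gcongr
    exact enorm_sum_le _ _
  · intro i hi
    refine Measurable.aemeasurable ?_
    exact (hχ.measurable.edil.comp (measurable_const.sub measurable_id)).mul
      (measurable_kconv (hf i hi).measurable (hΨ.continuous_dil k).measurable).enorm

theorem lintegral_lintegral_sub_mul {χ h : Ed d → ℝ≥0∞} (hχ : Measurable χ) (hh : Measurable h) :
    ∫⁻ x, ∫⁻ z, χ (x - z) * h z = (∫⁻ x, χ x) * ∫⁻ z, h z := by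
  rw [lintegral_lintegral_swap (by
    exact ((hχ.comp (measurable_fst.sub measurable_snd)).mul
      (hh.comp measurable_snd)).aemeasurable)]
  rw [← lintegral_const_mul _ hh]
  refine lintegral_congr fun z => ?_
  rw [lintegral_mul_const _ (by fun_prop), lintegral_sub_right_eq_self (fun x => χ x)]

theorem lintegral_lpMaj {χ : Ed d → ℝ≥0∞} {Ψ f : Ed d → ℂ} (hχ : GoodMajorant χ)
    (hΨ : GoodKernel Ψ) (hf : Nice f) (k : ℤ) :
    ∫⁻ x, lpMaj χ Ψ k f x = (∫⁻ x, χ x) * ∫⁻ x, ‖kconv (dil k Ψ) f x‖ₑ := by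
  simp only [lpMaj]
  rw [lintegral_lintegral_sub_mul hχ.measurable.edil
    (measurable_kconv hf.measurable (hΨ.continuous_dil k).measurable).enorm,
    lintegral_edil k hχ.measurable]

end

section

variable {d : ℕ}

/-- Conditional expectation onto dyadic cubes of side length `2 ^ j`. -/
def cellExp (j : ℤ) (f : Ed d → ℂ) (x : Ed d) : ℂ := ∫ z, ((cellKer j x z).toReal : ℂ) * f z

theorem enorm_toReal_cellKer (j : ℤ) (x z : Ed d) :
    ‖((cellKer j x z).toReal : ℂ)‖ₑ = cellKer j x z := by
  rw [← ofReal_norm, Complex.norm_real, Real.norm_of_nonneg ENNReal.toReal_nonneg,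
    ENNReal.ofReal_toReal (cellKer_ne_top j x z)]

theorem enorm_cellExp_le (j : ℤ) (f : Ed d → ℂ) (x : Ed d) :
    ‖cellExp j f x‖ₑ ≤ cellAvg j (fun z => ‖f z‖ₑ) x := by
  refine (enorm_integral_le_lintegral_enorm _).trans (le_of_eq ?_)
  simp_rw [enorm_mul, enorm_toReal_cellKer]
  rfl

theorem measurable_toReal_cellKer (j : ℤ) :
    Measurable fun p : Ed d × Ed d => ((cellKer j p.1 p.2).toReal : ℂ) :=
  Complex.measurable_ofReal.comp (measurable_cellKer j).ennreal_toReal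

theorem measurable_cellExp (j : ℤ) {f : Ed d → ℂ} (hf : Measurable f) :
    Measurable (cellExp j f) := by
  have : Measurable fun p : Ed d × Ed d => ((cellKer j p.1 p.2).toReal : ℂ) * f p.2 :=
    (measurable_toReal_cellKer j).mul (hf.comp measurable_snd)
  exact (this.stronglyMeasurable.integral_prod_right').measurable

theorem cellAvg_le_of_le {j : ℤ} {h : Ed d → ℝ≥0∞} {M : ℝ≥0∞} (hM : ∀ x, h x ≤ M) (x : Ed d) :
    cellAvg j h x ≤ M := by
  calc cellAvg j h x ≤ ∫⁻ z, cellKer j x z * M := by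
        refine lintegral_mono fun z => ?_
        gcongr
        exact hM z
    _ = M := by
        have hm : Measurable fun z => cellKer j x z :=
          (measurable_cellKer j).comp (measurable_const.prodMk measurable_id)
        rw [lintegral_mul_const _ hm, lintegral_cellKer, one_mul]

/-- The oscillation of `f` over the cubes of side length `2 ^ j` making up `W`. -/
def badPart (j : ℤ) (W : Set (Ed d)) (f : Ed d → ℂ) : Ed d → ℂ :=
  W.indicator fun x => f x - cellExp j f x

theorem lintegral_enorm_badPart_le {j : ℤ} {W : Set (Ed d)} (hW : IsCellUnion j W)
    (hm : MeasurableSet W) {f : Ed d → ℂ} (hf : Measurable f) :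
    ∫⁻ x, ‖badPart j W f x‖ₑ ≤ 2 * ∫⁻ x in W, ‖f x‖ₑ := by
  simp_rw [badPart, enorm_indicator_eq_indicator_enorm]
  rw [lintegral_indicator hm]
  calc ∫⁻ x in W, ‖f x - cellExp j f x‖ₑ
      ≤ ∫⁻ x in W, (‖f x‖ₑ + cellAvg j (fun z => ‖f z‖ₑ) x) := by
        refine lintegral_mono fun x => ?_
        exact (enorm_sub_le).trans (add_le_add le_rfl (enorm_cellExp_le j f x))
    _ = 2 * ∫⁻ x in W, ‖f x‖ₑ := by
        rw [lintegral_add_left hf.enorm, hW.lintegral_cellAvg hm hf.enorm, two_mul]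

theorem Nice.badPart {f : Ed d → ℂ} (hf : Nice f) {j : ℤ} {W : Set (Ed d)} (hW : IsCellUnion j W)
    (hm : MeasurableSet W) : Nice (badPart j W f) := by
  have hmeas : Measurable (_root_.badPart j W f) :=
    (hf.measurable.sub (measurable_cellExp j hf.measurable)).indicator hm
  refine ⟨hmeas, ⟨hmeas.aestronglyMeasurable, ?_⟩, ?_⟩
  · refine (lintegral_enorm_badPart_le hW hm hf.measurable).trans_lt ?_
    refine ENNReal.mul_lt_top (by simp) ?_
    exact (setLIntegral_le_lintegral _ _).trans_lt hf.integrable.2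
  · obtain ⟨M, hM⟩ := hf.bounded
    have hM0 : 0 ≤ M := (norm_nonneg _).trans (hM 0)
    refine ⟨M + M, fun x => ?_⟩
    rw [_root_.badPart]
    refine (norm_indicator_le_norm_self _ _).trans ((norm_sub_le _ _).trans ?_)
    refine add_le_add (hM x) ?_
    have h1 := (enorm_cellExp_le j f x).trans (cellAvg_le_of_le (M := ENNReal.ofReal M)
      (fun z => by
        rw [← ofReal_norm]
        exact ENNReal.ofReal_le_ofReal (hM z)) x)
    rwa [← ofReal_norm, ENNReal.ofReal_le_ofReal_iff hM0] at h1

theorem kconv_badPart {f K : Ed d → ℂ} (hf : Nice f) (hK : Continuous K)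
    (hb : ∃ M : ℝ, ∀ x, ‖K x‖ ≤ M) {j : ℤ} {W : Set (Ed d)} (hW : IsCellUnion j W)
    (hm : MeasurableSet W) (x : Ed d) :
    kconv K (badPart j W f) x = ∫ y, W.indicator f y *
      ∫ z, ((cellKer j y z).toReal : ℂ) * (K (x - y) - K (x - z)) := by
  obtain ⟨M, hM⟩ := hb
  have hcm : ∀ y : Ed d, Measurable fun z => ((cellKer j y z).toReal : ℂ) := fun y =>
    (measurable_toReal_cellKer j).comp (measurable_const.prodMk measurable_id)
  have hci : ∀ y : Ed d, Integrable fun z => ((cellKer j y z).toReal : ℂ) := fun y => by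
    refine ⟨(hcm y).aestronglyMeasurable, ?_⟩
    rw [HasFiniteIntegral]
    simp_rw [enorm_toReal_cellKer, lintegral_cellKer]
    simp
  have hc1 : ∀ y : Ed d, ∫ z, ((cellKer j y z).toReal : ℂ) = 1 := by
    intro y
    rw [integral_complex_ofReal, integral_toReal, lintegral_cellKer]
    · simp
    · exact ((measurable_cellKer j).comp (measurable_const.prodMk measurable_id)).aemeasurable
    · exact ae_of_all _ fun z => (cellKer_ne_top j y z).lt_top
  have hfW : Integrable (W.indicator f) := hf.integrable.indicator hm
  have hInt1 : Integrable fun y => K (x - y) * W.indicator f y :=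
    hfW.bdd_mul (c := M) (by fun_prop) (ae_of_all _ fun z => hM _)
  set Φ : Ed d → Ed d → ℂ := fun y z => K (x - y) * (((cellKer j y z).toReal : ℂ) *
    W.indicator f z) with hΦ
  have hΦi : Integrable (Function.uncurry Φ) (volume.prod volume) := by
    have hmeas : Measurable (Function.uncurry Φ) := by
      refine Measurable.mul (hK.measurable.comp (measurable_const.sub measurable_fst)) ?_
      exact (measurable_toReal_cellKer j).mul ((hf.measurable.indicator hm).comp measurable_snd)
    rw [integrable_prod_iff' hmeas.aestronglyMeasurable]
    constructor
    · refine ae_of_all _ fun z => ?_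
      simp only [Function.uncurry, hΦ]
      refine Integrable.bdd_mul (c := M) ?_ (by fun_prop) (ae_of_all _ fun z => hM _)
      simp_rw [cellKer_comm j _ z]
      exact (hci z).mul_const _
    · refine Integrable.mono' (g := fun z => M * ‖W.indicator f z‖) (hfW.norm.const_mul _) ?_ ?_
      · exact hmeas.norm.stronglyMeasurable.integral_prod_left'.aestronglyMeasurable
      · refine ae_of_all _ fun z => ?_
        rw [Real.norm_of_nonneg (integral_nonneg fun _ => norm_nonneg _)]
        calc ∫ y, ‖Function.uncurry Φ (y, z)‖
            ≤ ∫ y, M * ‖W.indicator f z‖ * ‖((cellKer j z y).toReal : ℂ)‖ := by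
              refine integral_mono_of_nonneg (ae_of_all _ fun _ => norm_nonneg _)
                ((hci z).norm.const_mul _) (ae_of_all _ fun y => ?_)
              simp only [Function.uncurry, hΦ, norm_mul, cellKer_comm j y z]
              have := hM (x - y)
              calc _ ≤ M * (‖((cellKer j z y).toReal : ℂ)‖ * ‖W.indicator f z‖) := by gcongr
                _ = _ := by ring
          _ = M * ‖W.indicator f z‖ := by
              rw [integral_const_mul]
              have : ∀ y, ‖((cellKer j z y).toReal : ℂ)‖ = (cellKer j z y).toReal := fun y => by
                rw [Complex.norm_real, Real.norm_of_nonneg ENNReal.toReal_nonneg]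
              simp_rw [this]
              have h2 := hc1 z
              rw [integral_complex_ofReal] at h2
              rw [show ∫ y, (cellKer j z y).toReal = 1 by exact_mod_cast h2, mul_one]
  have h1 : ∀ y, K (x - y) * badPart j W f y
      = K (x - y) * W.indicator f y - ∫ z, Φ y z := by
    intro y
    simp only [hΦ, integral_const_mul]
    rw [← mul_sub]
    congr 1
    by_cases hy : y ∈ W
    · rw [badPart, Set.indicator_of_mem hy, Set.indicator_of_mem hy, cellExp]
      congr 1
      refine integral_congr_ae (ae_of_all _ fun z => ?_)
      simp only
      by_cases hz : cell j y = cell j z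
      · rw [Set.indicator_of_mem (hW y z hz hy)]
      · rw [cellKer_eq_zero hz]; simp
    · rw [badPart, Set.indicator_of_notMem hy, Set.indicator_of_notMem hy, zero_sub, eq_comm,
        neg_eq_zero]
      refine integral_eq_zero_of_ae (ae_of_all _ fun z => ?_)
      simp only [Pi.zero_apply]
      by_cases hz : cell j y = cell j z
      · rw [Set.indicator_of_notMem (fun h => hy (hW z y hz.symm h)), mul_zero]
      · rw [cellKer_eq_zero hz]; simp
  rw [kconv]
  simp_rw [h1]
  have hl : Integrable fun y => ∫ z, Φ y z := hΦi.integral_prod_left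
  have hr : Integrable fun z => ∫ y, Φ y z := hΦi.integral_prod_right
  rw [integral_sub hInt1 hl, integral_integral_swap hΦi, ← integral_sub hInt1 hr]
  refine integral_congr_ae (ae_of_all _ fun y => ?_)
  simp only [hΦ]
  have h2 : Integrable fun z => ((cellKer j y z).toReal : ℂ) * K (x - z) :=
    (hci y).mul_bdd (c := M) (by fun_prop) (ae_of_all _ fun z => hM _)
  simp_rw [mul_sub]
  rw [integral_sub ((hci y).mul_const _) h2, integral_mul_const, hc1, one_mul, mul_sub,
    mul_comm (K (x - y))]
  congr 1
  rw [← integral_const_mul]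
  refine integral_congr_ae (ae_of_all _ fun z => ?_)
  simp only [cellKer_comm j z y]
  ring

theorem lintegral_enorm_kconv_badPart_le {f Ψ : Ed d → ℂ} (hf : Nice f) (hΨ : GoodKernel Ψ)
    {A : ℝ≥0∞} (hA : ∀ h, ∫⁻ x, ‖Ψ (x - h) - Ψ x‖ₑ ≤ A * ‖h‖ₑ) (k : ℤ)
    {j : ℤ} {W : Set (Ed d)} (hW : IsCellUnion j W) (hm : MeasurableSet W) :
    ∫⁻ x, ‖kconv (dil k Ψ) (badPart j W f) x‖ₑ ≤
      A * d * ENNReal.ofReal (2 ^ (j - k)) * ∫⁻ x in W, ‖f x‖ₑ := by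
  have hDm : Measurable (dil k Ψ) := (hΨ.continuous_dil k).measurable
  have hcm : ∀ y : Ed d, Measurable fun z => cellKer j y z := fun y =>
    (measurable_cellKer j).comp (measurable_const.prodMk measurable_id)
  have h1 : ∀ x, ‖kconv (dil k Ψ) (badPart j W f) x‖ₑ ≤ ∫⁻ y, W.indicator (fun y => ‖f y‖ₑ) y *
      ∫⁻ z, cellKer j y z * ‖dil k Ψ (x - y) - dil k Ψ (x - z)‖ₑ := by
    intro x
    rw [kconv_badPart hf (hΨ.continuous_dil k) (hΨ.bounded_dil k) hW hm]
    refine (enorm_integral_le_lintegral_enorm _).trans (lintegral_mono fun y => ?_)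
    rw [enorm_mul, enorm_indicator_eq_indicator_enorm]
    gcongr
    refine (enorm_integral_le_lintegral_enorm _).trans (le_of_eq ?_)
    simp_rw [enorm_mul, enorm_toReal_cellKer]
  have hm3 : Measurable fun p : (Ed d × Ed d) × Ed d =>
      cellKer j p.1.2 p.2 * ‖dil k Ψ (p.1.1 - p.1.2) - dil k Ψ (p.1.1 - p.2)‖ₑ := by
    refine ((measurable_cellKer j).comp ((measurable_snd.comp measurable_fst).prodMk
      measurable_snd)).mul ?_
    fun_prop
  calc _ ≤ ∫⁻ x, ∫⁻ y, W.indicator (fun y => ‖f y‖ₑ) y *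
      ∫⁻ z, cellKer j y z * ‖dil k Ψ (x - y) - dil k Ψ (x - z)‖ₑ := lintegral_mono h1
    _ = ∫⁻ y, ∫⁻ x, W.indicator (fun y => ‖f y‖ₑ) y *
      ∫⁻ z, cellKer j y z * ‖dil k Ψ (x - y) - dil k Ψ (x - z)‖ₑ := by
        refine lintegral_lintegral_swap ?_
        exact ((((hf.measurable.enorm).indicator hm).comp measurable_snd).mul
          hm3.lintegral_prod_right').aemeasurable
    _ ≤ ∫⁻ y, W.indicator (fun y => ‖f y‖ₑ) y * (A * d * ENNReal.ofReal (2 ^ (j - k))) := by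
        refine lintegral_mono fun y => ?_
        have hm2 : Measurable fun p : Ed d × Ed d =>
            cellKer j y p.2 * ‖dil k Ψ (p.1 - y) - dil k Ψ (p.1 - p.2)‖ₑ :=
          ((hcm y).comp measurable_snd).mul (by fun_prop)
        simp only
        rw [lintegral_const_mul _ hm2.lintegral_prod_right']
        gcongr
        rw [lintegral_lintegral_swap hm2.aemeasurable]
        calc ∫⁻ z, ∫⁻ x, cellKer j y z * ‖dil k Ψ (x - y) - dil k Ψ (x - z)‖ₑ
            ≤ ∫⁻ z, cellKer j y z * (A * d * ENNReal.ofReal (2 ^ (j - k))) := by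
              refine lintegral_mono fun z => ?_
              simp only
              rw [lintegral_const_mul _ (by fun_prop)]
              by_cases hz : cell j y = cell j z
              · gcongr
                refine (lintegral_dil_sub_le hΨ.continuous hA k y z).trans ?_
                have h2 : ‖y - z‖ₑ ≤ d * ENNReal.ofReal (2 ^ j) := by
                  rw [← ofReal_norm, ← ENNReal.ofReal_natCast,
                    ← ENNReal.ofReal_mul (by positivity)]
                  exact ENNReal.ofReal_le_ofReal (norm_sub_le_of_cell_eq hz)
                have h3 : ENNReal.ofReal (2 ^ (j - k))
                    = (ENNReal.ofReal (2 ^ k))⁻¹ * ENNReal.ofReal (2 ^ j) := by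
                  rw [← ENNReal.ofReal_inv_of_pos (by positivity),
                    ← ENNReal.ofReal_mul (by positivity), zpow_sub₀ two_ne_zero, mul_comm,
                    div_eq_mul_inv]
                rw [h3]
                calc _ ≤ A * (ENNReal.ofReal (2 ^ k))⁻¹ * (d * ENNReal.ofReal (2 ^ j)) := by gcongr
                  _ = _ := by ring
              · rw [cellKer_eq_zero hz, zero_mul, zero_mul]
          _ = _ := by rw [lintegral_mul_const _ (hcm y), lintegral_cellKer, one_mul]
    _ = _ := by
        rw [lintegral_mul_const _ ((hf.measurable.enorm).indicator hm), lintegral_indicator hm,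
          mul_comm]

theorem lintegral_triple_weighted {X D B : Ed d → ℝ≥0∞} (hXm : Measurable X) (hDm : Measurable D)
    (hB : Measurable B) :
    ∫⁻ x, ∫⁻ z, ∫⁻ y, X (x - z) * D (z - y) * (‖x - z‖ₑ + ‖z - y‖ₑ) * B y =
      ((∫⁻ x, ‖x‖ₑ * X x) * (∫⁻ x, D x) + (∫⁻ x, X x) * ∫⁻ x, ‖x‖ₑ * D x) * ∫⁻ x, B x := by
  have hm3 : Measurable fun p : (Ed d × Ed d) × Ed d => X (p.1.1 - p.1.2) * D (p.1.2 - p.2) *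
      (‖p.1.1 - p.1.2‖ₑ + ‖p.1.2 - p.2‖ₑ) * B p.2 := by fun_prop
  have hm2 : ∀ z, Measurable fun p : Ed d × Ed d => X (p.1 - z) * D (z - p.2) *
      (‖p.1 - z‖ₑ + ‖z - p.2‖ₑ) * B p.2 := fun z => by fun_prop
  have inner : ∀ z y, ∫⁻ x, X (x - z) * D (z - y) * (‖x - z‖ₑ + ‖z - y‖ₑ) * B y
      = ((∫⁻ x, ‖x‖ₑ * X x) * D (z - y) + (∫⁻ x, X x) * (‖z - y‖ₑ * D (z - y))) * B y := by
    intro z y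
    rw [lintegral_sub_right_eq_self (μ := volume)
      (fun x => X x * D (z - y) * (‖x‖ₑ + ‖z - y‖ₑ) * B y) z]
    have : ∀ x, X x * D (z - y) * (‖x‖ₑ + ‖z - y‖ₑ) * B y
        = (‖x‖ₑ * X x) * (D (z - y) * B y) + X x * (‖z - y‖ₑ * D (z - y) * B y) := by
      intro x; ring
    simp_rw [this]
    rw [lintegral_add_left (by fun_prop), lintegral_mul_const _ (by fun_prop),
      lintegral_mul_const _ (by fun_prop)]
    ring
  have hs : Measurable fun p : Ed d × Ed d => ∫⁻ y, X (p.1 - p.2) * D (p.2 - y) *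
      (‖p.1 - p.2‖ₑ + ‖p.2 - y‖ₑ) * B y := hm3.lintegral_prod_right'
  rw [lintegral_lintegral_swap hs.aemeasurable]
  have h1 : ∀ z, ∫⁻ x, ∫⁻ y, X (x - z) * D (z - y) * (‖x - z‖ₑ + ‖z - y‖ₑ) * B y
      = ∫⁻ y, ((∫⁻ x, ‖x‖ₑ * X x) * D (z - y) + (∫⁻ x, X x) * (‖z - y‖ₑ * D (z - y))) * B y := by
    intro z
    rw [lintegral_lintegral_swap (hm2 z).aemeasurable]
    exact lintegral_congr fun y => inner z y
  simp_rw [h1]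
  rw [lintegral_lintegral_sub_mul (χ := fun u => (∫⁻ x, ‖x‖ₑ * X x) * D u +
      (∫⁻ x, X x) * (‖u‖ₑ * D u)) (by fun_prop) hB,
    lintegral_add_left (by fun_prop), lintegral_const_mul _ (by fun_prop),
    lintegral_const_mul _ (by fun_prop)]

theorem setLIntegral_lpMaj_le {χ : Ed d → ℝ≥0∞} {Ψ b : Ed d → ℂ} (hχ : GoodMajorant χ)
    (hΨ : GoodKernel Ψ) (hb : Nice b) {j k : ℤ} {S : Set (Ed d)} (hS : MeasurableSet S)
    (hSb : ∀ x ∈ S, ∀ y, b y ≠ 0 → 2 ^ j ≤ ‖x - y‖) :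
    ∫⁻ x in S, lpMaj χ Ψ k b x ≤ ENNReal.ofReal (2 ^ (k - j)) *
      ((∫⁻ x, ‖x‖ₑ * χ x) * (∫⁻ x, ‖Ψ x‖ₑ) + (∫⁻ x, χ x) * ∫⁻ x, ‖x‖ₑ * ‖Ψ x‖ₑ) *
      ∫⁻ x, ‖b x‖ₑ := by
  set D : Ed d → ℝ≥0∞ := fun x => ‖dil k Ψ x‖ₑ with hD
  have hDm : Measurable D := (hΨ.continuous_dil k).measurable.enorm
  set X : Ed d → ℝ≥0∞ := edil k χ with hX
  have hXm : Measurable X := hχ.measurable.edil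
  have hbm : Measurable fun x => ‖b x‖ₑ := hb.measurable.enorm
  set δ : ℝ≥0∞ := ENNReal.ofReal (2 ^ j) with hδ
  have hδ0 : δ ≠ 0 := by rw [hδ, Ne, ENNReal.ofReal_eq_zero, not_le]; positivity
  have key : δ * ∫⁻ x in S, lpMaj χ Ψ k b x ≤
      ∫⁻ x, ∫⁻ z, ∫⁻ y, X (x - z) * D (z - y) * (‖x - z‖ₑ + ‖z - y‖ₑ) * ‖b y‖ₑ := by
    rw [← lintegral_const_mul' _ _ ENNReal.ofReal_ne_top]
    refine (setLIntegral_mono' hS fun x hx => ?_).trans (setLIntegral_le_lintegral _ _)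
    rw [lpMaj, ← lintegral_const_mul' _ _ ENNReal.ofReal_ne_top]
    refine lintegral_mono fun z => ?_
    calc δ * (edil k χ (x - z) * ‖kconv (dil k Ψ) b z‖ₑ)
        ≤ δ * (X (x - z) * ∫⁻ y, D (z - y) * ‖b y‖ₑ) := by
          gcongr
          exact enorm_kconv_le _ _ _
      _ = ∫⁻ y, δ * X (x - z) * (D (z - y) * ‖b y‖ₑ) := by
          rw [lintegral_const_mul _ (by fun_prop), mul_assoc]
      _ ≤ _ := by
          refine lintegral_mono fun y => ?_
          by_cases hy : b y = 0
          · simp [hy]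
          · have h1 : δ ≤ ‖x - z‖ₑ + ‖z - y‖ₑ := by
              have h2 : ‖x - y‖ₑ ≤ ‖x - z‖ₑ + ‖z - y‖ₑ := by
                have := enorm_add_le (x - z) (z - y)
                rwa [sub_add_sub_cancel] at this
              refine le_trans ?_ h2
              rw [hδ, ← ofReal_norm]
              exact ENNReal.ofReal_le_ofReal (hSb x hx y hy)
            calc δ * X (x - z) * (D (z - y) * ‖b y‖ₑ)
                ≤ (‖x - z‖ₑ + ‖z - y‖ₑ) * X (x - z) * (D (z - y) * ‖b y‖ₑ) := by gcongr
              _ = _ := by ring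
  rw [lintegral_triple_weighted hXm hDm hbm, hX, hD, hΨ.lintegral_dil, hΨ.lintegral_enorm_mul_dil,
    lintegral_enorm_mul_edil k hχ.measurable, lintegral_edil k hχ.measurable] at key
  have h3 : ENNReal.ofReal (2 ^ (k - j)) = δ⁻¹ * ENNReal.ofReal (2 ^ k) := by
    rw [hδ, ← ENNReal.ofReal_inv_of_pos (by positivity), ← ENNReal.ofReal_mul (by positivity),
      zpow_sub₀ two_ne_zero, mul_comm, div_eq_mul_inv]
  rw [h3]
  calc ∫⁻ x in S, lpMaj χ Ψ k b x = δ⁻¹ * (δ * ∫⁻ x in S, lpMaj χ Ψ k b x) := by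
        rw [← mul_assoc, ENNReal.inv_mul_cancel hδ0 ENNReal.ofReal_ne_top, one_mul]
    _ ≤ _ := mul_le_mul_right key _
    _ = _ := by ring

end

section

variable {d : ℕ}

theorem tsum_two_inv_pow_natAbs_ne_top :
    ∑' k : ℤ, ENNReal.ofReal (2⁻¹ ^ k.natAbs : ℝ) ≠ ∞ := by
  refine Summable.tsum_ofReal_ne_top (Summable.of_nat_of_neg ?_ ?_)
  · simpa using summable_geometric_of_lt_one (r := (2⁻¹ : ℝ)) (by norm_num) (by norm_num)
  · simpa using summable_geometric_of_lt_one (r := (2⁻¹ : ℝ)) (by norm_num) (by norm_num)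

theorem sum_two_inv_pow_natAbs_sub_le (F : Finset ℤ) (j : ℤ) :
    ∑ k ∈ F, ENNReal.ofReal (2⁻¹ ^ (k - j).natAbs : ℝ) ≤
      ∑' k : ℤ, ENNReal.ofReal (2⁻¹ ^ k.natAbs : ℝ) := by
  rw [← (Equiv.subRight j).tsum_eq fun k : ℤ => ENNReal.ofReal (2⁻¹ ^ k.natAbs : ℝ)]
  exact ENNReal.sum_le_tsum F

/-- The points whose stopping cube has side length `2 ^ j`. -/
def stopSet (a : ℤ → Ed d → ℝ≥0∞) (l : ℝ≥0∞) (j₀ j : ℤ) : Set (Ed d) :=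
  {x | (j = j₀ ∨ l < a j x) ∧ ∀ i, j < i → a i x ≤ l}

theorem measurableSet_stopSet {a : ℤ → Ed d → ℝ≥0∞} (ha : ∀ j, Measurable (a j)) (l : ℝ≥0∞)
    (j₀ j : ℤ) : MeasurableSet (stopSet a l j₀ j) := by
  have : stopSet a l j₀ j = ({x | j = j₀} ∪ {x | l < a j x}) ∩ ⋂ i, ⋂ _ : j < i, {x | a i x ≤ l} := by
    ext x
    simp [stopSet]
  rw [this]
  refine ((MeasurableSet.const _).union (measurableSet_lt measurable_const (ha j))).inter ?_
  exact MeasurableSet.iInter fun i => MeasurableSet.iInter fun _ =>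
    measurableSet_le (ha i) measurable_const

theorem exists_mem_stopSet {a : ℤ → Ed d → ℝ≥0∞} {l : ℝ≥0∞} {j₀ J : ℤ} (hJ : j₀ ≤ J)
    (hl : ∀ j, J ≤ j → ∀ x, a j x ≤ l) (x : Ed d) :
    ∃ j ∈ Finset.Icc j₀ J, x ∈ stopSet a l j₀ j := by
  obtain ⟨j, ⟨h1, h2⟩, h3⟩ := Int.exists_greatest_of_bdd
    (P := fun z => j₀ ≤ z ∧ (z = j₀ ∨ l < a z x)) ⟨J, fun z hz => by
      rcases hz.2 with h | h
      · omega
      · by_contra! hlt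
        exact absurd h (not_lt.2 (hl z hlt.le x))⟩ ⟨j₀, le_rfl, Or.inl rfl⟩
  refine ⟨j, Finset.mem_Icc.2 ⟨h1, ?_⟩, h2, fun i hi => ?_⟩
  · rcases h2 with h | h
    · omega
    · by_contra! hlt
      exact absurd h (not_lt.2 (hl j hlt.le x))
  · by_contra! hlt
    exact absurd (h3 i ⟨by omega, Or.inr hlt⟩) (by omega)

theorem stopSet_unique {a : ℤ → Ed d → ℝ≥0∞} {l : ℝ≥0∞} {j₀ i j : ℤ} (hi : j₀ ≤ i) (hj : j₀ ≤ j)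
    {x : Ed d} (h1 : x ∈ stopSet a l j₀ i) (h2 : x ∈ stopSet a l j₀ j) : i = j := by
  rcases lt_trichotomy i j with h | h | h
  · rcases h2.1 with h3 | h3
    · omega
    · exact absurd h3 (not_lt.2 (h1.2 j h))
  · exact h
  · rcases h1.1 with h3 | h3
    · omega
    · exact absurd h3 (not_lt.2 (h2.2 i h))

theorem exists_cellAvg_le (hd : 1 ≤ d) {h : Ed d → ℝ≥0∞} (hi : ∫⁻ x, h x ≠ ∞) {l : ℝ≥0∞}
    (hl : l ≠ 0) (j₀ : ℤ) : ∃ J, j₀ ≤ J ∧ ∀ j, J ≤ j → ∀ x, cellAvg j h x ≤ l := by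
  obtain ⟨n, hn⟩ := ENNReal.exists_nat_mul_gt hl hi
  refine ⟨max j₀ n, le_max_left _ _, fun j hj x => ?_⟩
  have hnj : (n : ℤ) ≤ j := (le_max_right _ _).trans hj
  calc cellAvg j h x ≤ ∫⁻ z, (ENNReal.ofReal (2 ^ j) ^ d)⁻¹ * h z := by
        refine lintegral_mono fun z => ?_
        gcongr
        exact cellKer_le j x z
    _ = (ENNReal.ofReal (2 ^ j) ^ d)⁻¹ * ∫⁻ z, h z :=
        lintegral_const_mul' _ _ (ENNReal.inv_ne_top.2 (ofReal_two_zpow_pow_ne_zero j))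
    _ ≤ (ENNReal.ofReal (2 ^ j) ^ d)⁻¹ * (ENNReal.ofReal (2 ^ j) ^ d * l) := by
        gcongr
        refine hn.le.trans ?_
        gcongr
        have h1 : (n : ℝ≥0∞) ≤ ENNReal.ofReal (2 ^ j) := by
          rw [← ENNReal.ofReal_natCast]
          refine ENNReal.ofReal_le_ofReal ?_
          have h2 : (n : ℝ) ≤ 2 ^ n := by exact_mod_cast (Nat.lt_two_pow_self (n := n)).le
          refine h2.trans ?_
          rw [← zpow_natCast]
          exact zpow_le_zpow_right₀ (by norm_num) hnj
        have h3 : (1 : ℝ≥0∞) ≤ ENNReal.ofReal (2 ^ j) := by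
          rw [ENNReal.one_le_ofReal]
          exact one_le_zpow₀ (by norm_num) (by omega)
        exact h1.trans (le_self_pow₀ h3 (by omega))
    _ = l := by
        rw [← mul_assoc, ENNReal.inv_mul_cancel (ofReal_two_zpow_pow_ne_zero j)
          (ofReal_two_zpow_pow_ne_top j), one_mul]

/-- Calderón–Zygmund decomposition, adapted to a finite family of Littlewood–Paley pieces. -/
theorem exists_calderon_zygmund (hd : 1 ≤ d) {χ : Ed d → ℝ≥0∞} {Ψ : Ed d → ℂ}
    (hχ : GoodMajorant χ) (hΨ : GoodKernel Ψ) :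
    ∃ C : ℝ≥0∞, C ≠ ∞ ∧ ∀ (F : Finset ℤ) (f : Ed d → ℂ), Nice f → ∀ l : ℝ≥0∞, l ≠ 0 →
      ∃ (g b : Ed d → ℂ) (Ω : Set (Ed d)), Nice g ∧ Nice b ∧ (∀ x, f x = g x + b x) ∧
        MeasurableSet Ω ∧ l * volume Ω ≤ C * ∫⁻ x, ‖f x‖ₑ ∧ (∀ x, ‖g x‖ₑ ≤ 2 ^ d * l) ∧
        ∫⁻ x, ‖g x‖ₑ ≤ ∫⁻ x, ‖f x‖ₑ ∧
        ∑ k ∈ F, ∫⁻ x in Ωᶜ, lpMaj χ Ψ k b x ≤ C * ∫⁻ x, ‖f x‖ₑ := by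
  obtain ⟨A, hA, hmod⟩ := hΨ.modulus
  set m : ℝ≥0∞ := (∫⁻ x, ‖x‖ₑ * χ x) * (∫⁻ x, ‖Ψ x‖ₑ) + (∫⁻ x, χ x) * ∫⁻ x, ‖x‖ₑ * ‖Ψ x‖ₑ with hm
  have hmt : m ≠ ∞ := ENNReal.add_ne_top.2
    ⟨ENNReal.mul_ne_top hχ.moment_ne_top hΨ.integral_ne_top,
      ENNReal.mul_ne_top hχ.integral_ne_top hΨ.moment_ne_top⟩
  set C₀ : ℝ≥0∞ := (∫⁻ x, χ x) * (A * d) + 2 * m with hC₀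
  have hC₀t : C₀ ≠ ∞ := ENNReal.add_ne_top.2
    ⟨ENNReal.mul_ne_top hχ.integral_ne_top (ENNReal.mul_ne_top hA (by simp)),
      ENNReal.mul_ne_top (by simp) hmt⟩
  set T : ℝ≥0∞ := ∑' k : ℤ, ENNReal.ofReal (2⁻¹ ^ k.natAbs : ℝ) with hT
  refine ⟨3 ^ d + C₀ * T, ENNReal.add_ne_top.2 ⟨by simp,
    ENNReal.mul_ne_top hC₀t tsum_two_inv_pow_natAbs_ne_top⟩, fun F f hf l hl => ?_⟩
  obtain ⟨j₀, hj₀⟩ : ∃ j₀ : ℤ, ∀ k ∈ F, j₀ ≤ k := by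
    obtain ⟨j₀, h⟩ := F.bddBelow
    exact ⟨j₀, fun k hk => h hk⟩
  have hfe : Measurable fun x => ‖f x‖ₑ := hf.measurable.enorm
  obtain ⟨J, hJ, hJl⟩ := exists_cellAvg_le hd (h := fun x => ‖f x‖ₑ) hf.integrable.2.ne hl j₀
  set a : ℤ → Ed d → ℝ≥0∞ := fun j => cellAvg j fun x => ‖f x‖ₑ with ha
  set W : ℤ → Set (Ed d) := stopSet a l j₀ with hW
  have ham : ∀ j, Measurable (a j) := fun j => measurable_cellAvg j hfe
  have hWm : ∀ j, MeasurableSet (W j) := measurableSet_stopSet ham l j₀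
  have hWu : ∀ j, IsCellUnion j (W j) := by
    intro j x z hxz hx
    have hc : ∀ i, j ≤ i → a i x = a i z := fun i hi => cellAvg_congr (cell_eq_of_le hi hxz) _
    refine ⟨?_, fun i hi => ?_⟩
    · rw [← hc j le_rfl]; exact hx.1
    · rw [← hc i hi.le]; exact hx.2 i hi
  have hsum : ∀ {x j}, j ∈ Finset.Icc j₀ J → x ∈ W j → ∀ {β : Type} [AddCommMonoid β]
      (h : ℤ → Ed d → β), ∑ i ∈ Finset.Icc j₀ J, (W i).indicator (h i) x = h j x := by
    intro x j hj hx β _ h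
    rw [Finset.sum_eq_single_of_mem j hj, Set.indicator_of_mem hx]
    intro i hi hij
    refine Set.indicator_of_notMem (fun hxi => hij ?_) _
    exact stopSet_unique (Finset.mem_Icc.1 hi).1 (Finset.mem_Icc.1 hj).1 hxi hx
  have hpart : ∑ j ∈ Finset.Icc j₀ J, ∫⁻ x in W j, ‖f x‖ₑ = ∫⁻ x, ‖f x‖ₑ := by
    simp_rw [← lintegral_indicator (hWm _)]
    rw [← lintegral_finsetSum _ fun j _ => hfe.indicator (hWm j)]
    refine lintegral_congr fun x => ?_
    obtain ⟨j, hj, hx⟩ := exists_mem_stopSet hJ hJl x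
    exact hsum hj hx fun _ x => ‖f x‖ₑ
  set b : Ed d → ℂ := fun x => ∑ j ∈ Finset.Icc j₀ J, badPart j (W j) f x with hb
  have hbj : ∀ j, Nice (badPart j (W j) f) := fun j => hf.badPart (hWu j) (hWm j)
  have hbn : Nice b := Nice.sum _ fun j _ => hbj j
  have hgW : ∀ {x j}, j ∈ Finset.Icc j₀ J → x ∈ W j → f x - b x = cellExp j f x := by
    intro x j hj hx
    have : b x = f x - cellExp j f x := hsum hj hx fun j x => f x - cellExp j f x
    rw [this, sub_sub_cancel]
  have hgb : ∀ x, ‖f x - b x‖ₑ ≤ 2 ^ d * l := by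
    intro x
    obtain ⟨j, hj, hx⟩ := exists_mem_stopSet hJ hJl x
    rw [hgW hj hx]
    refine (enorm_cellExp_le j f x).trans ((cellAvg_le_succ j _ x).trans ?_)
    gcongr
    exact hx.2 (j + 1) (by omega)
  have hgi : ∫⁻ x, ‖f x - b x‖ₑ ≤ ∫⁻ x, ‖f x‖ₑ := by
    calc ∫⁻ x, ‖f x - b x‖ₑ ≤ ∫⁻ x, ∑ j ∈ Finset.Icc j₀ J, (W j).indicator (a j) x := by
          refine lintegral_mono fun x => ?_
          obtain ⟨j, hj, hx⟩ := exists_mem_stopSet hJ hJl x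
          simp only
          rw [hgW hj hx, hsum hj hx a]
          exact enorm_cellExp_le j f x
      _ = ∑ j ∈ Finset.Icc j₀ J, ∫⁻ x in W j, a j x := by
          rw [lintegral_finsetSum _ fun j _ => (ham j).indicator (hWm j)]
          simp_rw [lintegral_indicator (hWm _)]
      _ = ∫⁻ x, ‖f x‖ₑ := by
          rw [← hpart]
          exact Finset.sum_congr rfl fun j _ => (hWu j).lintegral_cellAvg (hWm j) hfe
  have hgm : Measurable fun x => f x - b x := hf.measurable.sub hbn.measurable
  have hIF : ∫⁻ x, ‖f x‖ₑ ≠ ∞ := hf.integrable.2.ne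
  set Ω : Set (Ed d) := ⋃ j ∈ Finset.Ioc j₀ J, fatten j (W j) with hΩ
  have hΩm : MeasurableSet Ω := Finset.measurableSet_biUnion _ fun j _ =>
    measurableSet_fatten j (hWm j)
  refine ⟨fun x => f x - b x, b, Ω, ⟨hgm, hf.integrable.sub hbn.integrable, ?_⟩, hbn,
    fun x => by simp, hΩm, ?_, hgb, hgi, ?_⟩
  · obtain ⟨M, hM⟩ := hf.bounded
    obtain ⟨N, hN⟩ := hbn.bounded
    exact ⟨M + N, fun x => (norm_sub_le _ _).trans (add_le_add (hM x) (hN x))⟩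
  · calc l * volume Ω ≤ l * ∑ j ∈ Finset.Ioc j₀ J, 3 ^ d * volume (W j) := by
          gcongr
          refine (measure_biUnion_finset_le _ _).trans (Finset.sum_le_sum fun j _ => ?_)
          exact volume_fatten_le j (hWm j)
      _ = 3 ^ d * ∑ j ∈ Finset.Ioc j₀ J, l * volume (W j) := by
          rw [Finset.mul_sum, Finset.mul_sum]
          exact Finset.sum_congr rfl fun j _ => by ring
      _ ≤ 3 ^ d * ∑ j ∈ Finset.Ioc j₀ J, ∫⁻ x in W j, ‖f x‖ₑ := by
          gcongr with j hj
          rw [← (hWu j).lintegral_cellAvg (hWm j) hfe, ← setLIntegral_const]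
          refine setLIntegral_mono' (hWm j) fun x hx => ?_
          rcases hx.1 with h | h
          · have := (Finset.mem_Ioc.1 hj).1
            omega
          · exact h.le
      _ ≤ 3 ^ d * ∫⁻ x, ‖f x‖ₑ := by
          rw [← hpart]
          gcongr
          exact Finset.Ioc_subset_Icc_self
      _ ≤ _ := by
          gcongr
          exact le_self_add
  · have hterm : ∀ k ∈ F, ∀ j ∈ Finset.Icc j₀ J, ∫⁻ x in Ωᶜ, lpMaj χ Ψ k (badPart j (W j) f) x ≤
        C₀ * ENNReal.ofReal (2⁻¹ ^ (k - j).natAbs : ℝ) * ∫⁻ x in W j, ‖f x‖ₑ := by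
      intro k hk j hj
      have hpow : ∀ n : ℤ, n ≤ 0 → (2 : ℝ) ^ n = 2⁻¹ ^ n.natAbs := by
        intro n hn
        obtain ⟨q, rfl⟩ := Int.exists_eq_neg_ofNat hn
        simp
      rcases le_or_gt j k with hjk | hjk
      · have h1 := lintegral_enorm_kconv_badPart_le hf hΨ hmod k (hWu j) (hWm j)
        have h2 := lintegral_lpMaj hχ hΨ (hbj j) k
        refine (setLIntegral_le_lintegral _ _).trans ?_
        rw [h2, ← Int.natAbs_neg, neg_sub, ← hpow _ (by omega)]
        calc _ ≤ (∫⁻ x, χ x) * (A * d * ENNReal.ofReal (2 ^ (j - k)) * ∫⁻ x in W j, ‖f x‖ₑ) := by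
              gcongr
          _ = (∫⁻ x, χ x) * (A * d) * ENNReal.ofReal (2 ^ (j - k)) * ∫⁻ x in W j, ‖f x‖ₑ := by ring
          _ ≤ _ := by
              gcongr
              exact le_self_add
      · have h1 := setLIntegral_lpMaj_le hχ hΨ (hbj j) (j := j) (k := k) hΩm.compl (by
          intro x hx y hy
          have hyW : y ∈ W j := by
            by_contra h
            exact hy (Set.indicator_of_notMem h _)
          refine (hWu j).le_norm_sub (fun hxf => hx ?_) hyW
          have := hj₀ k hk
          simp only [hΩ, Set.mem_iUnion]
          exact ⟨j, Finset.mem_Ioc.2 ⟨by omega, (Finset.mem_Icc.1 hj).2⟩, hxf⟩)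
        refine h1.trans ?_
        rw [← hpow _ (by omega)]
        calc _ ≤ ENNReal.ofReal (2 ^ (k - j)) * m * (2 * ∫⁻ x in W j, ‖f x‖ₑ) := by
              gcongr
              exact lintegral_enorm_badPart_le (hWu j) (hWm j) hf.measurable
          _ = (2 * m) * ENNReal.ofReal (2 ^ (k - j)) * ∫⁻ x in W j, ‖f x‖ₑ := by ring
          _ ≤ _ := by
              gcongr
              exact le_add_self
    calc ∑ k ∈ F, ∫⁻ x in Ωᶜ, lpMaj χ Ψ k b x
        ≤ ∑ k ∈ F, ∑ j ∈ Finset.Icc j₀ J, ∫⁻ x in Ωᶜ, lpMaj χ Ψ k (badPart j (W j) f) x := by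
          refine Finset.sum_le_sum fun k _ => ?_
          rw [← lintegral_finsetSum _ fun j _ => measurable_lpMaj hχ hΨ (hbj j) k]
          exact lintegral_mono fun x => lpMaj_sum_le hχ hΨ _ (fun j _ => hbj j) k x
      _ ≤ ∑ k ∈ F, ∑ j ∈ Finset.Icc j₀ J,
          C₀ * ENNReal.ofReal (2⁻¹ ^ (k - j).natAbs : ℝ) * ∫⁻ x in W j, ‖f x‖ₑ :=
          Finset.sum_le_sum fun k hk => Finset.sum_le_sum fun j hj => hterm k hk j hj
      _ = ∑ j ∈ Finset.Icc j₀ J, C₀ * (∑ k ∈ F, ENNReal.ofReal (2⁻¹ ^ (k - j).natAbs : ℝ)) *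
          ∫⁻ x in W j, ‖f x‖ₑ := by
          rw [Finset.sum_comm]
          refine Finset.sum_congr rfl fun j _ => ?_
          rw [Finset.mul_sum, Finset.sum_mul]
      _ ≤ ∑ j ∈ Finset.Icc j₀ J, C₀ * T * ∫⁻ x in W j, ‖f x‖ₑ := by
          gcongr with j _
          exact sum_two_inv_pow_natAbs_sub_le F j
      _ = C₀ * T * ∫⁻ x, ‖f x‖ₑ := by rw [← Finset.mul_sum, hpart]
      _ ≤ _ := by
          gcongr
          exact le_add_self

end

section

open FourierTransform

variable {d : ℕ}

theorem continuous_kconv {K f : Ed d → ℂ} (hK : Continuous K) (hb : ∃ M : ℝ, ∀ x, ‖K x‖ ≤ M)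
    (hf : Integrable f) : Continuous (kconv K f) := by
  obtain ⟨M, hM⟩ := hb
  refine continuous_of_dominated (bound := fun z => M * ‖f z‖) (fun x => ?_) (fun x => ?_)
    (hf.norm.const_mul M) (ae_of_all _ fun z => by fun_prop)
  · have h : Continuous fun z => K (x - z) := by fun_prop
    exact h.aestronglyMeasurable.mul hf.1
  · refine ae_of_all _ fun z => ?_
    rw [norm_mul]
    gcongr
    exact hM _

theorem Nice.kconv {K f : Ed d → ℂ} (hK : GoodKernel K) (hf : Nice f) : Nice (kconv K f) := by
  have hm := measurable_kconv hf.measurable hK.continuous.measurable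
  refine ⟨hm, ⟨hm.aestronglyMeasurable, ?_⟩, ?_⟩
  · calc ∫⁻ x, ‖_root_.kconv K f x‖ₑ ≤ ∫⁻ x, ∫⁻ z, ‖K (x - z)‖ₑ * ‖f z‖ₑ :=
          lintegral_mono fun x => enorm_kconv_le K f x
      _ = (∫⁻ x, ‖K x‖ₑ) * ∫⁻ z, ‖f z‖ₑ :=
          lintegral_lintegral_sub_mul hK.continuous.measurable.enorm hf.measurable.enorm
      _ < ∞ := ENNReal.mul_lt_top hK.integral_ne_top.lt_top hf.integrable.2
  · obtain ⟨M, hM⟩ := hK.bounded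
    refine ⟨∫ z, M * ‖f z‖, fun x => ?_⟩
    refine norm_integral_le_of_norm_le (hf.integrable.norm.const_mul M) (ae_of_all _ fun z => ?_)
    rw [norm_mul]
    gcongr
    exact hM _

theorem GoodKernel.integrable {K : Ed d → ℂ} (hK : GoodKernel K) : Integrable K :=
  ⟨hK.continuous.aestronglyMeasurable, hK.integral_ne_top.lt_top⟩

theorem GoodKernel.dil {K : Ed d → ℂ} (hK : GoodKernel K) (k : ℤ) : GoodKernel (dil k K) where
  continuous := hK.continuous_dil k
  bounded := hK.bounded_dil k
  integral_ne_top := by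
    rw [hK.lintegral_dil]
    exact hK.integral_ne_top
  moment_ne_top := by
    rw [hK.lintegral_enorm_mul_dil]
    exact ENNReal.mul_ne_top ENNReal.ofReal_ne_top hK.moment_ne_top
  modulus := by
    obtain ⟨A, hA, h⟩ := hK.modulus
    refine ⟨A * (ENNReal.ofReal (2 ^ k))⁻¹, ENNReal.mul_ne_top hA (ENNReal.inv_ne_top.2 ?_), ?_⟩
    · rw [Ne, ENNReal.ofReal_eq_zero, not_le]
      positivity
    · intro y
      simpa using lintegral_dil_sub_le hK.continuous h k y 0

theorem fourier_kconv {K f : Ed d → ℂ} (hK : Integrable K) (hf : Integrable f) (ξ : Ed d) :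
    𝓕 (kconv K f) ξ = 𝓕 K ξ * 𝓕 f ξ := by
  have h := Real.fourier_mul_convolution_eq hK hf ξ
  rw [← h]
  refine congrArg (fun g : Ed d → ℂ => 𝓕 g ξ) (funext fun x => ?_)
  rw [kconv, MeasureTheory.convolution_eq_swap]
  rfl

theorem fourier_dil (k : ℤ) (K : Ed d → ℂ) (ξ : Ed d) :
    𝓕 (dil k K) ξ = 𝓕 K ((2 : ℝ) ^ k • ξ) := by
  have h2 : (0 : ℝ) < 2 ^ k := by positivity
  rw [Real.fourier_eq, Real.fourier_eq]
  have h := Measure.integral_comp_inv_smul (μ := (volume : Measure (Ed d)))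
    (fun v => Real.fourierChar (-inner ℝ v ((2 : ℝ) ^ k • ξ)) • K v) ((2 : ℝ) ^ k)
  rw [finrank_euclideanSpace, Fintype.card_fin, abs_of_pos (by positivity)] at h
  rw [← inv_smul_eq_iff₀ (by positivity), ← integral_smul] at h
  rw [← h]
  refine integral_congr_ae (ae_of_all _ fun x => ?_)
  simp only [dil]
  rw [smul_comm, inner_smul_left, inner_smul_right, RCLike.conj_to_real, ← mul_assoc,
    inv_mul_cancel₀ h2.ne', one_mul]

theorem lintegral_schwartz_sub_le (F : SchwartzMap (Ed d) ℂ) (h : Ed d) :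
    ∫⁻ x, ‖F (x - h) - F x‖ₑ ≤ (∫⁻ x, ‖fderiv ℝ F x‖ₑ) * ‖h‖ₑ := by
  have hD : Continuous (fderiv ℝ F) := (SchwartzMap.fderivCLM ℝ (Ed d) ℂ F).continuous
  have h1 : ∀ x, ‖F (x - h) - F x‖ₑ ≤ ∫⁻ s in Ioc (0 : ℝ) 1, ‖fderiv ℝ F (x - s • h)‖ₑ * ‖h‖ₑ := by
    intro x
    have hd : ∀ s : ℝ, HasDerivAt (fun s : ℝ => F (x - s • h)) (fderiv ℝ F (x - s • h) (-h)) s := by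
      intro s
      have e1 : HasDerivAt (fun s : ℝ => x - s • h) (-h) s := by
        refine (((hasDerivAt_id s).smul_const h).const_sub x).congr_deriv ?_
        simp
      exact (F.differentiableAt.hasFDerivAt).comp_hasDerivAt s e1
    have hc : Continuous fun s : ℝ => fderiv ℝ F (x - s • h) (-h) := by fun_prop
    have h2 := intervalIntegral.integral_eq_sub_of_hasDerivAt (a := 0) (b := 1)
      (fun s _ => hd s) (hc.intervalIntegrable _ _)
    simp only [one_smul, zero_smul, sub_zero] at h2
    rw [← h2, intervalIntegral.integral_of_le zero_le_one]
    refine (enorm_integral_le_lintegral_enorm _).trans (lintegral_mono fun s => ?_)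
    refine ((fderiv ℝ F (x - s • h)).le_opENorm (-h)).trans (le_of_eq ?_)
    rw [enorm_neg]
  calc _ ≤ ∫⁻ x, ∫⁻ s in Ioc (0 : ℝ) 1, ‖fderiv ℝ F (x - s • h)‖ₑ * ‖h‖ₑ := lintegral_mono h1
    _ = ∫⁻ s in Ioc (0 : ℝ) 1, ∫⁻ x, ‖fderiv ℝ F (x - s • h)‖ₑ * ‖h‖ₑ := by
        refine lintegral_lintegral_swap (Measurable.aemeasurable ?_)
        have : Continuous fun p : Ed d × ℝ => fderiv ℝ F (p.1 - p.2 • h) := by fun_prop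
        exact (this.enorm.measurable).mul measurable_const
    _ = ∫⁻ s in Ioc (0 : ℝ) 1, (∫⁻ x, ‖fderiv ℝ F x‖ₑ) * ‖h‖ₑ := by
        refine lintegral_congr fun s => ?_
        rw [lintegral_mul_const' _ _ enorm_ne_top,
          lintegral_sub_right_eq_self (fun x => ‖fderiv ℝ F x‖ₑ)]
    _ = _ := by simp

theorem goodKernel_schwartz (F : SchwartzMap (Ed d) ℂ) : GoodKernel F where
  continuous := F.continuous
  bounded := by
    obtain ⟨C, hC⟩ := F.decay 0 0
    exact ⟨C, fun x => by simpa using hC.2 x⟩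
  integral_ne_top := (F.integrable (μ := volume)).2.ne
  moment_ne_top := by
    have := (F.integrable_pow_mul volume 1).2.ne
    simpa [HasFiniteIntegral, enorm_mul] using this
  modulus := ⟨∫⁻ x, ‖fderiv ℝ F x‖ₑ,
    ((SchwartzMap.fderivCLM ℝ (Ed d) ℂ F).integrable (μ := volume)).2.ne,
    lintegral_schwartz_sub_le F⟩

end

section

open FourierTransform

variable {d : ℕ}

/-- A polynomially decaying majorant. -/
def decayMaj (d : ℕ) (C : ℝ) (x : Ed d) : ℝ≥0∞ := ENNReal.ofReal (C * (1 + ‖x‖) ^ (-(d + 2 : ℝ)))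

theorem goodMajorant_decayMaj {C : ℝ} (hC : 0 ≤ C) : GoodMajorant (decayMaj d C) := by
  have hm : Measurable (decayMaj d C) := by
    unfold decayMaj
    fun_prop
  have h1 : ∀ r : ℝ, (d : ℝ) < r → ∫⁻ x : Ed d, ENNReal.ofReal (C * (1 + ‖x‖) ^ (-r)) ≠ ∞ := by
    intro r hr
    have := (integrable_one_add_norm (E := Ed d) (μ := volume) (r := r) (by simpa using hr)).const_mul C
    rw [← lt_top_iff_ne_top]
    refine lt_of_eq_of_lt ?_ this.2
    refine lintegral_congr fun x => ?_
    rw [Real.enorm_of_nonneg (by positivity)]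
  refine ⟨hm, h1 _ (by linarith), ne_top_of_le_ne_top (h1 (d + 1) (by linarith)) ?_⟩
  refine lintegral_mono fun x => ?_
  simp only [decayMaj]
  rw [← ofReal_norm, ← ENNReal.ofReal_mul (norm_nonneg _)]
  refine ENNReal.ofReal_le_ofReal ?_
  have hx : 0 < 1 + ‖x‖ := by positivity
  have e : (1 + ‖x‖) ^ (-(d + 1 : ℝ)) = (1 + ‖x‖) * (1 + ‖x‖) ^ (-(d + 2 : ℝ)) := by
    nth_rewrite 2 [← Real.rpow_one (1 + ‖x‖)]
    rw [← Real.rpow_add hx]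
    congr 1
    ring
  rw [e]
  have : 0 ≤ C * (1 + ‖x‖) ^ (-(d + 2 : ℝ)) := by positivity
  nlinarith

theorem exists_decayMaj (F : SchwartzMap (Ed d) ℂ) :
    ∃ C : ℝ, 0 ≤ C ∧ ∀ x w : Ed d, ‖w‖ ≤ 2 → ‖F (x + w)‖ₑ ≤ decayMaj d C x := by
  set S : ℝ := 2 ^ (d + 2) * ((Finset.Iic ((d + 2, 0) : ℕ × ℕ)).sup
    (fun m : ℕ × ℕ => SchwartzMap.seminorm ℝ m.1 m.2)) F with hS
  have hS0 : 0 ≤ S := by positivity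
  have hF : ∀ x, (1 + ‖x‖) ^ (d + 2) * ‖F x‖ ≤ S := by
    intro x
    have := SchwartzMap.one_add_le_sup_seminorm_apply (𝕜 := ℝ) (m := (d + 2, 0)) (k := d + 2)
      (n := 0) le_rfl le_rfl F x
    simpa using this
  refine ⟨3 ^ (d + 2) * S, by positivity, fun x w hw => ?_⟩
  rw [decayMaj, ← ofReal_norm]
  refine ENNReal.ofReal_le_ofReal ?_
  have hx : 0 < 1 + ‖x‖ := by positivity
  have h1 : 1 + ‖x‖ ≤ 3 * (1 + ‖x + w‖) := by
    have : ‖x‖ ≤ ‖x + w‖ + ‖w‖ := by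
      simpa using norm_sub_le (x + w) w
    have := norm_nonneg (x + w)
    linarith
  rw [Real.rpow_neg hx.le, ← div_eq_mul_inv, le_div_iff₀ (by positivity)]
  have e : (1 + ‖x‖) ^ (d + 2 : ℝ) = (1 + ‖x‖) ^ (d + 2) := by
    rw [← Real.rpow_natCast]
    push_cast
    rfl
  rw [e]
  calc ‖F (x + w)‖ * (1 + ‖x‖) ^ (d + 2)
      ≤ ‖F (x + w)‖ * (3 * (1 + ‖x + w‖)) ^ (d + 2) := by gcongr
    _ = 3 ^ (d + 2) * ((1 + ‖x + w‖) ^ (d + 2) * ‖F (x + w)‖) := by rw [mul_pow]; ring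
    _ ≤ _ := by gcongr; exact hF _

/-- Convolution with a dilated kernel is controlled, up to shifts at the same scale. -/
theorem enorm_kconv_add_le {K : Ed d → ℂ} {χ : Ed d → ℝ≥0∞}
    (hχ : ∀ x w : Ed d, ‖w‖ ≤ 2 → ‖K (x + w)‖ₑ ≤ χ x) (k : ℤ) (u : Ed d → ℂ) (x w : Ed d)
    (hw : ‖w‖ ≤ 2 * 2 ^ k) :
    ‖kconv (dil k K) u (x + w)‖ₑ ≤ ∫⁻ z, edil k χ (x - z) * ‖u z‖ₑ := by
  refine (enorm_kconv_le _ _ _).trans (lintegral_mono fun z => ?_)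
  simp only
  gcongr
  rw [enorm_dil, edil, edil]
  gcongr
  have e : ((2 : ℝ) ^ k)⁻¹ • (x + w - z) = ((2 : ℝ) ^ k)⁻¹ • (x - z) + ((2 : ℝ) ^ k)⁻¹ • w := by
    rw [← smul_add]
    congr 1
    abel
  rw [e]
  refine hχ _ _ ?_
  have h2 : (0 : ℝ) < 2 ^ k := by positivity
  rw [norm_smul, Real.norm_of_nonneg (by positivity), inv_mul_le_iff₀ h2, mul_comm]
  exact hw

/-- A smooth cutoff, equal to one on the unit ball and supported in the ball of radius two. -/
def cutoff (d : ℕ) (ξ : Ed d) : ℂ :=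
  ((⟨1, 2, one_pos, one_lt_two⟩ : ContDiffBump (0 : Ed d)) ξ : ℝ)

theorem contDiff_cutoff : ContDiff ℝ (↑(⊤ : ℕ∞)) (cutoff d) :=
  Complex.ofRealCLM.contDiff.comp (ContDiffBump.contDiff _)

theorem cutoff_eq_one {ξ : Ed d} (h : ‖ξ‖ ≤ 1) : cutoff d ξ = 1 := by
  rw [cutoff, ContDiffBump.one_of_mem_closedBall]
  · simp
  · simpa using h

theorem cutoff_eq_zero {ξ : Ed d} (h : 2 ≤ ‖ξ‖) : cutoff d ξ = 0 := by
  rw [cutoff, ContDiffBump.zero_of_le_dist]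
  · simp
  · simpa using h

theorem norm_cutoff_le (ξ : Ed d) : ‖cutoff d ξ‖ ≤ 1 := by
  rw [cutoff, Complex.norm_real, Real.norm_of_nonneg (ContDiffBump.nonneg _)]
  exact ContDiffBump.le_one _

theorem hasCompactSupport_of_eq_zero {θ : Ed d → ℂ} (h : ∀ ξ, 2 ≤ ‖ξ‖ → θ ξ = 0) :
    HasCompactSupport θ := by
  refine HasCompactSupport.of_support_subset_isCompact (isCompact_closedBall (0 : Ed d) 2) ?_
  intro ξ hξ
  rw [mem_closedBall_zero_iff]
  by_contra! hlt
  exact hξ (h ξ hlt.le)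

/-- The multiplier of a Littlewood–Paley piece. -/
def annMul (d : ℕ) (ξ : Ed d) : ℂ := cutoff d ξ - cutoff d ((2 : ℝ) • ξ)

/-- The companion multiplier. -/
def sumMul (d : ℕ) (ξ : Ed d) : ℂ := cutoff d ξ + cutoff d ((2 : ℝ) • ξ)

theorem contDiff_annMul : ContDiff ℝ (↑(⊤ : ℕ∞)) (annMul d) :=
  contDiff_cutoff.sub (contDiff_cutoff.comp (contDiff_const_smul _))

theorem contDiff_sumMul : ContDiff ℝ (↑(⊤ : ℕ∞)) (sumMul d) :=
  contDiff_cutoff.add (contDiff_cutoff.comp (contDiff_const_smul _))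

theorem cutoff_two_smul_eq_zero {ξ : Ed d} (h : 1 ≤ ‖ξ‖) : cutoff d ((2 : ℝ) • ξ) = 0 := by
  apply cutoff_eq_zero
  rw [norm_smul, Real.norm_of_nonneg zero_le_two]
  linarith

theorem annMul_eq_zero {ξ : Ed d} (h : 2 ≤ ‖ξ‖) : annMul d ξ = 0 := by
  rw [annMul, cutoff_eq_zero h, cutoff_two_smul_eq_zero (by linarith), sub_zero]

theorem annMul_eq_zero_of_le {ξ : Ed d} (h : ‖ξ‖ ≤ 1 / 2) : annMul d ξ = 0 := by
  rw [annMul, cutoff_eq_one (by linarith), cutoff_eq_one, sub_self]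
  rw [norm_smul, Real.norm_of_nonneg zero_le_two]
  linarith

theorem sumMul_eq_zero {ξ : Ed d} (h : 2 ≤ ‖ξ‖) : sumMul d ξ = 0 := by
  rw [sumMul, cutoff_eq_zero h, cutoff_two_smul_eq_zero (by linarith), add_zero]

theorem norm_annMul_le (ξ : Ed d) : ‖annMul d ξ‖ ≤ 2 := by
  refine (norm_sub_le _ _).trans ?_
  linarith [norm_cutoff_le ξ, norm_cutoff_le ((2 : ℝ) • ξ)]

theorem norm_sumMul_le (ξ : Ed d) : ‖sumMul d ξ‖ ≤ 2 := by
  refine (norm_add_le _ _).trans ?_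
  linarith [norm_cutoff_le ξ, norm_cutoff_le ((2 : ℝ) • ξ)]

theorem sumMul_mul_annMul (ξ : Ed d) :
    sumMul d ξ * annMul d ξ = cutoff d ξ ^ 2 - cutoff d ((2 : ℝ) • ξ) ^ 2 := by
  rw [sumMul, annMul]
  ring

/-- The inverse Fourier transform of a test function is a Schwartz function. -/
theorem exists_schwartz_fourierInv {θ : Ed d → ℂ} (h1 : ContDiff ℝ (↑(⊤ : ℕ∞)) θ)
    (h2 : ∀ ξ, 2 ≤ ‖ξ‖ → θ ξ = 0) :
    ∃ F : SchwartzMap (Ed d) ℂ, ∀ ξ, 𝓕 (F : Ed d → ℂ) ξ = θ ξ := by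
  refine ⟨𝓕⁻ ((hasCompactSupport_of_eq_zero h2).toSchwartzMap h1), fun ξ => ?_⟩
  rw [← SchwartzMap.fourier_coe, FourierTransform.fourier_fourierInv_eq]
  rfl

/-- The kernel with Fourier transform `cutoff`. -/
def cutoffKer (d : ℕ) : SchwartzMap (Ed d) ℂ :=
  (exists_schwartz_fourierInv contDiff_cutoff fun _ h => cutoff_eq_zero h).choose

/-- The kernel with Fourier transform `annMul`. -/
def annKer (d : ℕ) : SchwartzMap (Ed d) ℂ :=
  (exists_schwartz_fourierInv contDiff_annMul fun _ h => annMul_eq_zero h).choose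

/-- The kernel with Fourier transform `sumMul`. -/
def sumKer (d : ℕ) : SchwartzMap (Ed d) ℂ :=
  (exists_schwartz_fourierInv contDiff_sumMul fun _ h => sumMul_eq_zero h).choose

theorem fourier_cutoffKer (ξ : Ed d) : 𝓕 (cutoffKer d : Ed d → ℂ) ξ = cutoff d ξ :=
  (exists_schwartz_fourierInv contDiff_cutoff fun _ h => cutoff_eq_zero h).choose_spec ξ

theorem fourier_annKer (ξ : Ed d) : 𝓕 (annKer d : Ed d → ℂ) ξ = annMul d ξ :=
  (exists_schwartz_fourierInv contDiff_annMul fun _ h => annMul_eq_zero h).choose_spec ξ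

theorem fourier_sumKer (ξ : Ed d) : 𝓕 (sumKer d : Ed d → ℂ) ξ = sumMul d ξ :=
  (exists_schwartz_fourierInv contDiff_sumMul fun _ h => sumMul_eq_zero h).choose_spec ξ

/-- A common majorant of the kernels and of their shifts. -/
theorem exists_common_majorant (d : ℕ) : ∃ χ : Ed d → ℝ≥0∞, GoodMajorant χ ∧
    (∀ x w : Ed d, ‖w‖ ≤ 2 → ‖cutoffKer d (x + w)‖ₑ ≤ χ x) ∧
    ∀ x w : Ed d, ‖w‖ ≤ 2 → ‖sumKer d (x + w)‖ₑ ≤ χ x := by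
  obtain ⟨C, hC, h1⟩ := exists_decayMaj (cutoffKer d)
  obtain ⟨C', hC', h2⟩ := exists_decayMaj (sumKer d)
  have hmono : ∀ {a b : ℝ}, a ≤ b → ∀ x : Ed d, decayMaj d a x ≤ decayMaj d b x := by
    intro a b hab x
    rw [decayMaj, decayMaj]
    gcongr
  exact ⟨decayMaj d (max C C'), goodMajorant_decayMaj (hC.trans (le_max_left _ _)),
    fun x w hw => (h1 x w hw).trans (hmono (le_max_left _ _) x),
    fun x w hw => (h2 x w hw).trans (hmono (le_max_right _ _) x)⟩

/-- The majorant kernel fixed from now on. -/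
def majKer (d : ℕ) : Ed d → ℝ≥0∞ := (exists_common_majorant d).choose

theorem goodMajorant_majKer : GoodMajorant (majKer d) := (exists_common_majorant d).choose_spec.1

theorem enorm_cutoffKer_le (x w : Ed d) (hw : ‖w‖ ≤ 2) : ‖cutoffKer d (x + w)‖ₑ ≤ majKer d x :=
  (exists_common_majorant d).choose_spec.2.1 x w hw

theorem enorm_sumKer_le (x w : Ed d) (hw : ‖w‖ ≤ 2) : ‖sumKer d (x + w)‖ₑ ≤ majKer d x :=
  (exists_common_majorant d).choose_spec.2.2 x w hw

end

section

open FourierTransform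

variable {d : ℕ}

theorem sq_lintegral_le {β : Type*} [MeasurableSpace β] (μ : Measure β) {h : β → ℝ≥0∞}
    (hh : AEMeasurable h μ) : (∫⁻ x, h x ∂μ) ^ 2 ≤ μ univ * ∫⁻ x, h x ^ 2 ∂μ := by
  have := ENNReal.lintegral_mul_le_Lp_mul_Lq μ Real.HolderConjugate.two_two hh
    (aemeasurable_const (b := (1 : ℝ≥0∞)))
  simp only [Pi.mul_apply, mul_one, ENNReal.one_rpow, lintegral_const, one_mul] at this
  calc (∫⁻ x, h x ∂μ) ^ 2
      ≤ ((∫⁻ x, h x ^ (2 : ℝ) ∂μ) ^ (1 / 2 : ℝ) * μ univ ^ (1 / 2 : ℝ)) ^ 2 := by gcongr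
    _ = _ := by
        have e : ∀ a : ℝ≥0∞, (a ^ (1 / 2 : ℝ)) ^ 2 = a := fun a => by
          rw [← ENNReal.rpow_natCast, ← ENNReal.rpow_mul]
          norm_num
        rw [mul_pow, e, e, mul_comm]
        simp

theorem Nice.memLp_two {f : Ed d → ℂ} (hf : Nice f) : MemLp f 2 := by
  obtain ⟨M, hM⟩ := hf.bounded
  refine (memLp_two_iff_integrable_sq_norm hf.integrable.1).2
    ((hf.integrable.norm.const_mul M).mono' (hf.integrable.1.norm.pow 2) (ae_of_all _ fun x => ?_))
  rw [Real.norm_of_nonneg (by positivity), sq]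
  exact mul_le_mul_of_nonneg_right (hM x) (norm_nonneg _)

theorem Nice.sub {f g : Ed d → ℂ} (hf : Nice f) (hg : Nice g) : Nice fun x => f x - g x := by
  obtain ⟨M, hM⟩ := hf.bounded
  obtain ⟨N, hN⟩ := hg.bounded
  exact ⟨hf.measurable.sub hg.measurable, hf.integrable.sub hg.integrable, M + N,
    fun x => (norm_sub_le _ _).trans (add_le_add (hM x) (hN x))⟩

/-- The square of the frequency cutoff to `‖ξ‖ ≲ 2 ^ (-j)`. -/
def lowP (j : ℤ) (f : Ed d → ℂ) : Ed d → ℂ :=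
  kconv (dil j (cutoffKer d)) (kconv (dil j (cutoffKer d)) f)

/-- The Littlewood–Paley piece at frequency `2 ^ (-j)`. -/
def deltaP (j : ℤ) (f : Ed d → ℂ) : Ed d → ℂ := kconv (dil j (annKer d)) f

/-- The difference of two consecutive squared frequency cutoffs. -/
def bandP (j : ℤ) (f : Ed d → ℂ) : Ed d → ℂ := kconv (dil j (sumKer d)) (deltaP j f)

/-- Majorant of the shifts of `bandP`. -/
def bandMaj (j : ℤ) (f : Ed d → ℂ) : Ed d → ℝ≥0∞ := lpMaj (majKer d) (annKer d) j f

/-- Majorant of the shifts of `lowP`. -/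
def lowMaj (j : ℤ) (f : Ed d → ℂ) : Ed d → ℝ≥0∞ := lpMaj (majKer d) (cutoffKer d) j f

theorem Nice.lowP {f : Ed d → ℂ} (hf : Nice f) (j : ℤ) : Nice (lowP j f) :=
  (hf.kconv ((goodKernel_schwartz _).dil j)).kconv ((goodKernel_schwartz _).dil j)

theorem Nice.deltaP {f : Ed d → ℂ} (hf : Nice f) (j : ℤ) : Nice (deltaP j f) :=
  hf.kconv ((goodKernel_schwartz _).dil j)

theorem Nice.bandP {f : Ed d → ℂ} (hf : Nice f) (j : ℤ) : Nice (bandP j f) :=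
  (hf.deltaP j).kconv ((goodKernel_schwartz _).dil j)

theorem continuous_lowP {f : Ed d → ℂ} (hf : Nice f) (j : ℤ) : Continuous (lowP j f) :=
  continuous_kconv ((goodKernel_schwartz _).continuous_dil j) ((goodKernel_schwartz _).bounded_dil j)
    (hf.kconv ((goodKernel_schwartz _).dil j)).integrable

theorem continuous_bandP {f : Ed d → ℂ} (hf : Nice f) (j : ℤ) : Continuous (bandP j f) :=
  continuous_kconv ((goodKernel_schwartz _).continuous_dil j) ((goodKernel_schwartz _).bounded_dil j)
    (hf.deltaP j).integrable

theorem fourier_deltaP {f : Ed d → ℂ} (hf : Nice f) (j : ℤ) (ξ : Ed d) :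
    𝓕 (deltaP j f) ξ = annMul d ((2 : ℝ) ^ j • ξ) * 𝓕 f ξ := by
  rw [deltaP, fourier_kconv ((goodKernel_schwartz _).dil j).integrable hf.integrable, fourier_dil,
    fourier_annKer]

theorem fourier_bandP {f : Ed d → ℂ} (hf : Nice f) (j : ℤ) (ξ : Ed d) :
    𝓕 (bandP j f) ξ = sumMul d ((2 : ℝ) ^ j • ξ) * annMul d ((2 : ℝ) ^ j • ξ) * 𝓕 f ξ := by
  rw [bandP, fourier_kconv ((goodKernel_schwartz _).dil j).integrable (hf.deltaP j).integrable,
    fourier_dil, fourier_sumKer, fourier_deltaP hf, mul_assoc]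

theorem fourier_lowP {f : Ed d → ℂ} (hf : Nice f) (j : ℤ) (ξ : Ed d) :
    𝓕 (lowP j f) ξ = cutoff d ((2 : ℝ) ^ j • ξ) ^ 2 * 𝓕 f ξ := by
  have h := (goodKernel_schwartz (cutoffKer d)).dil j
  rw [lowP, fourier_kconv h.integrable (hf.kconv h).integrable,
    fourier_kconv h.integrable hf.integrable, fourier_dil, fourier_cutoffKer]
  ring

theorem fourier_sub {f g : Ed d → ℂ} (hf : Integrable f) (hg : Integrable g) (ξ : Ed d) :
    𝓕 (fun x => f x - g x) ξ = 𝓕 f ξ - 𝓕 g ξ := by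
  simp only [Real.fourier_eq, smul_sub]
  exact integral_sub ((Real.fourierIntegral_convergent_iff ξ).2 hf)
    ((Real.fourierIntegral_convergent_iff ξ).2 hg)

theorem eq_zero_of_fourier_eq_zero {u : Ed d → ℂ} (hc : Continuous u) (hi : Integrable u)
    (h : ∀ ξ, 𝓕 u ξ = 0) (x : Ed d) : u x = 0 := by
  have h0 : 𝓕 u = fun _ => 0 := funext h
  have := congrFun (hc.fourierInv_fourier_eq hi (by rw [h0]; exact integrable_zero _ _ _)) x
  rw [← this, h0, Real.fourierInv_eq]
  simp

theorem lowP_sub_lowP {f : Ed d → ℂ} (hf : Nice f) (j : ℤ) (x : Ed d) :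
    lowP j f x - lowP (j + 1) f x = bandP j f x := by
  have h1 := ((hf.lowP j).sub (hf.lowP (j + 1)))
  refine sub_eq_zero.1 (eq_zero_of_fourier_eq_zero
    (u := fun x => lowP j f x - lowP (j + 1) f x - bandP j f x)
    (((continuous_lowP hf j).sub (continuous_lowP hf _)).sub (continuous_bandP hf j))
    (h1.sub (hf.bandP j)).integrable (fun ξ => ?_) x)
  rw [fourier_sub h1.integrable (hf.bandP j).integrable,
    fourier_sub (hf.lowP j).integrable (hf.lowP (j + 1)).integrable, fourier_lowP hf,
    fourier_lowP hf, fourier_bandP hf, sumMul_mul_annMul, smul_smul, zpow_add_one₀ two_ne_zero,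
    mul_comm (2 : ℝ)]
  ring

theorem lowP_sub_eq_sum {f : Ed d → ℂ} (hf : Nice f) (k : ℤ) (n : ℕ) (x : Ed d) :
    lowP (k - n) f x = lowP k f x + ∑ i ∈ Finset.range n, bandP (k - (i + 1 : ℕ)) f x := by
  induction n with
  | zero => simp
  | succ n ih =>
    rw [Finset.sum_range_succ, ← add_assoc, ← ih, ← lowP_sub_lowP hf]
    have : k - ((n + 1 : ℕ) : ℤ) + 1 = k - n := by push_cast; ring
    rw [this]
    ring

theorem enorm_bandP_add_le {j : ℤ} (f : Ed d → ℂ) (x w : Ed d) (hw : ‖w‖ ≤ 2 * 2 ^ j) :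
    ‖bandP j f (x + w)‖ₑ ≤ bandMaj j f x :=
  enorm_kconv_add_le enorm_sumKer_le j _ x w hw

theorem enorm_lowP_add_le {j : ℤ} (f : Ed d → ℂ) (x w : Ed d) (hw : ‖w‖ ≤ 2 * 2 ^ j) :
    ‖lowP j f (x + w)‖ₑ ≤ lowMaj j f x :=
  enorm_kconv_add_le enorm_cutoffKer_le j _ x w hw

theorem measurable_bandMaj {f : Ed d → ℂ} (hf : Nice f) (j : ℤ) : Measurable (bandMaj j f) :=
  measurable_lpMaj goodMajorant_majKer (goodKernel_schwartz _) hf j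

theorem measurable_lowMaj {f : Ed d → ℂ} (hf : Nice f) (j : ℤ) : Measurable (lowMaj j f) :=
  measurable_lpMaj goodMajorant_majKer (goodKernel_schwartz _) hf j

theorem lpMaj_add_le {χ : Ed d → ℝ≥0∞} {Ψ : Ed d → ℂ} (hχ : GoodMajorant χ)
    (hΨ : GoodKernel Ψ) {f g : Ed d → ℂ} (hf : Nice f) (hg : Nice g) (k : ℤ) (x : Ed d) :
    lpMaj χ Ψ k (fun x => f x + g x) x ≤ lpMaj χ Ψ k f x + lpMaj χ Ψ k g x := by
  have := lpMaj_sum_le hχ hΨ Finset.univ (f := ![f, g]) (by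
    intro i _
    fin_cases i
    · exact hf
    · exact hg) k x
  simpa using this

theorem lpMaj_le_of_bound {χ : Ed d → ℝ≥0∞} {Ψ : Ed d → ℂ} (hχ : GoodMajorant χ)
    (hΨ : GoodKernel Ψ) {f : Ed d → ℂ} {M : ℝ≥0∞} (hM : ∀ x, ‖f x‖ₑ ≤ M) (k : ℤ) (x : Ed d) :
    lpMaj χ Ψ k f x ≤ (∫⁻ x, χ x) * (∫⁻ x, ‖Ψ x‖ₑ) * M := by
  have h1 : ∀ z, ‖kconv (dil k Ψ) f z‖ₑ ≤ (∫⁻ x, ‖Ψ x‖ₑ) * M := by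
    intro z
    calc ‖kconv (dil k Ψ) f z‖ₑ ≤ ∫⁻ y, ‖dil k Ψ (z - y)‖ₑ * ‖f y‖ₑ := enorm_kconv_le _ _ _
      _ ≤ ∫⁻ y, ‖dil k Ψ (z - y)‖ₑ * M := by
          refine lintegral_mono fun y => ?_
          gcongr
          exact hM y
      _ = _ := by
          have hm : Measurable fun y => ‖dil k Ψ (z - y)‖ₑ :=
            ((hΨ.continuous_dil k).measurable.comp (measurable_const.sub measurable_id)).enorm
          rw [lintegral_mul_const _ hm, lintegral_sub_left_eq_self (fun y => ‖dil k Ψ y‖ₑ),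
            hΨ.lintegral_dil]
  calc lpMaj χ Ψ k f x ≤ ∫⁻ z, edil k χ (x - z) * ((∫⁻ x, ‖Ψ x‖ₑ) * M) := by
        refine lintegral_mono fun z => ?_
        simp only
        gcongr
        exact h1 z
    _ = _ := by
        have hm : Measurable fun z => edil k χ (x - z) :=
          hχ.measurable.edil.comp (measurable_const.sub measurable_id)
        rw [lintegral_mul_const _ hm, lintegral_sub_left_eq_self (fun y => edil k χ y),
          lintegral_edil k hχ.measurable, mul_assoc]

theorem lintegral_lpMaj_sq_le {χ : Ed d → ℝ≥0∞} {Ψ f : Ed d → ℂ} (hχ : GoodMajorant χ)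
    (hΨ : GoodKernel Ψ) (hf : Nice f) (k : ℤ) :
    ∫⁻ x, lpMaj χ Ψ k f x ^ 2 ≤ (∫⁻ x, χ x) ^ 2 * ∫⁻ x, ‖kconv (dil k Ψ) f x‖ₑ ^ 2 := by
  have hm := (measurable_kconv hf.measurable (hΨ.continuous_dil k).measurable).enorm
  have hχm := hχ.measurable.edil (k := k)
  have h1 : ∀ x, lpMaj χ Ψ k f x ^ 2 ≤
      (∫⁻ x, χ x) * ∫⁻ z, edil k χ (x - z) * ‖kconv (dil k Ψ) f z‖ₑ ^ 2 := by
    intro x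
    have hw : Measurable fun z => edil k χ (x - z) := hχm.comp (measurable_const.sub measurable_id)
    have := sq_lintegral_le (volume.withDensity fun z => edil k χ (x - z)) hm.aemeasurable
    rw [lintegral_withDensity_eq_lintegral_mul _ hw hm,
      lintegral_withDensity_eq_lintegral_mul _ hw (hm.pow_const 2), withDensity_apply _ .univ,
      setLIntegral_univ, lintegral_sub_left_eq_self (fun y => edil k χ y),
      lintegral_edil k hχ.measurable] at this
    exact this
  refine (lintegral_mono h1).trans (le_of_eq ?_)
  have hm2 : Measurable fun p : Ed d × Ed d =>
      edil k χ (p.1 - p.2) * ‖kconv (dil k Ψ) f p.2‖ₑ ^ 2 :=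
    (hχm.comp (measurable_fst.sub measurable_snd)).mul ((hm.comp measurable_snd).pow_const 2)
  rw [lintegral_const_mul _ hm2.lintegral_prod_right',
    lintegral_lintegral_sub_mul hχm (hm.pow_const 2), lintegral_edil k hχ.measurable]
  ring

theorem card_filter_annulus_le (F : Finset ℤ) {r : ℝ} (hr : 0 ≤ r) :
    (F.filter fun j : ℤ => 1 / 2 < 2 ^ j * r ∧ 2 ^ j * r < 2).card ≤ 2 := by
  rcases hr.eq_or_lt with rfl | hr
  · norm_num
  obtain ⟨m, h1, h2⟩ := exists_mem_Ico_zpow (x := (2 * r)⁻¹) (y := 2) (by positivity) one_lt_two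
  refine (Finset.card_le_card (t := {m + 1, m + 2}) fun j hj => ?_).trans Finset.card_le_two
  obtain ⟨-, h3, h4⟩ := Finset.mem_filter.1 hj
  have h5 : (2 : ℝ) ^ m < 2 ^ j := by
    refine h1.trans_lt ?_
    rw [inv_lt_iff_one_lt_mul₀ (by positivity)]
    linarith
  have h6 : (2 : ℝ) ^ j < 2 ^ (m + 3) := by
    have : (2 : ℝ) ^ (m + 3) = 4 * 2 ^ (m + 1) := by
      rw [show m + 3 = (m + 1) + 2 by ring, zpow_add₀ two_ne_zero]
      norm_num
      ring
    rw [this]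
    have h7 : (2 : ℝ) ^ j < 4 * (2 * r)⁻¹ := by
      rw [← div_eq_mul_inv, lt_div_iff₀ (by positivity)]
      linarith
    linarith
  have h5' := (zpow_lt_zpow_iff_right₀ (one_lt_two (α := ℝ))).1 h5
  have h6' := (zpow_lt_zpow_iff_right₀ (one_lt_two (α := ℝ))).1 h6
  simp only [Finset.mem_insert, Finset.mem_singleton]
  omega

theorem annMul_dil_ne_zero {j : ℤ} {ξ : Ed d} (h : annMul d ((2 : ℝ) ^ j • ξ) ≠ 0) :
    1 / 2 < 2 ^ j * ‖ξ‖ ∧ 2 ^ j * ‖ξ‖ < 2 := by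
  have e : ‖(2 : ℝ) ^ j • ξ‖ = 2 ^ j * ‖ξ‖ := by
    rw [norm_smul, Real.norm_of_nonneg (by positivity)]
  rw [← e]
  constructor
  · by_contra! hle
    exact h (annMul_eq_zero_of_le hle)
  · by_contra! hle
    exact h (annMul_eq_zero hle)

theorem sum_annMul_sq_le (F : Finset ℤ) (ξ : Ed d) :
    ∑ j ∈ F, ‖annMul d ((2 : ℝ) ^ j • ξ)‖ₑ ^ 2 ≤ 8 := by
  have h1 : ∑ j ∈ F, ‖annMul d ((2 : ℝ) ^ j • ξ)‖ₑ ^ 2 = ∑ j ∈ F.filter fun j : ℤ =>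
      1 / 2 < 2 ^ j * ‖ξ‖ ∧ 2 ^ j * ‖ξ‖ < 2, ‖annMul d ((2 : ℝ) ^ j • ξ)‖ₑ ^ 2 := by
    refine (Finset.sum_filter_of_ne fun j _ hj => annMul_dil_ne_zero fun h => hj ?_).symm
    simp [h]
  rw [h1]
  calc _ ≤ ∑ j ∈ F.filter fun j : ℤ => 1 / 2 < 2 ^ j * ‖ξ‖ ∧ 2 ^ j * ‖ξ‖ < 2, (4 : ℝ≥0∞) := by
        refine Finset.sum_le_sum fun j _ => ?_
        have : ‖annMul d ((2 : ℝ) ^ j • ξ)‖ₑ ≤ 2 := by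
          rw [← ofReal_norm]
          exact (ENNReal.ofReal_le_ofReal (norm_annMul_le _)).trans (by norm_num)
        calc _ ≤ (2 : ℝ≥0∞) ^ 2 := by gcongr
          _ = 4 := by norm_num
    _ ≤ 8 := by
        rw [Finset.sum_const, nsmul_eq_mul]
        have : ((F.filter fun j : ℤ => 1 / 2 < 2 ^ j * ‖ξ‖ ∧ 2 ^ j * ‖ξ‖ < 2).card : ℝ≥0∞) ≤ 2 := by
          exact_mod_cast card_filter_annulus_le F (norm_nonneg ξ)
        calc _ ≤ (2 : ℝ≥0∞) * 4 := by gcongr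
          _ = 8 := by norm_num

/-- The square of the Littlewood–Paley square function. -/
def sqFn (F : Finset ℤ) (f : Ed d → ℂ) (x : Ed d) : ℝ≥0∞ := ∑ j ∈ F, bandMaj j f x ^ 2

theorem measurable_sqFn (F : Finset ℤ) {f : Ed d → ℂ} (hf : Nice f) : Measurable (sqFn F f) :=
  Finset.measurable_fun_sum _ fun j _ => (measurable_bandMaj hf j).pow_const 2

theorem lintegral_sqFn_le (F : Finset ℤ) {f : Ed d → ℂ} (hf : Nice f) :
    ∫⁻ x, sqFn F f x ≤ (∫⁻ x, majKer d x) ^ 2 * 8 * ∫⁻ x, ‖f x‖ₑ ^ 2 := by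
  have hfc : Continuous (𝓕 f) :=
    VectorFourier.fourierIntegral_continuous Real.continuous_fourierChar continuous_inner
      hf.integrable
  have hac : Continuous (annMul d) := contDiff_annMul.continuous
  calc ∫⁻ x, sqFn F f x = ∑ j ∈ F, ∫⁻ x, bandMaj j f x ^ 2 :=
        lintegral_finsetSum _ fun j _ => (measurable_bandMaj hf j).pow_const 2
    _ ≤ ∑ j ∈ F, (∫⁻ x, majKer d x) ^ 2 *
          ∫⁻ ξ, ‖annMul d ((2 : ℝ) ^ j • ξ)‖ₑ ^ 2 * ‖𝓕 f ξ‖ₑ ^ 2 := by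
        refine Finset.sum_le_sum fun j _ => ?_
        refine (lintegral_lpMaj_sq_le goodMajorant_majKer (goodKernel_schwartz _) hf j).trans
          (le_of_eq ?_)
        have := lintegral_fourier_sq (hf.deltaP j).integrable (hf.deltaP j).memLp_two
        simp_rw [fourier_deltaP hf, enorm_mul, mul_pow] at this
        rw [this]
        rfl
    _ = (∫⁻ x, majKer d x) ^ 2 * ∫⁻ ξ, (∑ j ∈ F, ‖annMul d ((2 : ℝ) ^ j • ξ)‖ₑ ^ 2) *
          ‖𝓕 f ξ‖ₑ ^ 2 := by
        rw [← Finset.mul_sum, ← lintegral_finsetSum]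
        · simp_rw [Finset.sum_mul]
        · intro j _
          fun_prop
    _ ≤ (∫⁻ x, majKer d x) ^ 2 * ∫⁻ ξ, 8 * ‖𝓕 f ξ‖ₑ ^ 2 := by
        gcongr with ξ
        exact sum_annMul_sq_le F ξ
    _ = _ := by
        rw [lintegral_const_mul _ (by fun_prop), lintegral_fourier_sq hf.integrable hf.memLp_two,
          mul_assoc]

end

section

variable {d : ℕ}

theorem two_rpow_add (a b : ℝ) : (2 : ℝ≥0∞) ^ (a + b) = 2 ^ a * 2 ^ b :=
  ENNReal.rpow_add _ _ two_ne_zero ENNReal.ofNat_ne_top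

theorem two_rpow_ne_zero (a : ℝ) : (2 : ℝ≥0∞) ^ a ≠ 0 :=
  (ENNReal.rpow_pos (by norm_num) ENNReal.ofNat_ne_top).ne'

theorem two_rpow_ne_top (a : ℝ) : (2 : ℝ≥0∞) ^ a ≠ ∞ :=
  ENNReal.rpow_ne_top_of_ne_zero two_ne_zero ENNReal.ofNat_ne_top

theorem two_rpow_eq_ofReal (a : ℝ) : (2 : ℝ≥0∞) ^ a = ENNReal.ofReal (2 ^ a) := by
  rw [← ENNReal.ofReal_rpow_of_pos two_pos]
  simp

theorem exists_eq_two_rpow {u : ℝ≥0∞} (h0 : u ≠ 0) (h : u ≠ ∞) : ∃ v : ℝ, u = 2 ^ v := by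
  have : 0 < u.toReal := ENNReal.toReal_pos h0 h
  refine ⟨Real.logb 2 u.toReal, ?_⟩
  rw [two_rpow_eq_ofReal, Real.rpow_logb two_pos (by norm_num) this, ENNReal.ofReal_toReal h]

theorem two_rpow_le_two_rpow {a b : ℝ} : (2 : ℝ≥0∞) ^ a ≤ 2 ^ b ↔ a ≤ b := by
  rw [two_rpow_eq_ofReal, two_rpow_eq_ofReal, ENNReal.ofReal_le_ofReal_iff (by positivity),
    Real.rpow_le_rpow_left_iff one_lt_two]

theorem exists_tsum_two_rpow_le {s : ℝ} (hs : 0 < s) : ∃ C : ℝ≥0∞, C ≠ 0 ∧ C ≠ ∞ ∧ ∀ u : ℝ≥0∞,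
    ∑' m : ℤ, (if (2 : ℝ≥0∞) ^ (s * m) ≤ u then (2 : ℝ≥0∞) ^ (s * m) else 0) ≤ C * u := by
  have hr : (2 : ℝ≥0∞) ^ (-s) < 1 := by
    rw [← ENNReal.rpow_zero (x := 2)]
    exact lt_of_not_ge fun h => by linarith [two_rpow_le_two_rpow.1 h]
  have hC0 : (1 - (2 : ℝ≥0∞) ^ (-s))⁻¹ ≠ 0 := by simp
  refine ⟨(1 - (2 : ℝ≥0∞) ^ (-s))⁻¹, hC0, ?_, fun u => ?_⟩
  · simpa [tsub_eq_zero_iff_le] using hr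
  rcases eq_or_ne u 0 with rfl | h0
  · simp
  rcases eq_or_ne u ∞ with rfl | h
  · rw [ENNReal.mul_top hC0]
    exact le_top
  obtain ⟨v, rfl⟩ := exists_eq_two_rpow h0 h
  set m₀ := ⌊v / s⌋
  have hm0 : s * m₀ ≤ v := by
    have := Int.floor_le (v / s)
    rwa [le_div_iff₀ hs, mul_comm] at this
  have key : ∀ m : ℤ, (if (2 : ℝ≥0∞) ^ (s * m) ≤ 2 ^ v then (2 : ℝ≥0∞) ^ (s * m) else 0) ≤
      ∑' i : ℕ, if m = m₀ - i then (2 : ℝ≥0∞) ^ (s * m₀) * ((2 : ℝ≥0∞) ^ (-s)) ^ i else 0 := by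
    intro m
    split_ifs with hm
    · rw [two_rpow_le_two_rpow] at hm
      have hle : m ≤ m₀ := Int.le_floor.2 (by rw [le_div_iff₀ hs]; linarith)
      obtain ⟨i, hi⟩ := Int.le.dest hle
      refine le_trans (le_of_eq ?_) (ENNReal.le_tsum i)
      rw [if_pos (by omega), ← ENNReal.rpow_natCast, ← ENNReal.rpow_mul, ← two_rpow_add]
      congr 1
      rw [← hi]
      push_cast
      ring
    · exact zero_le
  calc _ ≤ ∑' m : ℤ, ∑' i : ℕ, (if m = m₀ - i then
        (2 : ℝ≥0∞) ^ (s * m₀) * ((2 : ℝ≥0∞) ^ (-s)) ^ i else 0) := ENNReal.tsum_le_tsum key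
    _ = ∑' i : ℕ, (2 : ℝ≥0∞) ^ (s * m₀) * ((2 : ℝ≥0∞) ^ (-s)) ^ i := by
        rw [ENNReal.tsum_comm]
        exact tsum_congr fun i => tsum_ite_eq _ _
    _ = (1 - (2 : ℝ≥0∞) ^ (-s))⁻¹ * (2 : ℝ≥0∞) ^ (s * m₀) := by
        rw [ENNReal.tsum_mul_left, ENNReal.tsum_geometric, mul_comm]
    _ ≤ _ := by
        gcongr
        · norm_num

theorem exists_tsum_le_rpow {s q : ℝ} (hs : 0 < s) (hq : 0 < q) : ∃ C : ℝ≥0∞, C ≠ ∞ ∧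
    ∀ a : ℝ≥0∞, a ≠ 0 → a ≠ ∞ → ∀ u : ℝ≥0∞,
    ∑' m : ℤ, (if a * 2 ^ (s * m) < u then (a * (2 : ℝ≥0∞) ^ (s * m)) ^ q else 0) ≤ C * u ^ q := by
  obtain ⟨C, -, hC, h⟩ := exists_tsum_two_rpow_le (mul_pos hs hq)
  refine ⟨C, hC, fun a h0 ha u => ?_⟩
  have e : ∀ m : ℤ, (if a * 2 ^ (s * m) < u then (a * (2 : ℝ≥0∞) ^ (s * m)) ^ q else 0) ≤
      a ^ q * if (2 : ℝ≥0∞) ^ (s * q * m) ≤ (u / a) ^ q then (2 : ℝ≥0∞) ^ (s * q * m) else 0 := by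
    intro m
    have e1 : (2 : ℝ≥0∞) ^ (s * q * m) = (2 ^ (s * m)) ^ q := by
      rw [← ENNReal.rpow_mul]
      ring_nf
    split_ifs with h1 h2 h2
    · rw [ENNReal.mul_rpow_of_nonneg _ _ hq.le, e1]
    · refine (h2 ?_).elim
      rw [e1]
      gcongr
      rw [ENNReal.le_div_iff_mul_le (.inl h0) (.inl ha), mul_comm]
      exact h1.le
    · exact zero_le
    · exact zero_le
  refine (ENNReal.tsum_le_tsum e).trans ?_
  rw [ENNReal.tsum_mul_left]
  calc _ ≤ a ^ q * (C * (u / a) ^ q) := by gcongr; exact h _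
    _ = C * (u / a * a) ^ q := by
        rw [ENNReal.mul_rpow_of_nonneg _ _ hq.le]
        ring
    _ = _ := by rw [ENNReal.div_mul_cancel h0 ha]

theorem exists_tsum_le_rpow_neg {s q : ℝ} (hs : 0 < s) (hq : 0 < q) : ∃ C : ℝ≥0∞, C ≠ ∞ ∧
    ∀ a : ℝ≥0∞, a ≠ 0 → a ≠ ∞ → ∀ u : ℝ≥0∞,
    ∑' m : ℤ, (if u ≤ a * 2 ^ (s * m) then (a * (2 : ℝ≥0∞) ^ (s * m)) ^ (-q) else 0) ≤
      C * u ^ (-q) := by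
  obtain ⟨C, -, hC, h⟩ := exists_tsum_two_rpow_le (mul_pos hs hq)
  refine ⟨C, hC, fun a h0 ha u => ?_⟩
  have e : ∀ m : ℤ, (if u ≤ a * 2 ^ (s * m) then (a * (2 : ℝ≥0∞) ^ (s * m)) ^ (-q) else 0) ≤
      a ^ (-q) * if (2 : ℝ≥0∞) ^ (s * q * (-m : ℤ)) ≤ (a / u) ^ q then
        (2 : ℝ≥0∞) ^ (s * q * (-m : ℤ)) else 0 := by
    intro m
    have e1 : (2 : ℝ≥0∞) ^ (s * q * (-m : ℤ)) = (2 ^ (s * m)) ^ (-q) := by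
      rw [← ENNReal.rpow_mul]
      push_cast
      ring_nf
    split_ifs with h1 h2 h2
    · rw [ENNReal.mul_rpow_of_ne_zero h0 (two_rpow_ne_zero _), e1]
    · refine (h2 ?_).elim
      rw [e1, ENNReal.rpow_neg, ← ENNReal.inv_rpow]
      gcongr
      rw [ENNReal.le_div_iff_mul_le (.inr h0) (.inr ha), mul_comm, ← ENNReal.div_eq_inv_mul.trans
        (mul_comm _ _)]
      exact ENNReal.div_le_of_le_mul h1
    · exact zero_le
    · exact zero_le
  refine (ENNReal.tsum_le_tsum e).trans ?_
  rw [ENNReal.tsum_mul_left]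
  have hneg := (Equiv.neg ℤ).tsum_eq fun m : ℤ =>
    if (2 : ℝ≥0∞) ^ (s * q * m) ≤ (a / u) ^ q then (2 : ℝ≥0∞) ^ (s * q * m) else 0
  simp only [Equiv.neg_apply] at hneg
  rw [hneg]
  calc _ ≤ a ^ (-q) * (C * (a / u) ^ q) := by gcongr; exact h _
    _ = C * ((a / u) ^ q * (a⁻¹) ^ q) := by
        rw [ENNReal.rpow_neg, ENNReal.inv_rpow]
        ring
    _ = _ := by
        rw [← ENNReal.mul_rpow_of_nonneg _ _ hq.le, ENNReal.div_eq_inv_mul, mul_assoc,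
          ENNReal.mul_inv_cancel h0 ha, mul_one, ENNReal.rpow_neg, ENNReal.inv_rpow]

theorem exists_tsum_lintegral_high_le {s q r : ℝ} (hs : 0 < s) (hq : 0 < q) (hr : 0 ≤ r) :
    ∃ C : ℝ≥0∞, C ≠ ∞ ∧ ∀ φ : Ed d → ℝ≥0∞, Measurable φ → ∀ a : ℝ≥0∞, a ≠ 0 → a ≠ ∞ →
    ∑' m : ℤ, (a * (2 : ℝ≥0∞) ^ (s * m)) ^ q * ∫⁻ x in {x | a * 2 ^ (s * m) < φ x}, φ x ^ r ≤
      C * ∫⁻ x, φ x ^ (r + q) := by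
  obtain ⟨C, hC, h⟩ := exists_tsum_le_rpow hs hq
  refine ⟨C, hC, fun φ hφ a h0 ha => ?_⟩
  have hm : ∀ m : ℤ, MeasurableSet {x | a * 2 ^ (s * m) < φ x} := fun m =>
    measurableSet_lt measurable_const hφ
  have e : ∀ m : ℤ, (a * (2 : ℝ≥0∞) ^ (s * m)) ^ q * ∫⁻ x in {x | a * 2 ^ (s * m) < φ x}, φ x ^ r =
      ∫⁻ x, (if a * 2 ^ (s * m) < φ x then (a * (2 : ℝ≥0∞) ^ (s * m)) ^ q else 0) * φ x ^ r := by
    intro m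
    rw [← lintegral_indicator (hm m), ← lintegral_const_mul _ ((hφ.pow_const r).indicator (hm m))]
    refine lintegral_congr fun x => ?_
    by_cases hx : a * 2 ^ (s * m) < φ x <;> simp [hx]
  simp_rw [e]
  rw [← lintegral_tsum]
  swap
  · intro m
    refine Measurable.aemeasurable ?_
    exact (measurable_const.ite (hm m) measurable_const).mul (hφ.pow_const r)
  simp_rw [ENNReal.tsum_mul_right]
  rw [← lintegral_const_mul _ (hφ.pow_const _)]
  refine lintegral_mono fun x => ?_
  simp only
  rw [ENNReal.rpow_add_of_nonneg _ _ hr hq.le, mul_comm (φ x ^ r), ← mul_assoc]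
  gcongr
  exact h a h0 ha _

theorem exists_tsum_lintegral_low_le {s q r : ℝ} (hs : 0 < s) (hq : 0 < q) (hr : q < r) :
    ∃ C : ℝ≥0∞, C ≠ ∞ ∧ ∀ φ : Ed d → ℝ≥0∞, Measurable φ → ∀ a : ℝ≥0∞, a ≠ 0 → a ≠ ∞ →
    ∑' m : ℤ, (a * (2 : ℝ≥0∞) ^ (s * m)) ^ (-q) * ∫⁻ x in {x | φ x ≤ a * 2 ^ (s * m)}, φ x ^ r ≤
      C * ∫⁻ x, φ x ^ (r - q) := by
  obtain ⟨C, hC, h⟩ := exists_tsum_le_rpow_neg hs hq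
  refine ⟨C, hC, fun φ hφ a h0 ha => ?_⟩
  have hm : ∀ m : ℤ, MeasurableSet {x | φ x ≤ a * 2 ^ (s * m)} := fun m =>
    measurableSet_le hφ measurable_const
  have e : ∀ m : ℤ, (a * (2 : ℝ≥0∞) ^ (s * m)) ^ (-q) *
      ∫⁻ x in {x | φ x ≤ a * 2 ^ (s * m)}, φ x ^ r =
      ∫⁻ x, (if φ x ≤ a * 2 ^ (s * m) then (a * (2 : ℝ≥0∞) ^ (s * m)) ^ (-q) else 0) *
        φ x ^ r := by
    intro m
    rw [← lintegral_indicator (hm m), ← lintegral_const_mul _ ((hφ.pow_const r).indicator (hm m))]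
    refine lintegral_congr fun x => ?_
    by_cases hx : φ x ≤ a * 2 ^ (s * m) <;> simp [hx]
  simp_rw [e]
  rw [← lintegral_tsum]
  swap
  · intro m
    refine Measurable.aemeasurable ?_
    exact (measurable_const.ite (hm m) measurable_const).mul (hφ.pow_const r)
  simp_rw [ENNReal.tsum_mul_right]
  rw [← lintegral_const_mul _ (hφ.pow_const _)]
  refine lintegral_mono fun x => ?_
  simp only
  calc _ ≤ C * φ x ^ (-q) * φ x ^ r := by gcongr; exact h a h0 ha _
    _ ≤ C * φ x ^ (r - q) := by
        rw [mul_assoc]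
        gcongr
        rcases eq_or_ne (φ x) 0 with h0 | h0
        · simp [h0, ENNReal.zero_rpow_of_pos (hq.trans hr)]
        rcases eq_or_ne (φ x) ∞ with h1 | h1
        · simp [h1, ENNReal.top_rpow_of_neg (neg_lt_zero.2 hq)]
        · rw [← ENNReal.rpow_add _ _ h0 h1]
          ring_nf
          exact le_rfl

/-- The part of `f` above height `h`. -/
def highPart (h : ℝ≥0∞) (f : Ed d → ℂ) : Ed d → ℂ := {x | h < ‖f x‖ₑ}.indicator f

/-- The part of `f` below height `h`. -/
def lowPart (h : ℝ≥0∞) (f : Ed d → ℂ) : Ed d → ℂ := {x | ‖f x‖ₑ ≤ h}.indicator f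

theorem Nice.indicator {f : Ed d → ℂ} (hf : Nice f) {s : Set (Ed d)} (hs : MeasurableSet s) :
    Nice (s.indicator f) := by
  obtain ⟨M, hM⟩ := hf.bounded
  exact ⟨hf.measurable.indicator hs, hf.integrable.indicator hs, M, fun x =>
    (norm_indicator_le_norm_self f x).trans (hM x)⟩

theorem Nice.highPart {f : Ed d → ℂ} (hf : Nice f) (h : ℝ≥0∞) : Nice (highPart h f) :=
  hf.indicator (measurableSet_lt measurable_const hf.measurable.enorm)

theorem Nice.lowPart {f : Ed d → ℂ} (hf : Nice f) (h : ℝ≥0∞) : Nice (lowPart h f) :=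
  hf.indicator (measurableSet_le hf.measurable.enorm measurable_const)

theorem highPart_add_lowPart (h : ℝ≥0∞) (f : Ed d → ℂ) :
    (fun x => highPart h f x + lowPart h f x) = f := by
  funext x
  by_cases hx : h < ‖f x‖ₑ
  · simp [highPart, lowPart, hx]
  · simp [highPart, lowPart, hx, not_lt.1 hx]

theorem enorm_lowPart_le (h : ℝ≥0∞) (f : Ed d → ℂ) (x : Ed d) : ‖lowPart h f x‖ₑ ≤ h := by
  by_cases hx : ‖f x‖ₑ ≤ h <;> simp [lowPart, hx]

theorem lintegral_highPart {f : Ed d → ℂ} (hf : Measurable f) (h : ℝ≥0∞) {r : ℝ} (hr : 0 < r) :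
    ∫⁻ x, ‖highPart h f x‖ₑ ^ r = ∫⁻ x in {x | h < ‖f x‖ₑ}, ‖f x‖ₑ ^ r := by
  rw [← lintegral_indicator (measurableSet_lt measurable_const hf.enorm)]
  refine lintegral_congr fun x => ?_
  by_cases hx : h < ‖f x‖ₑ <;> simp [highPart, hx, hr]

theorem lintegral_lowPart {f : Ed d → ℂ} (hf : Measurable f) (h : ℝ≥0∞) {r : ℝ} (hr : 0 < r) :
    ∫⁻ x, ‖lowPart h f x‖ₑ ^ r = ∫⁻ x in {x | ‖f x‖ₑ ≤ h}, ‖f x‖ₑ ^ r := by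
  rw [← lintegral_indicator (measurableSet_le hf.enorm measurable_const)]
  refine lintegral_congr fun x => ?_
  by_cases hx : ‖f x‖ₑ ≤ h <;> simp [lowPart, hx, hr]

theorem lintegral_rpow_le_tsum {φ : Ed d → ℝ≥0∞} (hφ : Measurable φ) {p : ℝ} (hp : 0 < p) :
    ∫⁻ x, φ x ^ p ≤ ∑' m : ℤ, (2 : ℝ≥0∞) ^ (p * (m + 1)) * volume {x | 2 ^ (m : ℝ) < φ x} := by
  have hm : ∀ m : ℤ, MeasurableSet {x | (2 : ℝ≥0∞) ^ (m : ℝ) < φ x} := fun m =>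
    measurableSet_lt measurable_const hφ
  have e : ∀ m : ℤ, (2 : ℝ≥0∞) ^ (p * (m + 1)) * volume {x | 2 ^ (m : ℝ) < φ x} =
      ∫⁻ x, {x | (2 : ℝ≥0∞) ^ (m : ℝ) < φ x}.indicator (fun _ => (2 : ℝ≥0∞) ^ (p * (m + 1))) x :=
    fun m => (lintegral_indicator_const (hm m) _).symm
  simp_rw [e]
  rw [← lintegral_tsum fun m => (measurable_const.indicator (hm m)).aemeasurable]
  refine lintegral_mono fun x => ?_
  simp only
  rcases eq_or_ne (φ x) 0 with h0 | h0
  · simp [h0, hp]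
  rcases eq_or_ne (φ x) ∞ with h1 | h1
  · refine le_trans le_top (le_trans (le_of_eq ?_) (ENNReal.tsum_comp_le_tsum_of_injective
      (f := fun n : ℕ => (n : ℤ)) Nat.cast_injective _))
    refine (top_le_iff.1 ?_).symm
    calc ∞ = ∑' _ : ℕ, (1 : ℝ≥0∞) := (ENNReal.tsum_const_eq_top_of_ne_zero one_ne_zero).symm
      _ ≤ _ := by
        refine ENNReal.tsum_le_tsum fun n => ?_
        rw [indicator_of_mem (by simp [h1]),
          ← ENNReal.rpow_zero (x := 2), two_rpow_le_two_rpow]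
        positivity
  obtain ⟨v, hv⟩ := exists_eq_two_rpow h0 h1
  have hc1 := Int.ceil_lt_add_one v
  have hc2 := Int.le_ceil v
  refine le_trans ?_ (ENNReal.le_tsum (⌈v⌉ - 1))
  rw [indicator_of_mem, hv, ← ENNReal.rpow_mul, two_rpow_le_two_rpow]
  · push_cast
    nlinarith
  · rw [mem_ofPred_eq, hv]
    refine lt_of_not_ge fun h => ?_
    rw [two_rpow_le_two_rpow] at h
    push_cast at h
    linarith

end

section

variable {d : ℕ}

theorem Finset.sum_sq_le_sq_sum_ennreal {ι : Type*} (s : Finset ι) (f : ι → ℝ≥0∞) :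
    ∑ i ∈ s, f i ^ 2 ≤ (∑ i ∈ s, f i) ^ 2 := by
  rw [sq (∑ i ∈ s, f i), Finset.sum_mul]
  refine Finset.sum_le_sum fun i hi => ?_
  rw [sq]
  gcongr
  exact Finset.single_le_sum (f := f) (fun _ _ => zero_le) hi

theorem lt_add_or_of_lt_mul_add {u c a b : ℝ≥0∞} (h : u < c * (a + b)) :
    u < 2 * c * a ∨ u < 2 * c * b := by
  rcases le_total a b with hab | hab
  · right
    calc u < c * (a + b) := h
      _ ≤ c * (b + b) := by gcongr
      _ = _ := by ring
  · left
    calc u < c * (a + b) := h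
      _ ≤ c * (a + a) := by gcongr
      _ = _ := by ring

theorem sqFn_add_le (F : Finset ℤ) {f g : Ed d → ℂ} (hf : Nice f) (hg : Nice g) (x : Ed d) :
    sqFn F (fun x => f x + g x) x ≤ 4 * (sqFn F f x + sqFn F g x) := by
  rw [sqFn, sqFn, sqFn, ← Finset.sum_add_distrib, Finset.mul_sum]
  refine Finset.sum_le_sum fun j _ => ?_
  have h1 : bandMaj j (fun x => f x + g x) x ≤ bandMaj j f x + bandMaj j g x :=
    lpMaj_add_le goodMajorant_majKer (goodKernel_schwartz _) hf hg j x
  calc _ ≤ (bandMaj j f x + bandMaj j g x) ^ 2 := by gcongr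
    _ ≤ _ := by
      rcases le_total (bandMaj j f x) (bandMaj j g x) with h | h
      · calc _ ≤ (bandMaj j g x + bandMaj j g x) ^ 2 := by gcongr
          _ = 4 * (0 + bandMaj j g x ^ 2) := by ring
          _ ≤ _ := by gcongr; exact zero_le
      · calc _ ≤ (bandMaj j f x + bandMaj j f x) ^ 2 := by gcongr
          _ = 4 * (bandMaj j f x ^ 2 + 0) := by ring
          _ ≤ _ := by gcongr; exact zero_le

theorem lintegral_majKer_ne_top : ∫⁻ x, majKer d x ≠ ∞ := goodMajorant_majKer.integral_ne_top

theorem exists_weak_one_sqFn (hd : 1 ≤ d) : ∃ C : ℝ≥0∞, C ≠ ∞ ∧ ∀ (F : Finset ℤ) (f : Ed d → ℂ),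
    Nice f → ∀ l : ℝ≥0∞, l ≠ 0 → l ≠ ∞ →
      l * volume {x | l ^ 2 < sqFn F f x} ≤ C * ∫⁻ x, ‖f x‖ₑ := by
  obtain ⟨C, hC, hCZ⟩ := exists_calderon_zygmund hd goodMajorant_majKer
    (goodKernel_schwartz (annKer d))
  set K := (∫⁻ x, majKer d x) ^ 2 * 8
  have hK : K ≠ ∞ := ENNReal.mul_ne_top (ENNReal.pow_ne_top lintegral_majKer_ne_top)
    ENNReal.ofNat_ne_top
  refine ⟨C + 8 * K * 2 ^ d + 3 * C, ?_, fun F f hf l hl0 hl => ?_⟩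
  · finiteness
  obtain ⟨g, b, Ω, hg, hb, hfgb, hΩm, hΩ, hgl, hgi, hbΩ⟩ := hCZ F f hf l hl0
  have hff : f = fun x => g x + b x := funext hfgb
  set A := {x | l ^ 2 ≤ 8 * sqFn F g x}
  set B := {x | l ≤ 3 * ∑ k ∈ F, bandMaj k b x} ∩ Ωᶜ
  have hsub : {x | l ^ 2 < sqFn F f x} ⊆ Ω ∪ A ∪ B := by
    intro x hx
    by_cases hxΩ : x ∈ Ω
    · exact .inl (.inl hxΩ)
    have h1 : l ^ 2 < 4 * (sqFn F g x + sqFn F b x) := by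
      refine lt_of_lt_of_le (b := sqFn F f x) hx ?_
      rw [hff]
      exact sqFn_add_le F hg hb x
    rcases lt_add_or_of_lt_mul_add h1 with h2 | h2
    · exact .inl (.inr (by
        calc _ ≤ _ := h2.le
          _ = _ := by norm_num))
    · refine .inr ⟨?_, hxΩ⟩
      have h3 : l ^ 2 ≤ (3 * ∑ k ∈ F, bandMaj k b x) ^ 2 := by
        calc l ^ 2 ≤ 2 * 4 * sqFn F b x := h2.le
          _ ≤ 9 * (∑ k ∈ F, bandMaj k b x) ^ 2 := by
            gcongr
            · norm_num
            · exact Finset.sum_sq_le_sq_sum_ennreal _ _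
          _ = _ := by ring
      exact (ENNReal.pow_le_pow_left_iff two_ne_zero).1 h3
  have hA : l * volume A ≤ 8 * K * 2 ^ d * ∫⁻ x, ‖f x‖ₑ := by
    have h1 : l ^ 2 * volume A ≤ 8 * K * 2 ^ d * (∫⁻ x, ‖f x‖ₑ) * l := by
      calc l ^ 2 * volume A ≤ ∫⁻ x, 8 * sqFn F g x :=
            mul_meas_ge_le_lintegral₀ ((measurable_sqFn F hg).const_mul 8).aemeasurable _
        _ = 8 * ∫⁻ x, sqFn F g x := lintegral_const_mul _ (measurable_sqFn F hg)
        _ ≤ 8 * (K * ∫⁻ x, ‖g x‖ₑ ^ 2) := by gcongr; exact lintegral_sqFn_le F hg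
        _ ≤ 8 * (K * ∫⁻ x, (2 ^ d * l) * ‖g x‖ₑ) := by
            gcongr with x
            rw [sq]
            gcongr
            exact hgl x
        _ = 8 * (K * ((2 ^ d * l) * ∫⁻ x, ‖g x‖ₑ)) := by
            rw [lintegral_const_mul _ hg.measurable.enorm]
        _ ≤ 8 * (K * ((2 ^ d * l) * ∫⁻ x, ‖f x‖ₑ)) := by gcongr
        _ = _ := by ring
    rw [sq, mul_assoc, mul_comm] at h1
    exact (ENNReal.mul_le_mul_iff_left hl0 hl).1 h1
  have hB : l * volume B ≤ 3 * C * ∫⁻ x, ‖f x‖ₑ := by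
    have hm : Measurable fun x => ∑ k ∈ F, bandMaj k b x :=
      Finset.measurable_fun_sum _ fun j _ => measurable_bandMaj hb j
    calc l * volume B ≤ ∫⁻ x in Ωᶜ, 3 * ∑ k ∈ F, bandMaj k b x := by
          rw [← Measure.restrict_apply' hΩm.compl]
          exact mul_meas_ge_le_lintegral₀ (hm.const_mul 3).aemeasurable _
      _ = 3 * ∑ k ∈ F, ∫⁻ x in Ωᶜ, bandMaj k b x := by
          rw [lintegral_const_mul _ hm, lintegral_finsetSum _ fun j _ => measurable_bandMaj hb j]
      _ ≤ 3 * (C * ∫⁻ x, ‖f x‖ₑ) := by gcongr; exact hbΩ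
      _ = _ := by ring
  calc l * volume {x | l ^ 2 < sqFn F f x} ≤ l * (volume Ω + volume A + volume B) := by
        gcongr
        exact (measure_mono hsub).trans ((measure_union_le _ _).trans
          (add_le_add_left (measure_union_le _ _) _))
    _ = l * volume Ω + l * volume A + l * volume B := by ring
    _ ≤ C * (∫⁻ x, ‖f x‖ₑ) + 8 * K * 2 ^ d * (∫⁻ x, ‖f x‖ₑ) + 3 * C * ∫⁻ x, ‖f x‖ₑ := by gcongr
    _ = _ := by ring

theorem exists_marcinkiewicz {p : ℝ} (hp1 : 1 < p) (hp2 : p < 2) {C₁ C₂ : ℝ≥0∞} (h₁ : C₁ ≠ ∞)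
    (h₂ : C₂ ≠ ∞) : ∃ C : ℝ≥0∞, C ≠ ∞ ∧ ∀ Q : (Ed d → ℂ) → Ed d → ℝ≥0∞,
      (∀ f, Nice f → Measurable (Q f)) →
      (∀ f, Nice f → ∀ l : ℝ≥0∞, l ≠ 0 → l ≠ ∞ →
        l * volume {x | l ^ 2 < Q f x} ≤ C₁ * ∫⁻ x, ‖f x‖ₑ) →
      (∀ f, Nice f → ∫⁻ x, Q f x ≤ C₂ * ∫⁻ x, ‖f x‖ₑ ^ 2) →
      (∀ f g, Nice f → Nice g → ∀ x, Q (fun x => f x + g x) x ≤ 4 * (Q f x + Q g x)) →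
      ∀ f, Nice f → ∫⁻ x, Q f x ^ (p / 2) ≤ C * ∫⁻ x, ‖f x‖ₑ ^ p := by
  obtain ⟨D₁, hD₁, hH⟩ := exists_tsum_lintegral_high_le (d := d) one_pos (sub_pos.2 hp1) zero_le_one
  obtain ⟨D₂, hD₂, hL⟩ := exists_tsum_lintegral_low_le (d := d) one_pos (sub_pos.2 hp2)
    (show 2 - p < 2 by linarith)
  refine ⟨2 ^ p * (3 * C₁ * D₁ + 8 * C₂ * D₂), ?_, fun Q hQ hQ1 hQ2 hQa f hf => ?_⟩
  · have := two_rpow_ne_top p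
    finiteness
  have hroot : ∀ m : ℤ, {x | (2 : ℝ≥0∞) ^ (m : ℝ) < Q f x ^ (1 / 2 : ℝ)} =
      {x | ((2 : ℝ≥0∞) ^ (m : ℝ)) ^ 2 < Q f x} := by
    intro m
    ext x
    rw [mem_ofPred_eq, mem_ofPred_eq,
      ← ENNReal.rpow_lt_rpow_iff (show (0 : ℝ) < 1 / 2 by norm_num) (y := Q f x),
      ← ENNReal.rpow_natCast, ← ENNReal.rpow_mul ((2 : ℝ≥0∞) ^ (m : ℝ))]
    norm_num
  have key : ∀ m : ℤ, (2 : ℝ≥0∞) ^ (p * (m + 1)) * volume {x | (2 : ℝ≥0∞) ^ (m : ℝ) <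
      Q f x ^ (1 / 2 : ℝ)} ≤ 2 ^ p * (3 * C₁) * ((1 * (2 : ℝ≥0∞) ^ (1 * m : ℝ)) ^ (p - 1) *
        ∫⁻ x in {x | 1 * 2 ^ (1 * m : ℝ) < ‖f x‖ₑ}, ‖f x‖ₑ ^ (1 : ℝ)) +
      2 ^ p * (8 * C₂) * ((1 * (2 : ℝ≥0∞) ^ (1 * m : ℝ)) ^ (-(2 - p)) *
        ∫⁻ x in {x | ‖f x‖ₑ ≤ 1 * 2 ^ (1 * m : ℝ)}, ‖f x‖ₑ ^ (2 : ℝ)) := by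
    intro m
    rw [hroot, one_mul, one_mul]
    set h : ℝ≥0∞ := 2 ^ (m : ℝ) with hh
    have hh0 : h ≠ 0 := two_rpow_ne_zero _
    have hht : h ≠ ∞ := two_rpow_ne_top _
    rw [← lintegral_highPart hf.measurable h one_pos, ← lintegral_lowPart hf.measurable h two_pos]
    set H := highPart h f
    set L := lowPart h f
    have hsub : {x | h ^ 2 < Q f x} ⊆ {x | (h / 3) ^ 2 < Q H x} ∪ {x | h ^ 2 ≤ 8 * Q L x} := by
      intro x hx
      have h1 : h ^ 2 < 4 * (Q H x + Q L x) := by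
        refine lt_of_lt_of_le (b := Q f x) hx ?_
        have := hQa H L (hf.highPart h) (hf.lowPart h) x
        rwa [highPart_add_lowPart] at this
      rcases lt_add_or_of_lt_mul_add h1 with h2 | h2
      · left
        rw [mem_ofPred_eq, div_eq_mul_inv, mul_pow, ← ENNReal.inv_pow, ← div_eq_mul_inv]
        refine ENNReal.div_lt_of_lt_mul (h2.trans_le ?_)
        rw [mul_comm]
        gcongr
        norm_num
      · right
        calc _ ≤ _ := h2.le
          _ = _ := by norm_num
    have hv1 : volume {x | (h / 3) ^ 2 < Q H x} ≤ 3 * C₁ * (h⁻¹ * ∫⁻ x, ‖H x‖ₑ ^ (1 : ℝ)) := by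
      have h3 : h / 3 ≠ 0 := ENNReal.div_ne_zero.2 ⟨hh0, by norm_num⟩
      have h3t : h / 3 ≠ ∞ := ENNReal.div_ne_top hht (by norm_num)
      have := hQ1 H (hf.highPart h) (h / 3) h3 h3t
      simp only [ENNReal.rpow_one]
      calc _ = (h / 3)⁻¹ * ((h / 3) * volume {x | (h / 3) ^ 2 < Q H x}) := by
            rw [← mul_assoc, ENNReal.inv_mul_cancel h3 h3t, one_mul]
        _ ≤ (h / 3)⁻¹ * (C₁ * ∫⁻ x, ‖H x‖ₑ) := by gcongr
        _ = _ := by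
            rw [ENNReal.inv_div (by norm_num) (by norm_num), ENNReal.div_eq_inv_mul]
            ring
    have hv2 : volume {x | h ^ 2 ≤ 8 * Q L x} ≤
        8 * C₂ * ((h ^ 2)⁻¹ * ∫⁻ x, ‖L x‖ₑ ^ (2 : ℝ)) := by
      have hh2 : h ^ 2 ≠ 0 := pow_ne_zero _ hh0
      have hh2t : h ^ 2 ≠ ∞ := ENNReal.pow_ne_top hht
      calc _ = (h ^ 2)⁻¹ * (h ^ 2 * volume {x | h ^ 2 ≤ 8 * Q L x}) := by
            rw [← mul_assoc, ENNReal.inv_mul_cancel hh2 hh2t, one_mul]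
        _ ≤ (h ^ 2)⁻¹ * ∫⁻ x, 8 * Q L x := by
            gcongr
            exact mul_meas_ge_le_lintegral₀ ((hQ _ (hf.lowPart h)).const_mul 8).aemeasurable _
        _ = (h ^ 2)⁻¹ * (8 * ∫⁻ x, Q L x) := by
            rw [lintegral_const_mul _ (hQ _ (hf.lowPart h))]
        _ ≤ (h ^ 2)⁻¹ * (8 * (C₂ * ∫⁻ x, ‖L x‖ₑ ^ 2)) := by
            gcongr
            exact hQ2 _ (hf.lowPart h)
        _ = _ := by
            simp only [ENNReal.rpow_two]
            ring
    have e0 : (2 : ℝ≥0∞) ^ (p * (m + 1)) = 2 ^ p * h ^ p := by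
      rw [hh, ← ENNReal.rpow_mul, ← two_rpow_add]
      ring_nf
    have e1 : h ^ p * h⁻¹ = h ^ (p - 1) := by
      rw [ENNReal.rpow_sub _ _ hh0 hht, ENNReal.rpow_one, ENNReal.div_eq_inv_mul, mul_comm]
    have e2 : h ^ p * (h ^ 2)⁻¹ = h ^ (-(2 - p)) := by
      rw [neg_sub, ENNReal.rpow_sub _ _ hh0 hht, ENNReal.rpow_two, ENNReal.div_eq_inv_mul, mul_comm]
    calc _ ≤ 2 ^ p * h ^ p * (3 * C₁ * (h⁻¹ * ∫⁻ x, ‖H x‖ₑ ^ (1 : ℝ)) +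
          8 * C₂ * ((h ^ 2)⁻¹ * ∫⁻ x, ‖L x‖ₑ ^ (2 : ℝ))) := by
          rw [e0]
          gcongr
          exact (measure_mono hsub).trans ((measure_union_le _ _).trans (add_le_add hv1 hv2))
      _ = 2 ^ p * (3 * C₁) * (h ^ p * h⁻¹ * ∫⁻ x, ‖H x‖ₑ ^ (1 : ℝ)) +
          2 ^ p * (8 * C₂) * (h ^ p * (h ^ 2)⁻¹ * ∫⁻ x, ‖L x‖ₑ ^ (2 : ℝ)) := by ring
      _ = _ := by rw [e1, e2]
  have hp0 : 0 < p := by linarith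
  have hQr : Measurable fun x => Q f x ^ (1 / 2 : ℝ) := (hQ f hf).pow_const _
  calc ∫⁻ x, Q f x ^ (p / 2) = ∫⁻ x, (Q f x ^ (1 / 2 : ℝ)) ^ p := by
        refine lintegral_congr fun x => ?_
        rw [← ENNReal.rpow_mul]
        ring_nf
    _ ≤ _ := lintegral_rpow_le_tsum hQr hp0
    _ ≤ _ := ENNReal.tsum_le_tsum key
    _ = 2 ^ p * (3 * C₁) * ∑' m : ℤ, ((1 * (2 : ℝ≥0∞) ^ (1 * m : ℝ)) ^ (p - 1) *
        ∫⁻ x in {x | 1 * 2 ^ (1 * m : ℝ) < ‖f x‖ₑ}, ‖f x‖ₑ ^ (1 : ℝ)) +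
      2 ^ p * (8 * C₂) * ∑' m : ℤ, ((1 * (2 : ℝ≥0∞) ^ (1 * m : ℝ)) ^ (-(2 - p)) *
        ∫⁻ x in {x | ‖f x‖ₑ ≤ 1 * 2 ^ (1 * m : ℝ)}, ‖f x‖ₑ ^ (2 : ℝ)) := by
        rw [ENNReal.tsum_add, ENNReal.tsum_mul_left, ENNReal.tsum_mul_left]
    _ ≤ 2 ^ p * (3 * C₁) * (D₁ * ∫⁻ x, ‖f x‖ₑ ^ (1 + (p - 1))) +
        2 ^ p * (8 * C₂) * (D₂ * ∫⁻ x, ‖f x‖ₑ ^ (2 - (2 - p))) := by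
        gcongr
        · exact hH _ hf.measurable.enorm 1 one_ne_zero ENNReal.one_ne_top
        · exact hL _ hf.measurable.enorm 1 one_ne_zero ENNReal.one_ne_top
    _ = _ := by
        rw [show 1 + (p - 1) = p by ring, show 2 - (2 - p) = p by ring]
        ring

theorem exists_lintegral_sqFn_rpow_le (hd : 1 ≤ d) {p : ℝ} (hp1 : 1 < p) (hp2 : p < 2) :
    ∃ C : ℝ≥0∞, C ≠ ∞ ∧ ∀ (F : Finset ℤ) (f : Ed d → ℂ), Nice f →
      ∫⁻ x, sqFn F f x ^ (p / 2) ≤ C * ∫⁻ x, ‖f x‖ₑ ^ p := by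
  obtain ⟨C₁, hC₁, h₁⟩ := exists_weak_one_sqFn hd
  have hK : (∫⁻ x, majKer d x) ^ 2 * 8 ≠ ∞ :=
    ENNReal.mul_ne_top (ENNReal.pow_ne_top lintegral_majKer_ne_top) ENNReal.ofNat_ne_top
  obtain ⟨C, hC, h⟩ := exists_marcinkiewicz (d := d) hp1 hp2 hC₁ hK
  exact ⟨C, hC, fun F => h (sqFn F) (fun _ => measurable_sqFn F) (h₁ F)
    (fun _ => lintegral_sqFn_le F) fun _ _ => sqFn_add_le F⟩

end

section

variable {d : ℕ}

theorem rpow_mul_lintegral_highPart_le {f : Ed d → ℂ} (hf : Measurable f) {h : ℝ≥0∞} {p : ℝ}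
    (hp : 1 ≤ p) :
    h ^ (p - 1) * ∫⁻ x, ‖highPart h f x‖ₑ ≤ ∫⁻ x, ‖f x‖ₑ ^ p := by
  have hm : Measurable (highPart h f) :=
    hf.indicator (measurableSet_lt measurable_const hf.enorm)
  rw [← lintegral_const_mul _ hm.enorm]
  refine lintegral_mono fun x => ?_
  simp only
  by_cases hx : h < ‖f x‖ₑ
  · calc h ^ (p - 1) * ‖highPart h f x‖ₑ ≤ ‖f x‖ₑ ^ (p - 1) * ‖f x‖ₑ ^ (1 : ℝ) := by
          simp only [highPart, ENNReal.rpow_one]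
          gcongr
          exact enorm_indicator_le_enorm_self f x
      _ = ‖f x‖ₑ ^ p := by
          rw [← ENNReal.rpow_add_of_nonneg _ _ (by linarith) zero_le_one]
          ring_nf
  · simp [highPart, hx]

theorem exists_weak_lowMaj (hd : 1 ≤ d) {p : ℝ} (hp : 1 ≤ p) : ∃ C : ℝ≥0∞, C ≠ ∞ ∧
    ∀ (F : Finset ℤ) (f : Ed d → ℂ), Nice f → ∀ l : ℝ≥0∞, l ≠ 0 → l ≠ ∞ →
      l ^ p * volume {x | ∃ k ∈ F, l < lowMaj k f x} ≤ C * ∫⁻ x, ‖f x‖ₑ ^ p := by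
  obtain ⟨C, hC, hCZ⟩ := exists_calderon_zygmund hd goodMajorant_majKer
    (goodKernel_schwartz (cutoffKer d))
  set c : ℝ≥0∞ := (∫⁻ x, majKer d x) * ∫⁻ x, ‖cutoffKer d x‖ₑ
  have hc : c ≠ ∞ := ENNReal.mul_ne_top lintegral_majKer_ne_top
    (goodKernel_schwartz (cutoffKer d)).integrable.2.ne
  set M : ℝ≥0∞ := c * (1 + 2 ^ d) + 1
  have hM0 : M ≠ 0 := by simp [M]
  have hM : M ≠ ∞ := by simp only [M]; finiteness
  have hp0 : 0 ≤ p := by linarith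
  refine ⟨M ^ p * (2 * C), by finiteness, fun F f hf l hl0 hl => ?_⟩
  set h := l / M
  have hh0 : h ≠ 0 := ENNReal.div_ne_zero.2 ⟨hl0, hM⟩
  have hht : h ≠ ∞ := ENNReal.div_ne_top hl hM0
  have hlM : l = M * h := (ENNReal.mul_div_cancel hM0 hM).symm
  have hH := hf.highPart h
  obtain ⟨g, b, Ω, hg, hb, hfgb, hΩm, hΩ, hgl, hgi, hbΩ⟩ := hCZ F _ hH h hh0
  have hff : f = fun x => (g x + b x) + lowPart h f x := by
    conv_lhs => rw [← highPart_add_lowPart h f]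
    funext x
    rw [hfgb]
  set B := {x | h ≤ ∑ k ∈ F, lowMaj k b x} ∩ Ωᶜ
  have hsub : {x | ∃ k ∈ F, l < lowMaj k f x} ⊆ Ω ∪ B := by
    rintro x ⟨k, hk, hx⟩
    by_cases hxΩ : x ∈ Ω
    · exact .inl hxΩ
    refine .inr ⟨?_, hxΩ⟩
    have h1 : lowMaj k f x ≤ lowMaj k g x + lowMaj k b x + lowMaj k (lowPart h f) x := by
      conv_lhs => rw [hff]
      exact (lpMaj_add_le goodMajorant_majKer (goodKernel_schwartz _) (hg.add hb)
        (hf.lowPart h) k x).trans (add_le_add_left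
          (lpMaj_add_le goodMajorant_majKer (goodKernel_schwartz _) hg hb k x) _)
    have h2 : lowMaj k g x ≤ c * (2 ^ d * h) :=
      lpMaj_le_of_bound goodMajorant_majKer (goodKernel_schwartz _) hgl k x
    have h3 : lowMaj k (lowPart h f) x ≤ c * h :=
      lpMaj_le_of_bound goodMajorant_majKer (goodKernel_schwartz _) (enorm_lowPart_le h f) k x
    have h4 : c * (1 + 2 ^ d) * h + h ≤ c * (1 + 2 ^ d) * h + lowMaj k b x := by
      calc c * (1 + 2 ^ d) * h + h = M * h := by simp only [M]; ring
        _ = l := hlM.symm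
        _ ≤ _ := hx.le
        _ ≤ _ := h1
        _ ≤ c * (2 ^ d * h) + lowMaj k b x + c * h := by gcongr
        _ = _ := by ring
    have h5 : h ≤ lowMaj k b x := by
      refine (ENNReal.add_le_add_iff_left ?_).1 h4
      finiteness
    exact h5.trans (Finset.single_le_sum (f := fun k => lowMaj k b x) (fun _ _ => zero_le) hk)
  have hB : h * volume B ≤ C * ∫⁻ x, ‖highPart h f x‖ₑ := by
    have hm : Measurable fun x => ∑ k ∈ F, lowMaj k b x :=
      Finset.measurable_fun_sum _ fun j _ => measurable_lowMaj hb j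
    calc h * volume B ≤ ∫⁻ x in Ωᶜ, ∑ k ∈ F, lowMaj k b x := by
          rw [← Measure.restrict_apply' hΩm.compl]
          exact mul_meas_ge_le_lintegral₀ hm.aemeasurable _
      _ = ∑ k ∈ F, ∫⁻ x in Ωᶜ, lowMaj k b x :=
          lintegral_finsetSum _ fun j _ => measurable_lowMaj hb j
      _ ≤ _ := hbΩ
  calc l ^ p * volume {x | ∃ k ∈ F, l < lowMaj k f x}
      ≤ l ^ p * (volume Ω + volume B) := by
        gcongr
        exact (measure_mono hsub).trans (measure_union_le _ _)
    _ = M ^ p * (h ^ (p - 1) * (h * volume Ω + h * volume B)) := by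
        rw [hlM, ENNReal.mul_rpow_of_nonneg _ _ hp0]
        have : h ^ p = h ^ (p - 1) * h := by
          conv_rhs => rw [← ENNReal.rpow_one h, ← ENNReal.rpow_mul, one_mul,
            ← ENNReal.rpow_add _ _ hh0 hht]
          ring_nf
        rw [this]
        ring
    _ ≤ M ^ p * (h ^ (p - 1) * (C * (∫⁻ x, ‖highPart h f x‖ₑ) +
          C * ∫⁻ x, ‖highPart h f x‖ₑ)) := by gcongr
    _ = M ^ p * (2 * C) * (h ^ (p - 1) * ∫⁻ x, ‖highPart h f x‖ₑ) := by ring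
    _ ≤ _ := by
        gcongr
        exact rpow_mul_lintegral_highPart_le hf.measurable hp

end

section

open FourierTransform Real

variable {d : ℕ}

theorem sphereCos_eq_besselU (i : Fin d) {x : Ed d} {r : ℝ} (h : ‖x‖ = |r|) :
    sphereCos d x = besselU d i r := by
  rw [sphereCos_eq_of_norm_eq (x' := EuclideanSpace.single i r)
    (by rw [h, PiLp.norm_single, Real.norm_eq_abs]), sphereCos, besselU]
  refine integral_congr_ae (ae_of_all _ fun y => ?_)
  simp only [EuclideanSpace.inner_single_right]
  simp

theorem sphMean_fourierInv (i : Fin d) {g : Ed d → ℂ} (hg : Integrable g) (t : ℝ) (x : Ed d) :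
    sphMean d t (𝓕⁻ g) x = 𝓕⁻ (fun ξ => (besselU d i (2 * π * (t * ‖ξ‖)) : ℂ) * g ξ) x := by
  have := isProbabilityMeasure_sphereProb (d := d) i.pos
  rw [sphMean]
  simp_rw [Real.fourierInv_eq]
  rw [integral_integral_swap]
  · refine integral_congr_ae (ae_of_all _ fun ξ => ?_)
    simp only
    have e : ∀ y : sphere (0 : Ed d) 1, 𝐞 (inner ℝ ξ (x - t • (y : Ed d))) • g ξ =
        (𝐞 (inner ℝ ξ x) • g ξ) * Complex.exp
          (((inner ℝ (y : Ed d) ((-(2 * π * t)) • ξ) : ℝ) : ℂ) * Complex.I) := by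
      intro y
      rw [inner_sub_right, inner_smul_right, inner_smul_right, Circle.smul_def, Circle.smul_def,
        Real.fourierChar_apply, Real.fourierChar_apply, smul_eq_mul, smul_eq_mul,
        mul_right_comm (Complex.exp _) (g ξ), ← Complex.exp_add, real_inner_comm ξ (y : Ed d)]
      congr 2
      push_cast
      ring
    simp_rw [e]
    rw [integral_const_mul, integral_sphere_exp, sphereCos_eq_besselU i (r := 2 * π * (t * ‖ξ‖)),
      Circle.smul_def, Circle.smul_def, smul_eq_mul, smul_eq_mul]
    · ring
    · rw [norm_smul, norm_neg, Real.norm_eq_abs, ← mul_assoc, abs_mul (2 * π * t), abs_norm]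
  · refine ((hg.comp_snd (sphereProb d)).norm).mono' ?_ (ae_of_all _ fun p => ?_)
    · have h1 : Continuous fun p : sphere (0 : Ed d) 1 × Ed d =>
          𝐞 (inner ℝ p.2 (x - t • (p.1 : Ed d))) := by
        have := Real.continuous_fourierChar
        fun_prop
      exact h1.aestronglyMeasurable.smul (hg.comp_snd (sphereProb d)).1
    · simp [Function.uncurry, Circle.norm_smul]

/-- The derivative in the radius of the multiplier of the spherical means. -/
def derivMul (i : Fin d) (s : ℝ) (ξ : Ed d) : ℝ := 2 * π * ‖ξ‖ * besselU' d i (2 * π * (s * ‖ξ‖))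

theorem continuous_besselU (i : Fin d) : Continuous (besselU d i) :=
  continuous_iff_continuousAt.2 fun r => (hasDerivAt_besselU i r).continuousAt

theorem continuous_besselU' (i : Fin d) : Continuous (besselU' d i) :=
  continuous_iff_continuousAt.2 fun r => (hasDerivAt_besselU' i r).continuousAt

theorem continuous_derivMul (i : Fin d) : Continuous fun p : ℝ × Ed d => derivMul i p.1 p.2 := by
  have := continuous_besselU' i
  unfold derivMul
  fun_prop

theorem integral_derivMul (i : Fin d) (a b : ℝ) (ξ : Ed d) :
    ∫ s in a..b, derivMul i s ξ =
      besselU d i (2 * π * (b * ‖ξ‖)) - besselU d i (2 * π * (a * ‖ξ‖)) := by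
  refine intervalIntegral.integral_eq_sub_of_hasDerivAt
    (f := fun s => besselU d i (2 * π * (s * ‖ξ‖))) (fun s _ => ?_) ?_
  · have h1 : HasDerivAt (fun s => 2 * π * (s * ‖ξ‖)) (2 * π * (1 * ‖ξ‖)) s :=
      ((hasDerivAt_id s).mul_const _).const_mul _
    refine ((hasDerivAt_besselU i _).comp s h1).congr_deriv ?_
    rw [derivMul]
    ring
  · exact ((continuous_derivMul i).comp (by fun_prop : Continuous fun s : ℝ => (s, ξ))).intervalIntegrable
      _ _

/-- The derivative in the radius of the spherical means of `𝓕⁻ g`. -/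
def derivMean (i : Fin d) (g : Ed d → ℂ) (s : ℝ) (x : Ed d) : ℂ :=
  𝓕⁻ (fun ξ => (derivMul i s ξ : ℂ) * g ξ) x

theorem fourierInv_sub_eq_integral (i : Fin d) {g : Ed d → ℂ} (hg : Continuous g)
    (hc : HasCompactSupport g) (a b : ℝ) (x : Ed d) :
    𝓕⁻ (fun ξ => (besselU d i (2 * π * (b * ‖ξ‖)) : ℂ) * g ξ) x -
      𝓕⁻ (fun ξ => (besselU d i (2 * π * (a * ‖ξ‖)) : ℂ) * g ξ) x =
      ∫ s in a..b, derivMean i g s x := by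
  have hU := continuous_besselU i
  have hi : ∀ t : ℝ, Integrable fun ξ : Ed d =>
      𝐞 (inner ℝ ξ x) • ((besselU d i (2 * π * (t * ‖ξ‖)) : ℂ) * g ξ) := by
    intro t
    have hcont : Continuous fun ξ : Ed d =>
        𝐞 (inner ℝ ξ x) • ((besselU d i (2 * π * (t * ‖ξ‖)) : ℂ) * g ξ) := by
      have := Real.continuous_fourierChar
      fun_prop
    exact hcont.integrable_of_hasCompactSupport (hc.mul_left.smul_left)
  simp_rw [derivMean, Real.fourierInv_eq]
  rw [← integral_sub (hi b) (hi a), intervalIntegral_integral_swap]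
  · refine integral_congr_ae (ae_of_all _ fun ξ => ?_)
    simp only
    rw [← smul_sub, ← sub_mul, ← Complex.ofReal_sub, ← integral_derivMul,
      ← intervalIntegral.integral_ofReal, ← intervalIntegral.integral_mul_const]
    simp_rw [Circle.smul_def]
    rw [intervalIntegral.integral_smul]
  · have hcont : Continuous (Function.uncurry fun (s : ℝ) (ξ : Ed d) =>
        𝐞 (inner ℝ ξ x) • ((derivMul i s ξ : ℂ) * g ξ)) := by
      have h1 := Real.continuous_fourierChar
      have h2 := continuous_derivMul i
      unfold Function.uncurry
      fun_prop
    rw [Measure.restrict_prod_eq_prod_univ]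
    refine (IntegrableOn.mono_set (t := uIcc a b ×ˢ univ) ?_
      (prod_mono_left uIoc_subset_uIcc))
    have hzero : ∀ p ∉ uIcc a b ×ˢ tsupport g, p ∈ uIcc a b ×ˢ (univ : Set (Ed d)) →
        Function.uncurry (fun (s : ℝ) (ξ : Ed d) =>
        𝐞 (inner ℝ ξ x) • ((derivMul i s ξ : ℂ) * g ξ)) p = 0 := by
      rintro ⟨s, ξ⟩ h1 h2
      have : ξ ∉ tsupport g := fun h => h1 ⟨h2.1, h⟩
      simp [Function.uncurry, image_eq_zero_of_notMem_tsupport this]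
    refine ((hcont.continuousOn.integrableOn_compact
      (isCompact_uIcc.prod hc)).of_forall_sdiff_eq_zero
        (measurableSet_uIcc.prod .univ) fun p hp => hzero p hp.2 hp.1)

theorem measurable_derivMean (i : Fin d) {g : Ed d → ℂ} (hg : Continuous g) :
    Measurable fun p : ℝ × Ed d => derivMean i g p.1 p.2 := by
  have hcont : Continuous fun q : (ℝ × Ed d) × Ed d =>
      𝐞 (inner ℝ q.2 q.1.2) • ((derivMul i q.1.1 q.2 : ℂ) * g q.2) := by
    have h1 := Real.continuous_fourierChar
    have h2 : Continuous fun q : (ℝ × Ed d) × Ed d => derivMul i q.1.1 q.2 :=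
      (continuous_const.mul continuous_snd.norm).mul ((continuous_besselU' i).comp
        (continuous_const.mul (continuous_fst.fst.mul continuous_snd.norm)))
    have h3 : Continuous fun q : (ℝ × Ed d) × Ed d => inner ℝ q.2 q.1.2 :=
      continuous_snd.inner continuous_fst.snd
    exact (h1.comp h3).smul ((Complex.continuous_ofReal.comp h2).mul (hg.comp continuous_snd))
  have e : (fun p : ℝ × Ed d => derivMean i g p.1 p.2) =
      fun p => ∫ ξ, 𝐞 (inner ℝ ξ p.2) • ((derivMul i p.1 ξ : ℂ) * g ξ) := by
    funext p
    rw [derivMean, Real.fourierInv_eq]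
  rw [e]
  exact (hcont.stronglyMeasurable.integral_prod_right' (ν := volume)).measurable

theorem enorm_sphMean_sq_le (i : Fin d) {g : Ed d → ℂ} (hg : Continuous g)
    (hc : HasCompactSupport g) {t t' δ : ℝ} (h : |t - t'| ≤ δ) (x : Ed d) :
    ‖sphMean d t (𝓕⁻ g) x‖ₑ ^ 2 ≤
      2 * ‖𝓕⁻ (fun ξ => (besselU d i (2 * π * (t' * ‖ξ‖)) : ℂ) * g ξ) x‖ₑ ^ 2 +
      4 * ENNReal.ofReal δ * ∫⁻ s in Icc (t' - δ) (t' + δ), ‖derivMean i g s x‖ₑ ^ 2 := by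
  have hgi := hg.integrable_of_hasCompactSupport hc (μ := volume)
  rw [sphMean_fourierInv i hgi]
  set a := 𝓕⁻ (fun ξ => (besselU d i (2 * π * (t' * ‖ξ‖)) : ℂ) * g ξ) x
  have hδ : 0 ≤ δ := (abs_nonneg _).trans h
  have hm : Measurable fun s => ‖derivMean i g s x‖ₑ :=
    ((measurable_derivMean i hg).comp (measurable_id.prodMk measurable_const)).enorm
  have h1 : ‖𝓕⁻ (fun ξ => (besselU d i (2 * π * (t * ‖ξ‖)) : ℂ) * g ξ) x‖ₑ ≤
      ‖a‖ₑ + ∫⁻ s in Icc (t' - δ) (t' + δ), ‖derivMean i g s x‖ₑ := by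
    rw [← sub_add_cancel (𝓕⁻ (fun ξ => (besselU d i (2 * π * (t * ‖ξ‖)) : ℂ) * g ξ) x) a,
      fourierInv_sub_eq_integral i hg hc, add_comm]
    refine (enorm_add_le _ _).trans (add_le_add le_rfl ?_)
    rw [← ofReal_norm, intervalIntegral.norm_intervalIntegral_eq, ofReal_norm]
    refine (enorm_integral_le_lintegral_enorm _).trans (lintegral_mono_set ?_)
    intro s hs
    have := abs_le.1 h
    rw [mem_uIoc] at hs
    constructor <;> rcases hs with hs | hs <;> linarith [hs.1, hs.2]
  have h2 := sq_lintegral_le (volume.restrict (Icc (t' - δ) (t' + δ))) hm.aemeasurable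
  rw [Measure.restrict_apply_univ, Real.volume_Icc] at h2
  set b := ∫⁻ s in Icc (t' - δ) (t' + δ), ‖derivMean i g s x‖ₑ
  have h3 : (‖a‖ₑ + b) ^ 2 ≤ 2 * ‖a‖ₑ ^ 2 + 2 * b ^ 2 := by
    have := ENNReal.rpow_add_le_mul_rpow_add_rpow ‖a‖ₑ b (p := 2) one_le_two
    norm_num at this
    rwa [mul_add] at this
  calc _ ≤ (‖a‖ₑ + b) ^ 2 := by gcongr
    _ ≤ _ := h3
    _ ≤ 2 * ‖a‖ₑ ^ 2 + 2 * (ENNReal.ofReal (t' + δ - (t' - δ)) *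
        ∫⁻ s in Icc (t' - δ) (t' + δ), ‖derivMean i g s x‖ₑ ^ 2) := by gcongr
    _ = _ := by
        rw [show t' + δ - (t' - δ) = 2 * δ by ring, ENNReal.ofReal_mul zero_le_two]
        norm_num
        ring

end

section

open FourierTransform Real

variable {d : ℕ}

theorem exists_multiplier_bounds (i : Fin d) : ∃ C : ℝ, 0 < C ∧ ∀ (n : ℕ) (j : ℤ) (s : ℝ)
    (ξ : Ed d), (2 : ℝ) ^ (j + n - 1) ≤ s → 1 / 2 < 2 ^ j * ‖ξ‖ →
      besselU d i (2 * π * (s * ‖ξ‖)) ^ 2 ≤ C * ((2 ^ n) ^ (d - 1))⁻¹ ∧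
      besselU' d i (2 * π * (s * ‖ξ‖)) ^ 2 ≤ C * ((2 ^ n) ^ (d - 1))⁻¹ := by
  obtain ⟨C, hC, h⟩ := exists_bessel_energy_le i
  refine ⟨C, hC, fun n j s ξ hs hξ => ?_⟩
  set r := 2 * π * (s * ‖ξ‖)
  have hr : (2 : ℝ) ^ n ≤ r := by
    have e : (2 : ℝ) ^ (j + n - 1) = 2 ^ j * 2 ^ n / 2 := by
      rw [zpow_sub₀ two_ne_zero, zpow_add₀ two_ne_zero, zpow_natCast, zpow_one]
    have h1 : (2 : ℝ) ^ n * (1 / 4) ≤ s * ‖ξ‖ := by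
      calc (2 : ℝ) ^ n * (1 / 4) = 2 ^ n / 2 * (1 / 2) := by ring
        _ ≤ 2 ^ n / 2 * (2 ^ j * ‖ξ‖) := by gcongr
        _ = 2 ^ (j + n - 1) * ‖ξ‖ := by rw [e]; ring
        _ ≤ _ := by gcongr
    calc (2 : ℝ) ^ n = 4 * ((2 : ℝ) ^ n * (1 / 4)) := by ring
      _ ≤ 2 * π * (s * ‖ξ‖) := by
        gcongr
        linarith [Real.pi_gt_three]
  have hE := h r ((by positivity : (0 : ℝ) ≤ 2 ^ n).trans hr)
  have hp : ((2 : ℝ) ^ n) ^ (d - 1) ≤ r ^ (d - 1) := by gcongr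
  have hpos : (0 : ℝ) < (2 ^ n) ^ (d - 1) := by positivity
  have h2 : besselU d i r ^ 2 + besselU' d i r ^ 2 ≤ C * ((2 ^ n) ^ (d - 1))⁻¹ := by
    rw [← div_eq_mul_inv, le_div_iff₀ hpos, mul_comm]
    exact (mul_le_mul_of_nonneg_right hp (by positivity)).trans hE
  exact ⟨by nlinarith [sq_nonneg (besselU' d i r)], by nlinarith [sq_nonneg (besselU d i r)]⟩

theorem continuous_fourier_of_integrable {f : Ed d → ℂ} (hf : Integrable f) : Continuous (𝓕 f) :=
  VectorFourier.fourierIntegral_continuous Real.continuous_fourierChar continuous_inner hf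

theorem lintegral_fourierInv_mul_sq_le {g : Ed d → ℂ} (hg : Continuous g) (hc : HasCompactSupport g)
    {m : Ed d → ℝ} (hm : Continuous m) {c : ℝ} (h : ∀ ξ, g ξ ≠ 0 → m ξ ^ 2 ≤ c) :
    ∫⁻ x, ‖𝓕⁻ (fun ξ => (m ξ : ℂ) * g ξ) x‖ₑ ^ 2 ≤ ENNReal.ofReal c * ∫⁻ ξ, ‖g ξ‖ₑ ^ 2 := by
  have hcont : Continuous fun ξ => (m ξ : ℂ) * g ξ := (Complex.continuous_ofReal.comp hm).mul hg
  have hsupp : HasCompactSupport fun ξ => (m ξ : ℂ) * g ξ := hc.mul_left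
  rw [lintegral_fourierInv_sq (hcont.integrable_of_hasCompactSupport hsupp)
    (hcont.memLp_of_hasCompactSupport hsupp), ← lintegral_const_mul _ (by fun_prop)]
  refine lintegral_mono fun ξ => ?_
  rcases eq_or_ne (g ξ) 0 with h0 | h0
  · simp [h0]
  · simp only
    rw [enorm_mul, mul_pow]
    gcongr
    rw [← ofReal_norm, Complex.norm_real, Real.norm_eq_abs, ← ENNReal.ofReal_pow (abs_nonneg _),
      sq_abs]
    exact ENNReal.ofReal_le_ofReal (h ξ h0)

theorem exists_sphMean_bandP_sq_le (hd : 1 ≤ d) : ∃ C : ℝ≥0∞, C ≠ ∞ ∧ ∀ (n : ℕ) (j : ℤ) (t' : ℝ),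
    1 ≤ n → (2 : ℝ) ^ (j + n) ≤ t' → ∀ f : Ed d → ℂ, Nice f → ∃ V : Ed d → ℝ≥0∞, Measurable V ∧
      (∀ t x, |t - t'| ≤ 2 ^ j → ‖sphMean d t (bandP j f) x‖ₑ ^ 2 ≤ V x) ∧
      ∫⁻ x, V x ≤ C * ((2 ^ n) ^ (d - 1))⁻¹ *
        ∫⁻ ξ, ‖annMul d ((2 : ℝ) ^ j • ξ)‖ₑ ^ 2 * ‖𝓕 f ξ‖ₑ ^ 2 := by
  let i : Fin d := ⟨0, hd⟩
  obtain ⟨C, hC, hU⟩ := exists_multiplier_bounds i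
  refine ⟨4 * ((2 + 8 * 16 * ENNReal.ofReal (π ^ 2)) * ENNReal.ofReal C), by finiteness,
    fun n j t' hn ht f hf => ?_⟩
  set δ : ℝ := 2 ^ j with hδ
  have hδ0 : 0 < δ := by positivity
  set w : ℝ := C * ((2 ^ n) ^ (d - 1))⁻¹ with hw
  have hw0 : 0 < w := by positivity
  set g : Ed d → ℂ := 𝓕 (bandP j f) with hg
  have hgc : Continuous g := continuous_fourier_of_integrable (hf.bandP j).integrable
  have hg0 : ∀ ξ, g ξ ≠ 0 → 1 / 2 < 2 ^ j * ‖ξ‖ ∧ 2 ^ j * ‖ξ‖ < 2 := fun ξ h => by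
    refine annMul_dil_ne_zero fun h0 => h ?_
    rw [hg, fourier_bandP hf, h0]
    simp
  have hgs : HasCompactSupport g := by
    refine HasCompactSupport.intro (isCompact_closedBall (0 : Ed d) (2 / δ)) fun ξ hξ => ?_
    by_contra h
    refine hξ ?_
    rw [mem_closedBall_zero_iff, le_div_iff₀ hδ0, mul_comm]
    exact (hg0 ξ h).2.le
  have hgi := hgc.integrable_of_hasCompactSupport hgs (μ := volume)
  have hinv : 𝓕⁻ g = bandP j f :=
    Continuous.fourierInv_fourier_eq (continuous_bandP hf j) (hf.bandP j).integrable hgi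
  have hts : ∀ s, t' - δ ≤ s → (2 : ℝ) ^ (j + n - 1) ≤ s := by
    intro s hs
    have h1 : (2 : ℝ) ^ (j + n) = 2 * 2 ^ (j + n - 1) := by
      rw [zpow_sub₀ two_ne_zero, zpow_one]
      ring
    have h2 : δ ≤ (2 : ℝ) ^ (j + n - 1) := zpow_le_zpow_right₀ one_le_two (by omega)
    linarith
  have hUc := continuous_besselU i
  have hDc : ∀ s, Continuous (derivMul i s) := fun s => by
    have := continuous_besselU' i
    unfold derivMul
    fun_prop
  have hmeas := measurable_derivMean i hgc
  have hb1 : ∫⁻ x, ‖𝓕⁻ (fun ξ => (besselU d i (2 * π * (t' * ‖ξ‖)) : ℂ) * g ξ) x‖ₑ ^ 2 ≤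
      ENNReal.ofReal w * ∫⁻ ξ, ‖g ξ‖ₑ ^ 2 :=
    lintegral_fourierInv_mul_sq_le hgc hgs (by fun_prop) fun ξ h =>
      (hU n j t' ξ (hts t' (by linarith)) (hg0 ξ h).1).1
  have hb2 : ∀ s ∈ Icc (t' - δ) (t' + δ), ∫⁻ x, ‖derivMean i g s x‖ₑ ^ 2 ≤
      ENNReal.ofReal ((4 * π / δ) ^ 2 * w) * ∫⁻ ξ, ‖g ξ‖ₑ ^ 2 := fun s hs =>
    lintegral_fourierInv_mul_sq_le hgc hgs (hDc s) fun ξ h => by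
      obtain ⟨h1, h2⟩ := hg0 ξ h
      rw [derivMul, mul_pow]
      refine mul_le_mul ?_ (hU n j s ξ (hts s hs.1) h1).2 (sq_nonneg _) (sq_nonneg _)
      have : ‖ξ‖ ≤ 2 / δ := by
        rw [le_div_iff₀ hδ0, mul_comm]
        exact h2.le
      calc (2 * π * ‖ξ‖) ^ 2 ≤ (2 * π * (2 / δ)) ^ 2 := by gcongr
        _ = _ := by ring
  refine ⟨fun x => 2 * ‖𝓕⁻ (fun ξ => (besselU d i (2 * π * (t' * ‖ξ‖)) : ℂ) * g ξ) x‖ₑ ^ 2 +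
      4 * ENNReal.ofReal δ * ∫⁻ s in Icc (t' - δ) (t' + δ), ‖derivMean i g s x‖ₑ ^ 2, ?_, ?_, ?_⟩
  · apply Measurable.fun_add
    · have h1 : Integrable fun ξ => (besselU d i (2 * π * (t' * ‖ξ‖)) : ℂ) * g ξ := by
        have hc1 : Continuous fun ξ => (besselU d i (2 * π * (t' * ‖ξ‖)) : ℂ) * g ξ := by fun_prop
        exact hc1.integrable_of_hasCompactSupport hgs.mul_left
      have h2 := continuous_fourier_of_integrable h1
      have h3 : Continuous (𝓕⁻ fun ξ => (besselU d i (2 * π * (t' * ‖ξ‖)) : ℂ) * g ξ) := by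
        have : ∀ x, 𝓕⁻ (fun ξ => (besselU d i (2 * π * (t' * ‖ξ‖)) : ℂ) * g ξ) x =
            𝓕 (fun ξ => (besselU d i (2 * π * (t' * ‖ξ‖)) : ℂ) * g ξ) (-x) :=
          fun x => Real.fourierInv_eq_fourier_neg _ x
        rw [funext this]
        exact h2.comp continuous_neg
      exact (h3.measurable.enorm.pow_const 2).const_mul 2
    · exact (Measurable.lintegral_prod_left' (f := fun p : ℝ × Ed d =>
        ‖derivMean i g p.1 p.2‖ₑ ^ 2) (hmeas.enorm.pow_const 2)).const_mul _
  · intro t x h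
    rw [← hinv]
    exact enorm_sphMean_sq_le i hgc hgs h x
  · have hm2 : Measurable fun x => ∫⁻ s in Icc (t' - δ) (t' + δ), ‖derivMean i g s x‖ₑ ^ 2 :=
      Measurable.lintegral_prod_left' (f := fun p : ℝ × Ed d =>
        ‖derivMean i g p.1 p.2‖ₑ ^ 2) (hmeas.enorm.pow_const 2)
    rw [lintegral_add_right _ (hm2.const_mul _), lintegral_const_mul' _ _ (by finiteness),
      lintegral_const_mul _ hm2]
    have hswap : ∫⁻ x, ∫⁻ s in Icc (t' - δ) (t' + δ), ‖derivMean i g s x‖ₑ ^ 2 =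
        ∫⁻ s in Icc (t' - δ) (t' + δ), ∫⁻ x, ‖derivMean i g s x‖ₑ ^ 2 := by
      refine lintegral_lintegral_swap ?_
      exact ((hmeas.enorm.pow_const 2).comp measurable_swap).aemeasurable
    have hin : ∫⁻ s in Icc (t' - δ) (t' + δ), ∫⁻ x, ‖derivMean i g s x‖ₑ ^ 2 ≤
        ENNReal.ofReal ((4 * π / δ) ^ 2 * w) * (∫⁻ ξ, ‖g ξ‖ₑ ^ 2) * ENNReal.ofReal (2 * δ) := by
      refine (setLIntegral_mono' measurableSet_Icc hb2).trans (le_of_eq ?_)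
      rw [setLIntegral_const, Real.volume_Icc]
      congr 2
      ring
    have hgf : ∫⁻ ξ, ‖g ξ‖ₑ ^ 2 ≤
        4 * ∫⁻ ξ, ‖annMul d ((2 : ℝ) ^ j • ξ)‖ₑ ^ 2 * ‖𝓕 f ξ‖ₑ ^ 2 := by
      rw [← lintegral_const_mul' _ _ (by finiteness)]
      refine lintegral_mono fun ξ => ?_
      simp only
      rw [hg, fourier_bandP hf, enorm_mul, enorm_mul, mul_pow, mul_pow, mul_assoc]
      gcongr
      have : ‖sumMul d ((2 : ℝ) ^ j • ξ)‖ₑ ≤ 2 := by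
        rw [← ofReal_norm]
        exact ENNReal.ofReal_le_of_le_toReal (by simpa using norm_sumMul_le _)
      calc _ ≤ (2 : ℝ≥0∞) ^ 2 := by gcongr
        _ = 4 := by norm_num
    have hwe : ENNReal.ofReal w = ENNReal.ofReal C * ((2 ^ n) ^ (d - 1))⁻¹ := by
      rw [hw, ENNReal.ofReal_mul hC.le, ENNReal.ofReal_inv_of_pos (by positivity),
        ENNReal.ofReal_pow (by positivity), ENNReal.ofReal_pow (by positivity)]
      norm_num
    have hcomb : 4 * ENNReal.ofReal δ * (ENNReal.ofReal ((4 * π / δ) ^ 2 * w) *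
        (∫⁻ ξ, ‖g ξ‖ₑ ^ 2) * ENNReal.ofReal (2 * δ)) =
        8 * 16 * ENNReal.ofReal (π ^ 2) * ENNReal.ofReal w * ∫⁻ ξ, ‖g ξ‖ₑ ^ 2 := by
      have e : ENNReal.ofReal δ * ENNReal.ofReal ((4 * π / δ) ^ 2 * w) * ENNReal.ofReal (2 * δ) =
          2 * 16 * ENNReal.ofReal (π ^ 2) * ENNReal.ofReal w := by
        rw [← ENNReal.ofReal_mul hδ0.le, ← ENNReal.ofReal_mul (by positivity),
          show δ * ((4 * π / δ) ^ 2 * w) * (2 * δ) = 2 * 16 * π ^ 2 * w by field_simp; ring,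
          ENNReal.ofReal_mul (by positivity), ENNReal.ofReal_mul (by positivity)]
        norm_num
      calc _ = 4 * (ENNReal.ofReal δ * ENNReal.ofReal ((4 * π / δ) ^ 2 * w) *
          ENNReal.ofReal (2 * δ)) * ∫⁻ ξ, ‖g ξ‖ₑ ^ 2 := by ring
        _ = _ := by
          rw [e]
          ring
    rw [hswap]
    calc _ ≤ 2 * (ENNReal.ofReal w * ∫⁻ ξ, ‖g ξ‖ₑ ^ 2) + 4 * ENNReal.ofReal δ *
          (ENNReal.ofReal ((4 * π / δ) ^ 2 * w) * (∫⁻ ξ, ‖g ξ‖ₑ ^ 2) * ENNReal.ofReal (2 * δ)) := by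
          gcongr
      _ = (2 + 8 * 16 * ENNReal.ofReal (π ^ 2)) * ENNReal.ofReal w * ∫⁻ ξ, ‖g ξ‖ₑ ^ 2 := by
          rw [hcomb]
          ring
      _ ≤ (2 + 8 * 16 * ENNReal.ofReal (π ^ 2)) * ENNReal.ofReal w *
          (4 * ∫⁻ ξ, ‖annMul d ((2 : ℝ) ^ j • ξ)‖ₑ ^ 2 * ‖𝓕 f ξ‖ₑ ^ 2) := by gcongr
      _ = _ := by
          rw [hwe]
          ring

/-- The weak `L²` bound for the spherical means of one frequency band. -/
theorem exists_weak_two_sphMean_bandP (hd : 1 ≤ d) : ∃ C : ℝ≥0∞, C ≠ ∞ ∧ ∀ (n : ℕ), 1 ≤ n →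
    ∀ (F : Finset ℤ) (T : ℤ → Finset ℝ) (N : ℝ≥0∞), (∀ k ∈ F, ((T k).card : ℝ≥0∞) ≤ N) →
      (∀ k ∈ F, ∀ t ∈ T k, (2 : ℝ) ^ k ≤ t) → ∀ f : Ed d → ℂ, Nice f → ∀ l : ℝ≥0∞,
      l ^ 2 * volume {x | ∃ k ∈ F, ∃ t' ∈ T k, ∃ t, |t - t'| ≤ 2 ^ (k - n) ∧
        l < ‖sphMean d t (bandP (k - n) f) x‖ₑ} ≤
        C * N * ((2 ^ n) ^ (d - 1))⁻¹ * ∫⁻ x, ‖f x‖ₑ ^ 2 := by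
  obtain ⟨C, hC, h⟩ := exists_sphMean_bandP_sq_le hd
  refine ⟨C * 8, by finiteness, fun n hn F T N hN hT f hf l => ?_⟩
  have hV : ∀ (k : ℤ) (t' : ℝ), ∃ V : Ed d → ℝ≥0∞, Measurable V ∧ ((2 : ℝ) ^ k ≤ t' →
      (∀ t x, |t - t'| ≤ 2 ^ (k - n : ℤ) → ‖sphMean d t (bandP (k - n) f) x‖ₑ ^ 2 ≤ V x) ∧
      ∫⁻ x, V x ≤ C * ((2 ^ n) ^ (d - 1))⁻¹ *
        ∫⁻ ξ, ‖annMul d ((2 : ℝ) ^ (k - n : ℤ) • ξ)‖ₑ ^ 2 * ‖𝓕 f ξ‖ₑ ^ 2) := by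
    intro k t'
    by_cases hk : (2 : ℝ) ^ k ≤ t'
    · obtain ⟨V, hV, h1, h2⟩ := h n (k - n) t' hn (by rwa [sub_add_cancel]) f hf
      exact ⟨V, hV, fun _ => ⟨h1, h2⟩⟩
    · exact ⟨0, measurable_zero, fun h => absurd h hk⟩
  choose V hVm hVp using hV
  have hfc : Continuous (𝓕 f) := continuous_fourier_of_integrable hf.integrable
  have hac : Continuous (annMul d) := contDiff_annMul.continuous
  have hsum : ∀ ξ : Ed d, ∑ k ∈ F, ‖annMul d ((2 : ℝ) ^ (k - n : ℤ) • ξ)‖ₑ ^ 2 ≤ 8 := by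
    intro ξ
    have e := sum_annMul_sq_le (F.map (Equiv.subRight (n : ℤ)).toEmbedding) ξ
    rwa [Finset.sum_map] at e
  set G : Ed d → ℝ≥0∞ := fun x => ∑ k ∈ F, ∑ t' ∈ T k, V k t' x
  have hGm : Measurable G :=
    Finset.measurable_fun_sum _ fun k _ => Finset.measurable_fun_sum _ fun t' _ => hVm k t'
  have hsub : {x | ∃ k ∈ F, ∃ t' ∈ T k, ∃ t, |t - t'| ≤ 2 ^ (k - n : ℤ) ∧
        l < ‖sphMean d t (bandP (k - n) f) x‖ₑ} ⊆ {x | l ^ 2 ≤ G x} := by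
    rintro x ⟨k, hk, t', ht', t, ht, hl⟩
    calc l ^ 2 ≤ ‖sphMean d t (bandP (k - n) f) x‖ₑ ^ 2 := by gcongr
      _ ≤ V k t' x := (hVp k t' (hT k hk t' ht')).1 t x ht
      _ ≤ ∑ t' ∈ T k, V k t' x :=
        Finset.single_le_sum (f := fun t' => V k t' x) (fun _ _ => zero_le) ht'
      _ ≤ G x := Finset.single_le_sum (f := fun k => ∑ t' ∈ T k, V k t' x) (fun _ _ => zero_le) hk
  calc _ ≤ l ^ 2 * volume {x | l ^ 2 ≤ G x} := by gcongr
    _ ≤ ∫⁻ x, G x := mul_meas_ge_le_lintegral₀ hGm.aemeasurable _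
    _ = ∑ k ∈ F, ∑ t' ∈ T k, ∫⁻ x, V k t' x := by
        rw [lintegral_finsetSum _ fun k _ => Finset.measurable_fun_sum _ fun t' _ => hVm k t']
        exact Finset.sum_congr rfl fun k _ => lintegral_finsetSum _ fun t' _ => hVm k t'
    _ ≤ ∑ k ∈ F, ∑ _t' ∈ T k, C * ((2 ^ n) ^ (d - 1))⁻¹ *
        ∫⁻ ξ, ‖annMul d ((2 : ℝ) ^ (k - n : ℤ) • ξ)‖ₑ ^ 2 * ‖𝓕 f ξ‖ₑ ^ 2 := by
        gcongr with k hk t' ht'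
        exact (hVp k t' (hT k hk t' ht')).2
    _ ≤ ∑ k ∈ F, N * (C * ((2 ^ n) ^ (d - 1))⁻¹ *
        ∫⁻ ξ, ‖annMul d ((2 : ℝ) ^ (k - n : ℤ) • ξ)‖ₑ ^ 2 * ‖𝓕 f ξ‖ₑ ^ 2) := by
        refine Finset.sum_le_sum fun k hk => ?_
        rw [Finset.sum_const, nsmul_eq_mul]
        gcongr
        exact hN k hk
    _ = N * (C * ((2 ^ n) ^ (d - 1))⁻¹ * ∫⁻ ξ,
        (∑ k ∈ F, ‖annMul d ((2 : ℝ) ^ (k - n : ℤ) • ξ)‖ₑ ^ 2) * ‖𝓕 f ξ‖ₑ ^ 2) := by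
        rw [← Finset.mul_sum, ← Finset.mul_sum, ← lintegral_finsetSum]
        · simp_rw [Finset.sum_mul]
        · intro k _
          fun_prop
    _ ≤ N * (C * ((2 ^ n) ^ (d - 1))⁻¹ * ∫⁻ ξ, 8 * ‖𝓕 f ξ‖ₑ ^ 2) := by
        gcongr with ξ
        exact hsum ξ
    _ = _ := by
        rw [lintegral_const_mul _ (by fun_prop), lintegral_fourier_sq hf.integrable hf.memLp_two]
        ring

end

section

variable {d : ℕ}

/-- The spherical mean of a nonnegative function. -/
def posMean (t : ℝ) (h : Ed d → ℝ≥0∞) (x : Ed d) : ℝ≥0∞ :=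
  ∫⁻ y : sphere (0 : Ed d) 1, h (x - t • (y : Ed d)) ∂(sphereProb d)

theorem measurable_sub_smul_sphere (t : ℝ) :
    Measurable fun q : Ed d × sphere (0 : Ed d) 1 => q.1 - t • (q.2 : Ed d) := by
  fun_prop

theorem measurable_posMean (hd : 1 ≤ d) (t : ℝ) {h : Ed d → ℝ≥0∞} (hh : Measurable h) :
    Measurable (posMean t h) := by
  have := isProbabilityMeasure_sphereProb hd
  exact (hh.comp (measurable_sub_smul_sphere t)).lintegral_prod_right'

theorem lintegral_posMean (hd : 1 ≤ d) (t : ℝ) {h : Ed d → ℝ≥0∞} (hh : Measurable h) :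
    ∫⁻ x, posMean t h x = ∫⁻ x, h x := by
  have := isProbabilityMeasure_sphereProb hd
  unfold posMean
  rw [lintegral_lintegral_swap
    (f := fun (x : Ed d) (y : sphere (0 : Ed d) 1) => h (x - t • (y : Ed d)))
    (hh.comp (measurable_sub_smul_sphere t)).aemeasurable]
  simp_rw [lintegral_sub_right_eq_self]
  simp

theorem posMean_mono {t : ℝ} {g h : Ed d → ℝ≥0∞} (hgh : ∀ x, g x ≤ h x) (x : Ed d) :
    posMean t g x ≤ posMean t h x :=
  lintegral_mono fun _ => hgh _

theorem posMean_mul_add_mul (t : ℝ) {g h : Ed d → ℝ≥0∞} (hg : Measurable g) (hh : Measurable h)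
    (a b : ℝ≥0∞) (x : Ed d) :
    posMean t (fun x => a * g x + b * h x) x = a * posMean t g x + b * posMean t h x := by
  have h1 : Measurable fun y : sphere (0 : Ed d) 1 => g (x - t • (y : Ed d)) := by fun_prop
  have h2 : Measurable fun y : sphere (0 : Ed d) 1 => h (x - t • (y : Ed d)) := by fun_prop
  rw [posMean, lintegral_add_left (h1.const_mul a), lintegral_const_mul _ h1,
    lintegral_const_mul _ h2]
  rfl

theorem enorm_sphMean_le_posMean (t : ℝ) (f : Ed d → ℂ) (x : Ed d) :
    ‖sphMean d t f x‖ₑ ≤ posMean t (fun x => ‖f x‖ₑ) x :=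
  enorm_integral_le_lintegral_enorm _

theorem enorm_sphMean_bandP_le {j : ℤ} {t t' : ℝ} (h : |t - t'| ≤ 2 ^ j) (f : Ed d → ℂ)
    (x : Ed d) : ‖sphMean d t (bandP j f) x‖ₑ ≤ posMean t' (bandMaj j f) x := by
  refine (enorm_sphMean_le_posMean t _ x).trans (lintegral_mono fun y => ?_)
  have e : x - t • (y : Ed d) = (x - t' • (y : Ed d)) + (t' - t) • (y : Ed d) := by
    rw [sub_smul]
    abel
  rw [e]
  refine enorm_bandP_add_le f _ _ ?_
  rw [norm_smul, norm_eq_of_mem_sphere, mul_one, Real.norm_eq_abs, abs_sub_comm]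
  linarith [zpow_pos (two_pos (α := ℝ)) j]

theorem enorm_sphMean_lowP_le (hd : 1 ≤ d) {k : ℤ} {t : ℝ} (h : |t| ≤ 2 * 2 ^ k) (f : Ed d → ℂ)
    (x : Ed d) : ‖sphMean d t (lowP k f) x‖ₑ ≤ lowMaj k f x := by
  have := isProbabilityMeasure_sphereProb hd
  refine (enorm_sphMean_le_posMean t _ x).trans ?_
  calc _ ≤ ∫⁻ _y : sphere (0 : Ed d) 1, lowMaj k f x ∂(sphereProb d) := by
        refine lintegral_mono fun y => ?_
        simp only [sub_eq_add_neg]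
        refine enorm_lowP_add_le f _ _ ?_
        rwa [norm_neg, norm_smul, norm_eq_of_mem_sphere, mul_one, Real.norm_eq_abs]
    _ = _ := by simp

/-- The weak type bound, with constant `B`, for the maximal function of nonnegative functions over
the radii in `I`. -/
def PosWeak (d : ℕ) (I : Set ℝ) (q : ℝ) (B : ℝ≥0∞) : Prop :=
  ∀ h : Ed d → ℝ≥0∞, Measurable h → ∀ s : ℝ≥0∞, s ≠ 0 → s ≠ ∞ →
    s ^ q * volume {x | ∃ t ∈ I, s < posMean t h x} ≤ B * ∫⁻ x, h x ^ q

theorem le_mul_sq_rpow_add {g S c : ℝ≥0∞} {b : ℝ} (hb : 0 < b) (hS : g ^ 2 ≤ S) (hc0 : c ≠ 0)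
    (hc : c ≠ ∞) : g ≤ c * (g ^ 2 * S ^ (-b)) + c⁻¹ * S ^ b := by
  rcases eq_or_ne S 0 with h0 | h0
  · rw [h0] at hS
    have : g = 0 := by simpa using hS
    simp [this]
  rcases eq_or_ne S ∞ with h1 | h1
  · simp [h1, ENNReal.top_rpow_of_pos hb, ENNReal.mul_top (ENNReal.inv_ne_zero.2 hc)]
  rcases le_or_gt g (c⁻¹ * S ^ b) with h | h
  · exact h.trans le_add_self
  · refine le_add_right ?_
    have h2 : S ^ b ≤ c * g := by
      calc S ^ b = c * (c⁻¹ * S ^ b) := by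
            rw [← mul_assoc, ENNReal.mul_inv_cancel hc0 hc, one_mul]
        _ ≤ c * g := by gcongr
    calc g = g * (S ^ b * S ^ (-b)) := by
          rw [← ENNReal.rpow_add _ _ h0 h1, add_neg_cancel, ENNReal.rpow_zero, mul_one]
      _ ≤ g * (c * g * S ^ (-b)) := by gcongr
      _ = _ := by ring

theorem mul_rpow_neg_le {S : ℝ≥0∞} {b : ℝ} (hb1 : b < 1) :
    S * S ^ (-b) ≤ S ^ (1 - b) := by
  rcases eq_or_ne S 0 with h0 | h0
  · simp [h0]
  rcases eq_or_ne S ∞ with h1 | h1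
  · rw [h1, ENNReal.top_rpow_of_pos (y := 1 - b) (by linarith)]
    exact le_top
  · rw [sub_eq_add_neg, ENNReal.rpow_add _ _ h0 h1, ENNReal.rpow_one]

theorem exists_balanced_two_rpow {q : ℝ} (hq : 1 < q) {B N s : ℝ≥0∞} (hB0 : B ≠ 0) (hB : B ≠ ∞)
    (hN0 : N ≠ 0) (hN : N ≠ ∞) (hs0 : s ≠ 0) (hs : s ≠ ∞) : ∃ c : ℝ≥0∞, c ≠ 0 ∧ c ≠ ∞ ∧
      s ^ (2 * q / (1 + q)) * (s⁻¹ * (c * N)) = N ^ (q / (1 + q)) * B ^ (1 / (1 + q)) ∧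
      s ^ (2 * q / (1 + q)) * (((s * c) ^ q)⁻¹ * B) = N ^ (q / (1 + q)) * B ^ (1 / (1 + q)) := by
  obtain ⟨v, rfl⟩ := exists_eq_two_rpow hs0 hs
  obtain ⟨b, rfl⟩ := exists_eq_two_rpow hB0 hB
  obtain ⟨n, rfl⟩ := exists_eq_two_rpow hN0 hN
  refine ⟨2 ^ ((b + v * (1 - q) - n) / (1 + q)), two_rpow_ne_zero _, two_rpow_ne_top _, ?_, ?_⟩
  all_goals
    simp only [← two_rpow_add, ← ENNReal.rpow_mul, ← ENNReal.rpow_neg]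
    congr 1
    field_simp
    ring

/-- The weak type bound for the spherical means of one frequency band, in terms of the weak type
bound for nonnegative functions. -/
theorem exists_weak_sphMean_bandP (hd : 1 ≤ d) {q : ℝ} (hq1 : 1 < q) (hq2 : q < 2) :
    ∃ C : ℝ≥0∞, C ≠ ∞ ∧ ∀ (I : Set ℝ) (B : ℝ≥0∞), PosWeak d I q B → B ≠ 0 → B ≠ ∞ →
      ∀ (n : ℕ) (F : Finset ℤ) (T : ℤ → Finset ℝ) (N : ℝ≥0∞), N ≠ 0 → N ≠ ∞ →
      (∀ k ∈ F, ((T k).card : ℝ≥0∞) ≤ N) → (∀ k ∈ F, ∀ t ∈ T k, t ∈ I) →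
      ∀ f : Ed d → ℂ, Nice f → ∀ l : ℝ≥0∞, l ≠ 0 → l ≠ ∞ →
      l ^ (2 * q / (1 + q)) * volume {x | ∃ k ∈ F, ∃ t' ∈ T k, ∃ t, |t - t'| ≤ 2 ^ (k - n : ℤ) ∧
        l < ‖sphMean d t (bandP (k - n) f) x‖ₑ} ≤
        C * (N ^ (q / (1 + q)) * B ^ (1 / (1 + q))) * ∫⁻ x, ‖f x‖ₑ ^ (2 * q / (1 + q)) := by
  set p := 2 * q / (1 + q) with hp
  have hp1 : 1 < p := by
    rw [hp, lt_div_iff₀ (by linarith)]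
    linarith
  have hp2 : p < 2 := by
    rw [hp, div_lt_iff₀ (by linarith)]
    linarith
  obtain ⟨C, hC, hΓ⟩ := exists_lintegral_sqFn_rpow_le hd hp1 hp2
  refine ⟨(2 + 2 ^ q) * C, by finiteness, fun I B hB hB0 hBt n F T N hN0 hN hT hTI f hf l hl0 hl => ?_⟩
  set F' := F.map (Equiv.subRight (n : ℤ)).toEmbedding
  set S := sqFn F' f with hS
  have hSm : Measurable S := measurable_sqFn F' hf
  set b := 1 - p / 2 with hb
  have hb0 : 0 < b := by linarith
  have hb1 : b < 1 := by linarith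
  obtain ⟨c, hc0, hc, hc1, hc2⟩ := exists_balanced_two_rpow hq1 hB0 hBt hN0 hN hl0 hl
  set u : ℤ → Ed d → ℝ≥0∞ := fun k x => bandMaj (k - n) f x ^ 2 * S x ^ (-b) with hu
  have hum : ∀ k, Measurable (u k) := fun k =>
    ((measurable_bandMaj hf _).pow_const 2).mul (hSm.pow_const _)
  have hSe : ∀ x, S x = ∑ k ∈ F, bandMaj (k - n) f x ^ 2 := fun x => by
    rw [hS, sqFn, Finset.sum_map]
    rfl
  have hpt : ∀ k ∈ F, ∀ x, bandMaj (k - n) f x ≤ c * u k x + c⁻¹ * S x ^ b := fun k hk x => by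
    refine le_mul_sq_rpow_add hb0 ?_ hc0 hc
    rw [hSe]
    exact Finset.single_le_sum (f := fun k : ℤ => bandMaj (k - n) f x ^ 2) (fun _ _ => zero_le) hk
  set G : Ed d → ℝ≥0∞ := fun x => ∑ k ∈ F, ∑ t' ∈ T k, posMean t' (u k) x with hG
  have hGm : Measurable G := Finset.measurable_fun_sum _ fun k _ =>
    Finset.measurable_fun_sum _ fun t' _ => measurable_posMean hd t' (hum k)
  have hsub : {x | ∃ k ∈ F, ∃ t' ∈ T k, ∃ t, |t - t'| ≤ 2 ^ (k - n : ℤ) ∧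
      l < ‖sphMean d t (bandP (k - n) f) x‖ₑ} ⊆ {x | l * (2 * c)⁻¹ ≤ G x} ∪
        {x | ∃ t ∈ I, l * c / 2 < posMean t (fun x => S x ^ b) x} := by
    rintro x ⟨k, hk, t', ht', t, ht, hl⟩
    have h1 : l < c * posMean t' (u k) x + c⁻¹ * posMean t' (fun x => S x ^ b) x := by
      rw [← posMean_mul_add_mul _ (hum k) (hSm.pow_const b)]
      exact hl.trans_le ((enorm_sphMean_bandP_le ht f x).trans (posMean_mono (hpt k hk) x))
    rcases lt_add_or_of_lt_mul_add (c := 1) (by rwa [one_mul]) with h | h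
    · left
      have h2 : posMean t' (u k) x ≤ G x :=
        (Finset.single_le_sum (f := fun t' => posMean t' (u k) x) (fun _ _ => zero_le) ht').trans
          (Finset.single_le_sum (f := fun k => ∑ t' ∈ T k, posMean t' (u k) x)
            (fun _ _ => zero_le) hk)
      refine le_trans ?_ h2
      rw [← div_eq_mul_inv]
      refine ENNReal.div_le_of_le_mul ?_
      calc l ≤ _ := h.le
        _ = _ := by ring
    · right
      refine ⟨t', hTI k hk t' ht', ?_⟩
      refine ENNReal.div_lt_of_lt_mul ?_
      rw [← ENNReal.lt_div_iff_mul_lt (Or.inl hc0) (Or.inl hc), div_eq_mul_inv]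
      calc l < _ := h
        _ = _ := by ring
  have hG1 : ∫⁻ x, G x ≤ N * ∫⁻ x, S x ^ (p / 2) := by
    calc ∫⁻ x, G x = ∑ k ∈ F, ∑ t' ∈ T k, ∫⁻ x, u k x := by
          rw [hG, lintegral_finsetSum _ fun k _ => Finset.measurable_fun_sum _ fun t' _ =>
            measurable_posMean hd t' (hum k)]
          refine Finset.sum_congr rfl fun k _ => ?_
          rw [lintegral_finsetSum _ fun t' _ => measurable_posMean hd t' (hum k)]
          exact Finset.sum_congr rfl fun t' _ => lintegral_posMean hd t' (hum k)
      _ ≤ ∑ k ∈ F, N * ∫⁻ x, u k x := by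
          refine Finset.sum_le_sum fun k hk => ?_
          rw [Finset.sum_const, nsmul_eq_mul]
          gcongr
          exact hT k hk
      _ = N * ∫⁻ x, S x * S x ^ (-b) := by
          rw [← Finset.mul_sum, ← lintegral_finsetSum _ fun k _ => hum k]
          congr 2 with x
          rw [hSe x, Finset.sum_mul, hu]
          simp only [hSe x]
      _ ≤ N * ∫⁻ x, S x ^ (p / 2) := by
          gcongr with x
          refine (mul_rpow_neg_le hb1).trans (le_of_eq ?_)
          rw [hb]
          ring_nf
  have h1 : volume {x | l * (2 * c)⁻¹ ≤ G x} ≤ 2 * (l⁻¹ * (c * N)) * ∫⁻ x, S x ^ (p / 2) := by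
    have h2c0 : 2 * c ≠ 0 := mul_ne_zero two_ne_zero hc0
    have h2c : 2 * c ≠ ∞ := by finiteness
    have h3 := mul_meas_ge_le_lintegral₀ hGm.aemeasurable (l * (2 * c)⁻¹) (μ := volume)
    calc _ = l⁻¹ * (2 * c) * (l * (2 * c)⁻¹ * volume {x | l * (2 * c)⁻¹ ≤ G x}) := by
          rw [show l⁻¹ * (2 * c) * (l * (2 * c)⁻¹ * volume {x | l * (2 * c)⁻¹ ≤ G x}) =
            (l * l⁻¹) * ((2 * c) * (2 * c)⁻¹) * volume {x | l * (2 * c)⁻¹ ≤ G x} by ring,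
            ENNReal.mul_inv_cancel hl0 hl, ENNReal.mul_inv_cancel h2c0 h2c, one_mul, one_mul]
      _ ≤ l⁻¹ * (2 * c) * (N * ∫⁻ x, S x ^ (p / 2)) := by
          exact mul_le_mul_right (h3.trans hG1) _
      _ = _ := by ring
  have h2 : volume {x | ∃ t ∈ I, l * c / 2 < posMean t (fun x => S x ^ b) x} ≤
      2 ^ q * (((l * c) ^ q)⁻¹ * B) * ∫⁻ x, S x ^ (p / 2) := by
    have hlc0 : l * c / 2 ≠ 0 := ENNReal.div_ne_zero.2 ⟨mul_ne_zero hl0 hc0, by norm_num⟩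
    have hlc : l * c / 2 ≠ ∞ := ENNReal.div_ne_top (by finiteness) two_ne_zero
    have h3 := hB _ (hSm.pow_const b) _ hlc0 hlc
    have e : ∀ x, (S x ^ b) ^ q = S x ^ (p / 2) := fun x => by
      rw [← ENNReal.rpow_mul]
      congr 1
      rw [hb, hp]
      field_simp
      ring
    simp_rw [e] at h3
    have h4 : (l * c / 2) ^ q = (l * c) ^ q * (2 ^ q)⁻¹ := by
      rw [div_eq_mul_inv, ENNReal.mul_rpow_of_nonneg _ _ (by linarith), ENNReal.inv_rpow]
    have h50 : (l * c) ^ q ≠ 0 := by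
      rw [Ne, ENNReal.rpow_eq_zero_iff_of_pos (by linarith)]
      exact mul_ne_zero hl0 hc0
    have h5 : (l * c) ^ q ≠ ∞ := ENNReal.rpow_ne_top_of_nonneg (by linarith) (by finiteness)
    set v := volume {x | ∃ t ∈ I, l * c / 2 < posMean t (fun x => S x ^ b) x}
    calc v = ((l * c) ^ q * ((l * c) ^ q)⁻¹) * (2 ^ q * (2 ^ q)⁻¹) * v := by
          rw [ENNReal.mul_inv_cancel h50 h5, ENNReal.mul_inv_cancel (two_rpow_ne_zero q)
            (two_rpow_ne_top q), one_mul, one_mul]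
      _ = 2 ^ q * ((l * c) ^ q)⁻¹ * ((l * c / 2) ^ q * v) := by
          rw [h4]
          ring
      _ ≤ 2 ^ q * ((l * c) ^ q)⁻¹ * (B * ∫⁻ x, S x ^ (p / 2)) := by gcongr
      _ = _ := by ring
  calc _ ≤ l ^ p * (2 * (l⁻¹ * (c * N)) * (∫⁻ x, S x ^ (p / 2)) +
        2 ^ q * (((l * c) ^ q)⁻¹ * B) * ∫⁻ x, S x ^ (p / 2)) := by
        gcongr
        exact (measure_mono hsub).trans ((measure_union_le _ _).trans (add_le_add h1 h2))
    _ = (2 * (l ^ p * (l⁻¹ * (c * N))) + 2 ^ q * (l ^ p * (((l * c) ^ q)⁻¹ * B))) *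
        ∫⁻ x, S x ^ (p / 2) := by ring
    _ = (2 + 2 ^ q) * (N ^ (q / (1 + q)) * B ^ (1 / (1 + q))) * ∫⁻ x, S x ^ (p / 2) := by
        rw [hc1, hc2]
        ring
    _ ≤ (2 + 2 ^ q) * (N ^ (q / (1 + q)) * B ^ (1 / (1 + q))) * (C * ∫⁻ x, ‖f x‖ₑ ^ p) := by
        gcongr
        exact hΓ F' f hf
    _ = _ := by ring

end

section

theorem tsum_two_rpow_neg_abs_ne_top {e : ℝ} (he : 0 < e) :
    ∑' m : ℤ, (2 : ℝ≥0∞) ^ (-(e * |(m : ℝ)|)) ≠ ∞ := by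
  have hr : (2 : ℝ) ^ (-e) < 1 := Real.rpow_lt_one_of_one_lt_of_neg one_lt_two (by linarith)
  have hs : Summable fun n : ℕ => ((2 : ℝ) ^ (-e)) ^ n :=
    summable_geometric_of_lt_one (by positivity) hr
  have h1 : ∀ n : ℕ, ((2 : ℝ) ^ (-e)) ^ n = 2 ^ (-(e * |((n : ℤ) : ℝ)|)) := fun n => by
    rw [← Real.rpow_natCast, ← Real.rpow_mul zero_le_two]
    simp
  have h2 : ∀ n : ℕ, ((2 : ℝ) ^ (-e)) ^ n = 2 ^ (-(e * |((-n : ℤ) : ℝ)|)) := fun n => by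
    rw [h1]
    simp
  have hZ : Summable fun m : ℤ => (2 : ℝ) ^ (-(e * |(m : ℝ)|)) :=
    Summable.of_nat_of_neg (by simpa only [h1] using hs) (by simpa only [h2] using hs)
  simp_rw [two_rpow_eq_ofReal]
  exact hZ.tsum_ofReal_ne_top

/-- The class of the index `ν` at the scale `2 ^ (-n)`. -/
def scaleClass (α : ℝ) (n ν : ℕ) : ℕ :=
  min ⌊(α + 1) * Real.logb 2 ν⌋₊ ⌈n * ((α + 1) / α)⌉₊

theorem exists_tsum_scaleClass_le {α e : ℝ} (hα : 0 < α) (he : 0 < e) : ∃ K : ℝ≥0∞, K ≠ ∞ ∧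
    ∀ ν : ℕ, ∑' n : ℕ, (2 : ℝ≥0∞) ^ (-(e * |(n : ℝ) - scaleClass α n ν|)) ≤ K := by
  refine ⟨(∑' m : ℤ, (2 : ℝ≥0∞) ^ (-(e * |(m : ℝ)|))) +
    ∑' m : ℤ, (2 : ℝ≥0∞) ^ (-(e / α * |(m : ℝ)|)), ENNReal.add_ne_top.2
      ⟨tsum_two_rpow_neg_abs_ne_top he, tsum_two_rpow_neg_abs_ne_top (by positivity)⟩, fun ν => ?_⟩
  set c := ⌊(α + 1) * Real.logb 2 ν⌋₊ with hc
  have hterm : ∀ n : ℕ, (2 : ℝ≥0∞) ^ (-(e * |(n : ℝ) - scaleClass α n ν|)) ≤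
      2 ^ (-(e * |((n - c : ℤ) : ℝ)|)) + 2 ^ (-(e / α * |((n : ℤ) : ℝ)|)) := by
    intro n
    rcases le_total c ⌈n * ((α + 1) / α)⌉₊ with h | h
    · rw [scaleClass, ← hc, min_eq_left h]
      push_cast
      exact le_self_add
    · rw [scaleClass, ← hc, min_eq_right h]
      refine le_add_left (two_rpow_le_two_rpow.2 (neg_le_neg ?_))
      have h1 := Nat.le_ceil ((n : ℝ) * ((α + 1) / α))
      have h2 : (n : ℝ) * ((α + 1) / α) = n + n / α := by field_simp
      have h3 : (n : ℝ) / α ≤ |(n : ℝ) - ⌈n * ((α + 1) / α)⌉₊| := by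
        rw [abs_sub_comm]
        exact le_trans (by linarith) (le_abs_self _)
      calc e / α * |((n : ℤ) : ℝ)| = e * (n / α) := by
            rw [Int.cast_natCast, abs_of_nonneg (Nat.cast_nonneg n)]
            ring
        _ ≤ _ := by gcongr
  refine (ENNReal.tsum_le_tsum hterm).trans ?_
  rw [ENNReal.tsum_add]
  refine add_le_add ?_ ?_
  · exact ENNReal.tsum_comp_le_tsum_of_injective (f := fun n : ℕ => (n - c : ℤ))
      (fun a b h => by simpa using h) fun m : ℤ => (2 : ℝ≥0∞) ^ (-(e * |(m : ℝ)|))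
  · exact ENNReal.tsum_comp_le_tsum_of_injective (f := fun n : ℕ => (n : ℤ))
      Nat.cast_injective fun m : ℤ => (2 : ℝ≥0∞) ^ (-(e / α * |(m : ℝ)|))

theorem exists_tsum_abs_sub_le {e : ℝ} (he : 0 < e) : ∃ K : ℝ≥0∞, K ≠ ∞ ∧
    ∀ n : ℕ, ∑' i : ℕ, (2 : ℝ≥0∞) ^ (-(e * |(n : ℝ) - i|)) ≤ K := by
  refine ⟨_, tsum_two_rpow_neg_abs_ne_top he, fun n => ?_⟩
  refine le_trans (ENNReal.tsum_le_tsum fun i => le_of_eq ?_)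
    (ENNReal.tsum_comp_le_tsum_of_injective (f := fun i : ℕ => (n - i : ℤ))
      (fun a b h => by simpa using h) fun m : ℤ => (2 : ℝ≥0∞) ^ (-(e * |(m : ℝ)|)))
  push_cast
  rfl

theorem scaleClass_bounds {α : ℝ} (hα : 0 < α) {n ν : ℕ} (hν : 1 ≤ ν) :
    (scaleClass α n ν : ℝ) / (α + 1) ≤ Real.logb 2 ν ∧
    (scaleClass α n ν < n * ((α + 1) / α) →
      Real.logb 2 ν < (scaleClass α n ν + 1) / (α + 1)) ∧
    (scaleClass α n ν : ℝ) < n * ((α + 1) / α) + 1 := by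
  have hlog : 0 ≤ (α + 1) * Real.logb 2 ν :=
    mul_nonneg (by linarith) (Real.logb_nonneg one_lt_two (by exact_mod_cast hν))
  have hJ : 0 ≤ (n : ℝ) * ((α + 1) / α) := by positivity
  refine ⟨?_, fun h => ?_, ?_⟩
  · rw [div_le_iff₀ (by linarith), mul_comm (Real.logb _ _)]
    exact le_trans (by exact_mod_cast min_le_left _ _) (Nat.floor_le hlog)
  · rw [lt_div_iff₀ (by linarith), mul_comm]
    have h1 : scaleClass α n ν = ⌊(α + 1) * Real.logb 2 ν⌋₊ := by
      rcases min_choice ⌊(α + 1) * Real.logb 2 ν⌋₊ ⌈n * ((α + 1) / α)⌉₊ with h2 | h2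
      · exact h2
      · rw [scaleClass, h2] at h
        exact absurd (Nat.le_ceil _) h.not_ge
    rw [h1]
    exact Nat.lt_floor_add_one _
  · exact lt_of_le_of_lt (by exact_mod_cast min_le_right _ _) (Nat.ceil_lt_add_one hJ)

theorem card_image_floor_le {α e : ℝ} (hα : 0 < α) (he1 : e ≤ 1 / (α + 1))
    (he2 : e ≤ α / (α + 1)) {n : ℕ} (hn : 1 ≤ n) {i : ℕ} {V : Finset ℕ} (hV : ∀ ν ∈ V, 1 ≤ ν)
    (hi : ∀ ν ∈ V, scaleClass α n ν = i) :
    ((V.image fun ν : ℕ => ⌊(2 : ℝ) ^ n * (ν : ℝ) ^ (-α)⌋₊).card : ℝ) ≤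
      4 * 2 ^ (n / (α + 1) - e * |(n : ℝ) - i|) := by
  rcases V.eq_empty_or_nonempty with rfl | ⟨ν₀, hν₀⟩
  · simp
    positivity
  have hα1 : 0 < α + 1 := by linarith
  have hn1 : (1 : ℝ) ≤ n := by exact_mod_cast hn
  rcases le_or_gt i n with h | h
  · have hin : (i : ℝ) ≤ n := by exact_mod_cast h
    have hlt : (i : ℝ) < n * ((α + 1) / α) := by
      refine hin.trans_lt ?_
      rw [← mul_div_assoc, lt_div_iff₀ hα]
      nlinarith
    have hsub : V ⊆ Finset.Icc 1 ⌊(2 : ℝ) ^ (((i : ℝ) + 1) / (α + 1))⌋₊ := fun ν hν => by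
      have h1 : (0 : ℝ) < ν := by exact_mod_cast hV ν hν
      have h2 := (scaleClass_bounds hα (n := n) (hV ν hν)).2.1
      rw [hi ν hν] at h2
      refine Finset.mem_Icc.2 ⟨hV ν hν, Nat.le_floor ?_⟩
      exact ((Real.logb_le_iff_le_rpow one_lt_two h1).1 (h2 hlt).le)
    calc _ ≤ (V.card : ℝ) := by exact_mod_cast Finset.card_image_le
      _ ≤ (⌊(2 : ℝ) ^ (((i : ℝ) + 1) / (α + 1))⌋₊ : ℝ) := by
          have := Finset.card_le_card hsub
          rw [Nat.card_Icc, Nat.add_sub_cancel] at this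
          exact_mod_cast this
      _ ≤ 2 ^ (((i : ℝ) + 1) / (α + 1)) := Nat.floor_le (by positivity)
      _ ≤ 2 ^ (2 + (n / (α + 1) - e * |(n : ℝ) - i|)) := by
          refine Real.rpow_le_rpow_of_exponent_le one_le_two ?_
          rw [abs_of_nonneg (by linarith)]
          have h3 : e * (n - i) ≤ 1 / (α + 1) * (n - i) := by
            gcongr
          have h4 : ((i : ℝ) + 1) / (α + 1) =
              n / (α + 1) - 1 / (α + 1) * (n - i) + 1 / (α + 1) := by ring
          have h5 : 1 / (α + 1) ≤ 1 := by
            rw [div_le_one hα1]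
            linarith
          linarith
      _ = _ := by
          rw [Real.rpow_add two_pos]
          norm_num
  · have hin : (n : ℝ) ≤ i := by exact_mod_cast h.le
    set y : ℝ := 2 ^ ((n : ℝ) - α / (α + 1) * i) with hy
    have hsub : (V.image fun ν : ℕ => ⌊(2 : ℝ) ^ n * (ν : ℝ) ^ (-α)⌋₊) ⊆
        Finset.range (⌊y⌋₊ + 1) := fun m hm => by
      obtain ⟨ν, hν, rfl⟩ := Finset.mem_image.1 hm
      have h1 : (0 : ℝ) < ν := by exact_mod_cast hV ν hν
      have h2 := (scaleClass_bounds hα (n := n) (hV ν hν)).1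
      rw [hi ν hν, Real.le_logb_iff_rpow_le one_lt_two h1] at h2
      refine Finset.mem_range.2 (Nat.lt_succ_of_le (Nat.floor_le_floor ?_))
      calc (2 : ℝ) ^ n * (ν : ℝ) ^ (-α) ≤ 2 ^ n * ((2 : ℝ) ^ ((i : ℝ) / (α + 1))) ^ (-α) := by
            gcongr 2 ^ n * ?_
            exact Real.rpow_le_rpow_of_nonpos (by positivity) h2 (by linarith)
        _ = y := by
            rw [hy, ← Real.rpow_natCast, ← Real.rpow_mul zero_le_two, ← Real.rpow_add two_pos]
            congr 1
            ring
    have hi0 := (scaleClass_bounds hα (n := n) (hV ν₀ hν₀)).2.2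
    rw [hi ν₀ hν₀] at hi0
    have hy1 : 1 ≤ 2 * y := by
      have e1 : 2 * y = 2 ^ (1 + ((n : ℝ) - α / (α + 1) * i)) := by
        rw [Real.rpow_add two_pos, Real.rpow_one]
      rw [e1]
      refine Real.one_le_rpow one_le_two ?_
      have h3 : α / (α + 1) * i ≤ α / (α + 1) * (n * ((α + 1) / α) + 1) := by gcongr
      have h4 : α / (α + 1) * (n * ((α + 1) / α) + 1) = n + α / (α + 1) := by field_simp
      have h5 : α / (α + 1) ≤ 1 := by
        rw [div_le_one hα1]
        linarith
      linarith
    calc _ ≤ ((⌊y⌋₊ + 1 : ℕ) : ℝ) := by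
          have := Finset.card_le_card hsub
          rw [Finset.card_range] at this
          exact_mod_cast this
      _ ≤ y + 1 := by
          push_cast
          gcongr
          exact Nat.floor_le (by positivity)
      _ ≤ 4 * y := by linarith
      _ ≤ 4 * 2 ^ (n / (α + 1) - e * |(n : ℝ) - i|) := by
          rw [hy]
          refine mul_le_mul_of_nonneg_left
            (Real.rpow_le_rpow_of_exponent_le one_le_two ?_) (by norm_num)
          rw [abs_sub_comm, abs_of_nonneg (by linarith)]
          have h3 : e * (i - n) ≤ α / (α + 1) * (i - n) := by
            gcongr
          have h4 : (n : ℝ) - α / (α + 1) * i = n / (α + 1) - α / (α + 1) * (i - n) := by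
            field_simp
            ring
          linarith

/-- The radii of one class are well approximated by few of them. -/
theorem exists_net {α e : ℝ} (hα : 0 < α) (he1 : e ≤ 1 / (α + 1))
    (he2 : e ≤ α / (α + 1)) {n : ℕ} (hn : 1 ≤ n) (i : ℕ) (V : Finset ℕ) (hV : ∀ ν ∈ V, 1 ≤ ν) :
    ∃ R ⊆ V, (R.card : ℝ≥0∞) ≤ 4 * 2 ^ (n / (α + 1) - e * |(n : ℝ) - i|) ∧
      ∀ ν ∈ V, scaleClass α n ν = i →
        ∃ ρ ∈ R, |(ν : ℝ) ^ (-α) - (ρ : ℝ) ^ (-α)| ≤ ((2 : ℝ) ^ n)⁻¹ := by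
  set key : ℕ → ℕ := fun ν => ⌊(2 : ℝ) ^ n * (ν : ℝ) ^ (-α)⌋₊ with hkey
  set W := V.filter fun ν => scaleClass α n ν = i
  have hrep : ∀ m : ℕ, ∃ ρ : ℕ, m ∈ W.image key → ρ ∈ W ∧ key ρ = m := fun m => by
    by_cases h : m ∈ W.image key
    · obtain ⟨ρ, h1, h2⟩ := Finset.mem_image.1 h
      exact ⟨ρ, fun _ => ⟨h1, h2⟩⟩
    · exact ⟨0, fun h' => absurd h' h⟩
  choose rep hrep using hrep
  refine ⟨(W.image key).image rep, fun ρ hρ => ?_, ?_, fun ν hν hi => ?_⟩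
  · obtain ⟨m, hm, rfl⟩ := Finset.mem_image.1 hρ
    exact (Finset.mem_filter.1 (hrep m hm).1).1
  · have h1 := card_image_floor_le hα he1 he2 hn (V := W)
      (fun ν hν => hV ν (Finset.mem_filter.1 hν).1) (fun ν hν => (Finset.mem_filter.1 hν).2)
    have h2 : (((W.image key).image rep).card : ℝ) ≤
        4 * 2 ^ (n / (α + 1) - e * |(n : ℝ) - i|) :=
      le_trans (Nat.cast_le.2 Finset.card_image_le) h1
    rw [two_rpow_eq_ofReal, ← ENNReal.ofReal_natCast]
    refine (ENNReal.ofReal_le_ofReal h2).trans (le_of_eq ?_)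
    rw [ENNReal.ofReal_mul (by norm_num)]
    norm_num
  · have hνW : key ν ∈ W.image key :=
      Finset.mem_image_of_mem _ (Finset.mem_filter.2 ⟨hν, hi⟩)
    refine ⟨rep (key ν), Finset.mem_image_of_mem _ hνW, ?_⟩
    have hk : ⌊(2 : ℝ) ^ n * (rep (key ν) : ℝ) ^ (-α)⌋₊ = ⌊(2 : ℝ) ^ n * (ν : ℝ) ^ (-α)⌋₊ :=
      (hrep _ hνW).2
    have h1 := Nat.floor_le (show 0 ≤ (2 : ℝ) ^ n * (ν : ℝ) ^ (-α) by positivity)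
    have h2 := Nat.lt_floor_add_one ((2 : ℝ) ^ n * (ν : ℝ) ^ (-α))
    have h3 := Nat.floor_le (show 0 ≤ (2 : ℝ) ^ n * (rep (key ν) : ℝ) ^ (-α) by positivity)
    have h4 := Nat.lt_floor_add_one ((2 : ℝ) ^ n * (rep (key ν) : ℝ) ^ (-α))
    rw [hk] at h3 h4
    rw [← one_div, le_div_iff₀ (by positivity), ← abs_of_pos (show (0 : ℝ) < 2 ^ n by positivity),
      ← abs_mul, sub_mul, abs_le]
    constructor <;> linarith

end

section

variable {d : ℕ}

theorem kconv_add {K f g : Ed d → ℂ} (hK : Continuous K) (hb : ∃ M : ℝ, ∀ x, ‖K x‖ ≤ M)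
    (hf : Integrable f) (hg : Integrable g) (x : Ed d) :
    kconv K (fun z => f z + g z) x = kconv K f x + kconv K g x := by
  obtain ⟨M, hM⟩ := hb
  have hi : ∀ {u : Ed d → ℂ}, Integrable u → Integrable fun z => K (x - z) * u z := fun hu =>
    hu.bdd_mul (c := M) (by fun_prop) (ae_of_all _ fun z => hM _)
  simp only [kconv, mul_add]
  exact integral_add (hi hf) (hi hg)

theorem bandP_add {f g : Ed d → ℂ} (hf : Nice f) (hg : Nice g) (j : ℤ) (x : Ed d) :
    bandP j (fun z => f z + g z) x = bandP j f x + bandP j g x := by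
  have h1 : deltaP j (fun z => f z + g z) = fun z => deltaP j f z + deltaP j g z :=
    funext fun z => kconv_add ((goodKernel_schwartz _).continuous_dil j)
      ((goodKernel_schwartz _).bounded_dil j) hf.integrable hg.integrable z
  rw [bandP, h1]
  exact kconv_add ((goodKernel_schwartz _).continuous_dil j)
    ((goodKernel_schwartz _).bounded_dil j) (hf.deltaP j).integrable (hg.deltaP j).integrable x

theorem integrable_sphere_comp (hd : 1 ≤ d) {f : Ed d → ℂ} (hf : Continuous f) (t : ℝ)
    (x : Ed d) :
    Integrable (fun y : sphere (0 : Ed d) 1 => f (x - t • (y : Ed d))) (sphereProb d) := by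
  have := isProbabilityMeasure_sphereProb hd
  have hc : Continuous fun y : sphere (0 : Ed d) 1 => f (x - t • (y : Ed d)) := by fun_prop
  exact hc.integrable_of_hasCompactSupport (HasCompactSupport.of_compactSpace _)

theorem sphMean_add (hd : 1 ≤ d) {f g : Ed d → ℂ} (hf : Continuous f) (hg : Continuous g) (t : ℝ)
    (x : Ed d) : sphMean d t (fun z => f z + g z) x = sphMean d t f x + sphMean d t g x :=
  integral_add (integrable_sphere_comp hd hf t x) (integrable_sphere_comp hd hg t x)

theorem le_rpow_neg_mul {l v X : ℝ≥0∞} {p : ℝ} (hl0 : l ≠ 0) (hl : l ≠ ∞) (h : l ^ p * v ≤ X) :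
    v ≤ l ^ (-p) * X := by
  calc v = l ^ (-p) * (l ^ p * v) := by
        rw [← mul_assoc, ← ENNReal.rpow_add _ _ hl0 hl, neg_add_cancel, ENNReal.rpow_zero, one_mul]
    _ ≤ _ := by gcongr

theorem high_weight_eq (v w n r e κ s q : ℝ) (hq : 1 < q) (hs : s * (q - 1) = κ) :
    ((2 : ℝ≥0∞) ^ v) ^ q * (2 ^ (w + v - 1 - e * r)) ^ (-(2 * q / (1 + q))) *
      (4 * 2 ^ (n * κ - 4 * e * r)) ^ (q / (1 + q)) =
    2 ^ (2 * q / (1 + q) * (2 - w)) * 2 ^ (-(2 * q / (1 + q) * e * r)) *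
      (2 ^ v * 2 ^ (s * n)) ^ (q - 2 * q / (1 + q)) := by
  have h4 : (4 : ℝ≥0∞) = 2 ^ (2 : ℝ) := by norm_num
  rw [h4]
  simp only [← two_rpow_add, ← ENNReal.rpow_mul]
  congr 1
  rw [← hs]
  field_simp
  ring

theorem low_weight_eq (v w n r e κ s q : ℝ) (hs : s * (q - 1) = κ) :
    ((2 : ℝ≥0∞) ^ v) ^ q * (2 ^ (w + v - 1 - e * r)) ^ (-2 : ℝ) *
      (4 * 2 ^ (n * κ - 4 * e * r) * 2 ^ (-(s * n))) =
    2 ^ (4 - 2 * w) * 2 ^ (-(2 * e * r)) * (2 ^ v * 2 ^ (s * n)) ^ (-(2 - q)) := by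
  have h4 : (4 : ℝ≥0∞) = 2 ^ (2 : ℝ) := by norm_num
  rw [h4]
  simp only [← two_rpow_add, ← ENNReal.rpow_mul]
  congr 1
  rw [← hs]
  ring

/-- The radii of the set `E(α)`. -/
def rad (α : ℝ) (k : ℤ) (ν : ℕ) : ℝ := 2 ^ k * (1 + (ν : ℝ) ^ (-α))

theorem zpow_le_rad (α : ℝ) (k : ℤ) (ν : ℕ) : (2 : ℝ) ^ k ≤ rad α k ν :=
  le_mul_of_one_le_right (by positivity) (by linarith [show (0 : ℝ) ≤ (ν : ℝ) ^ (-α) by positivity])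

theorem rad_le {α : ℝ} (hα : 0 < α) (k : ℤ) {ν : ℕ} (hν : 1 ≤ ν) : rad α k ν ≤ 2 * 2 ^ k := by
  have : (ν : ℝ) ^ (-α) ≤ 1 :=
    Real.rpow_le_one_of_one_le_of_nonpos (by exact_mod_cast hν) (by linarith)
  rw [rad, mul_comm]
  gcongr
  linarith

theorem exists_weak_sphMean_class (hd : 2 ≤ d) {α : ℝ} (hα : 0 < α) {q : ℝ}
    (hq : q = 1 + 1 / (((d : ℝ) - 1) * (α + 1))) {e : ℝ}
    (he1 : 4 * e ≤ 1 / (α + 1)) (he2 : 4 * e ≤ α / (α + 1)) {c : ℝ≥0∞} (hc0 : c ≠ 0)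
    (hc : c ≠ ∞) : ∃ D : ℝ≥0∞, D ≠ ∞ ∧ ∀ (F : Finset ℤ) (V : Finset ℕ), (∀ ν ∈ V, 1 ≤ ν) →
      ∀ B : ℝ≥0∞, B ≠ 0 → B ≠ ∞ → PosWeak d {t | ∃ k ∈ F, ∃ ν ∈ V, t = rad α k ν} q B →
      ∀ (f : Ed d → ℂ), Nice f → ∀ a : ℝ≥0∞, a ≠ 0 → a ≠ ∞ → ∀ n : ℕ, 1 ≤ n → ∀ i : ℕ,
      a ^ q * volume {x | ∃ k ∈ F, ∃ ν ∈ V, scaleClass α n ν = i ∧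
        c * a * 2 ^ (-(e * |(n : ℝ) - i|)) < ‖sphMean d (rad α k ν) (bandP (k - n) f) x‖ₑ} ≤
      D * B ^ (1 / (1 + q)) * (2 ^ (-(2 * q / (1 + q) * e * |(n : ℝ) - i|)) *
        ((a * 2 ^ (((d : ℝ) - 1) * n)) ^ (q - 2 * q / (1 + q)) *
          ∫⁻ x in {x | a * 2 ^ (((d : ℝ) - 1) * n) < ‖f x‖ₑ}, ‖f x‖ₑ ^ (2 * q / (1 + q)))) +
      D * (2 ^ (-(2 * e * |(n : ℝ) - i|)) *
        ((a * 2 ^ (((d : ℝ) - 1) * n)) ^ (-(2 - q)) *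
          ∫⁻ x in {x | ‖f x‖ₑ ≤ a * 2 ^ (((d : ℝ) - 1) * n)}, ‖f x‖ₑ ^ (2 : ℝ))) := by
  have hd2 : (2 : ℝ) ≤ d := by exact_mod_cast hd
  set s : ℝ := (d : ℝ) - 1 with hs
  have hs1 : 1 ≤ s := by linarith
  have hα1 : 1 < α + 1 := by linarith
  have hprod : 1 < s * (α + 1) := by nlinarith
  have hq1 : 1 < q := by
    rw [hq]
    have : 0 < 1 / (s * (α + 1)) := by positivity
    linarith
  have hq2 : q < 2 := by
    rw [hq]
    have : 1 / (s * (α + 1)) < 1 := by rwa [div_lt_one (by linarith)]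
    linarith
  have hsq : s * (q - 1) = 1 / (α + 1) := by
    rw [hq]
    field_simp
    ring
  set p := 2 * q / (1 + q) with hp
  have hp0 : 0 < p := by positivity
  obtain ⟨C₁, hC₁, hw1⟩ := exists_weak_sphMean_bandP (d := d) (by omega) hq1 hq2
  obtain ⟨C₂, hC₂, hw2⟩ := exists_weak_two_sphMean_bandP (d := d) (by omega)
  obtain ⟨w, rfl⟩ := exists_eq_two_rpow hc0 hc
  refine ⟨C₁ * 2 ^ (p * (2 - w)) + C₂ * 2 ^ (4 - 2 * w), ENNReal.add_ne_top.2
    ⟨ENNReal.mul_ne_top hC₁ (two_rpow_ne_top _), ENNReal.mul_ne_top hC₂ (two_rpow_ne_top _)⟩,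
    fun F V hV B hB0 hB hPW f hf a ha0 ha n hn i => ?_⟩
  obtain ⟨v, rfl⟩ := exists_eq_two_rpow ha0 ha
  set r : ℝ := |(n : ℝ) - i| with hr
  obtain ⟨R, hRV, hRc, hR⟩ := exists_net hα he1 he2 hn i V hV
  rw [← hr] at hRc
  set N : ℝ≥0∞ := 4 * 2 ^ (n / (α + 1) - 4 * e * r) with hN
  have hN0 : N ≠ 0 := mul_ne_zero (by norm_num) (two_rpow_ne_zero _)
  have hNt : N ≠ ∞ := ENNReal.mul_ne_top (by norm_num) (two_rpow_ne_top _)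
  set h : ℝ≥0∞ := 2 ^ v * 2 ^ (s * n) with hh
  set T : ℤ → Finset ℝ := fun k => R.image (rad α k) with hT
  have hTc : ∀ k ∈ F, ((T k).card : ℝ≥0∞) ≤ N := fun k _ =>
    (Nat.cast_le.2 Finset.card_image_le).trans hRc
  have hT2 : ∀ k ∈ F, ∀ t ∈ T k, (2 : ℝ) ^ k ≤ t := fun k _ t ht => by
    obtain ⟨ρ, -, rfl⟩ := Finset.mem_image.1 ht
    exact zpow_le_rad α k ρ
  have hTI : ∀ k ∈ F, ∀ t ∈ T k, t ∈ {t | ∃ k ∈ F, ∃ ν ∈ V, t = rad α k ν} := fun k hk t ht => by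
    obtain ⟨ρ, hρ, rfl⟩ := Finset.mem_image.1 ht
    exact ⟨k, hk, ρ, hRV hρ, rfl⟩
  set l : ℝ≥0∞ := 2 ^ (w + v - 1 - e * r) with hl
  have hl0 : l ≠ 0 := two_rpow_ne_zero _
  have hlt : l ≠ ∞ := two_rpow_ne_top _
  have h2l : (2 : ℝ≥0∞) ^ w * 2 ^ v * 2 ^ (-(e * r)) = l + l := by
    rw [← two_mul, hl, ← two_rpow_add, ← two_rpow_add]
    nth_rw 2 [← ENNReal.rpow_one (x := 2)]
    rw [← two_rpow_add]
    congr 1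
    ring
  have H1 := le_rpow_neg_mul hl0 hlt
    (hw1 _ B hPW hB0 hB n F T N hN0 hNt hTc hTI _ (hf.highPart h) l hl0 hlt)
  have H2 := le_rpow_neg_mul hl0 hlt (p := 2)
    (by simpa using hw2 n hn F T N hTc hT2 _ (hf.lowPart h) l)
  rw [← hp, lintegral_highPart hf.measurable h hp0] at H1
  have e2 := lintegral_lowPart hf.measurable h two_pos
  simp_rw [ENNReal.rpow_two] at e2
  rw [e2] at H2
  simp_rw [ENNReal.rpow_two]
  set M₁ := ∫⁻ x in {x | h < ‖f x‖ₑ}, ‖f x‖ₑ ^ p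
  set M₂ := ∫⁻ x in {x | ‖f x‖ₑ ≤ h}, ‖f x‖ₑ ^ 2
  set S₁ := {x | ∃ k ∈ F, ∃ t' ∈ T k, ∃ t, |t - t'| ≤ 2 ^ (k - n : ℤ) ∧
    l < ‖sphMean d t (bandP (k - n) (highPart h f)) x‖ₑ}
  set S₂ := {x | ∃ k ∈ F, ∃ t' ∈ T k, ∃ t, |t - t'| ≤ 2 ^ (k - n : ℤ) ∧
    l < ‖sphMean d t (bandP (k - n) (lowPart h f)) x‖ₑ}
  have hsub : {x | ∃ k ∈ F, ∃ ν ∈ V, scaleClass α n ν = i ∧ (2 : ℝ≥0∞) ^ w * 2 ^ v *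
      2 ^ (-(e * r)) < ‖sphMean d (rad α k ν) (bandP (k - n) f) x‖ₑ} ⊆ S₁ ∪ S₂ := by
    rintro x ⟨k, hk, ν, hν, hi, hx⟩
    obtain ⟨ρ, hρ, hνρ⟩ := hR ν hν hi
    have hdist : |rad α k ν - rad α k ρ| ≤ 2 ^ (k - n : ℤ) := by
      rw [rad, rad, ← mul_sub, add_sub_add_left_eq_sub, abs_mul, abs_of_pos (by positivity),
        zpow_sub₀ two_ne_zero, zpow_natCast, div_eq_mul_inv]
      gcongr
    have hfs : bandP (k - n) f = fun x => bandP (k - n) (highPart h f) x +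
        bandP (k - n) (lowPart h f) x := by
      funext x
      rw [← bandP_add (hf.highPart h) (hf.lowPart h), highPart_add_lowPart]
    rw [h2l, hfs, sphMean_add (by omega) (continuous_bandP (hf.highPart h) _)
      (continuous_bandP (hf.lowPart h) _)] at hx
    have hTk : rad α k ρ ∈ T k := Finset.mem_image_of_mem _ hρ
    rcases lt_or_ge l ‖sphMean d (rad α k ν) (bandP (k - n) (highPart h f)) x‖ₑ with h1 | h1
    · exact Or.inl ⟨k, hk, _, hTk, _, hdist, h1⟩
    · refine Or.inr ⟨k, hk, _, hTk, _, hdist, ?_⟩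
      by_contra! h2
      exact absurd (hx.trans_le ((enorm_add_le _ _).trans (add_le_add h1 h2))) (lt_irrefl _)
  have E1 := high_weight_eq v w n r e (1 / (α + 1)) s q hq1 hsq
  have E2 := low_weight_eq v w n r e (1 / (α + 1)) s q hsq
  rw [mul_one_div, ← hN, ← hl, ← hp, ← hh] at E1
  rw [mul_one_div, ← hN, ← hl, ← hh] at E2
  have hpow : (((2 : ℝ≥0∞) ^ n) ^ (d - 1))⁻¹ = 2 ^ (-(s * n)) := by
    rw [← pow_mul, ENNReal.rpow_neg, ← ENNReal.rpow_natCast]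
    congr 2
    rw [Nat.cast_mul, Nat.cast_sub (by omega), hs]
    push_cast
    ring
  rw [hpow] at H2
  calc _ ≤ (2 ^ v) ^ q * (volume S₁ + volume S₂) := by
        gcongr
        exact (measure_mono hsub).trans (measure_union_le _ _)
    _ ≤ (2 ^ v) ^ q * (l ^ (-p) * (C₁ * (N ^ (q / (1 + q)) * B ^ (1 / (1 + q))) * M₁) +
        l ^ (-2 : ℝ) * (C₂ * N * 2 ^ (-(s * n)) * M₂)) := by gcongr
    _ = C₁ * B ^ (1 / (1 + q)) * ((2 ^ v) ^ q * l ^ (-p) * N ^ (q / (1 + q))) * M₁ +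
        C₂ * ((2 ^ v) ^ q * l ^ (-2 : ℝ) * (N * 2 ^ (-(s * n)))) * M₂ := by ring
    _ = (C₁ * 2 ^ (p * (2 - w))) * B ^ (1 / (1 + q)) * (2 ^ (-(p * e * r)) *
          (h ^ (q - p) * M₁)) +
        (C₂ * 2 ^ (4 - 2 * w)) * (2 ^ (-(2 * e * r)) * (h ^ (-(2 - q)) * M₂)) := by
        rw [E1, E2]
        ring
    _ ≤ _ := by
        gcongr
        · exact le_self_add
        · exact le_add_self

end

section

variable {d : ℕ}

theorem exists_weak_sum_sphMean_bandP (hd : 2 ≤ d) {α : ℝ} (hα : 0 < α) {q : ℝ}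
    (hq : q = 1 + 1 / (((d : ℝ) - 1) * (α + 1))) :
    ∃ C : ℝ≥0∞, C ≠ ∞ ∧ ∀ (F : Finset ℤ) (V : Finset ℕ), (∀ ν ∈ V, 1 ≤ ν) →
      ∀ B : ℝ≥0∞, B ≠ 0 → B ≠ ∞ → PosWeak d {t | ∃ k ∈ F, ∃ ν ∈ V, t = rad α k ν} q B →
      ∀ (f : Ed d → ℂ), Nice f → ∀ a : ℝ≥0∞, a ≠ 0 → a ≠ ∞ → ∀ m : ℕ,
      a ^ q * volume {x | ∃ k ∈ F, ∃ ν ∈ V, a <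
        ∑ i ∈ Finset.range m, ‖sphMean d (rad α k ν) (bandP (k - (i + 1 : ℕ)) f) x‖ₑ} ≤
      C * (B ^ (1 / (1 + q)) + 1) * ∫⁻ x, ‖f x‖ₑ ^ q := by
  have hd1 : (1 : ℝ) ≤ (d : ℝ) - 1 := by
    have : (2 : ℝ) ≤ d := by exact_mod_cast hd
    linarith
  have hden : 1 < ((d : ℝ) - 1) * (α + 1) := by nlinarith
  have hq1 : 1 < q := by rw [hq]; linarith [show 0 < 1 / (((d : ℝ) - 1) * (α + 1)) by positivity]
  have hq2 : q < 2 := by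
    rw [hq]; linarith [(div_lt_one (by linarith : 0 < ((d : ℝ) - 1) * (α + 1))).2 hden]
  have hα1 : 0 < α + 1 := by linarith
  set e : ℝ := min (1 / (α + 1)) (α / (α + 1)) / 4 with he
  have he0 : 0 < e := by positivity
  have he1 : 4 * e ≤ 1 / (α + 1) := by linarith [min_le_left (1 / (α + 1)) (α / (α + 1))]
  have he2 : 4 * e ≤ α / (α + 1) := by linarith [min_le_right (1 / (α + 1)) (α / (α + 1))]
  have hr : 0 < 2 * q / (1 + q) := by positivity
  have hr' : 0 < q - 2 * q / (1 + q) := by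
    rw [sub_pos, div_lt_iff₀ (by linarith)]; nlinarith
  obtain ⟨K, hK, hKs⟩ := exists_tsum_scaleClass_le hα he0
  obtain ⟨K₁, hK₁, hK₁s⟩ := exists_tsum_abs_sub_le (e := 2 * q / (1 + q) * e) (by positivity)
  obtain ⟨K₂, hK₂, hK₂s⟩ := exists_tsum_abs_sub_le (e := 2 * e) (by positivity)
  obtain ⟨C₁, hC₁, hC₁s⟩ := exists_tsum_lintegral_high_le (d := d) (s := (d : ℝ) - 1)
    (by linarith) hr' hr.le
  obtain ⟨C₂, hC₂, hC₂s⟩ := exists_tsum_lintegral_low_le (d := d) (s := (d : ℝ) - 1) (r := 2)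
    (by linarith) (sub_pos.2 hq2) (by linarith)
  have hc0 : (K + 1)⁻¹ ≠ 0 := ENNReal.inv_ne_zero.2 (by finiteness)
  have hc : (K + 1)⁻¹ ≠ ∞ := ENNReal.inv_ne_top.2 (by simp)
  obtain ⟨D, hD, hDs⟩ := exists_weak_sphMean_class hd hα hq he1 he2 hc0 hc
  refine ⟨D * (K₁ * C₁ + K₂ * C₂), by finiteness, fun F V hV B hB0 hB hW f hf a ha0 ha m => ?_⟩
  set S : ℕ → ℕ → Set (Ed d) := fun n i => {x | ∃ k ∈ F, ∃ ν ∈ V, scaleClass α n ν = i ∧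
        (K + 1)⁻¹ * a * 2 ^ (-(e * |(n : ℝ) - i|)) <
          ‖sphMean d (rad α k ν) (bandP (k - n) f) x‖ₑ} with hS
  have hsub : {x | ∃ k ∈ F, ∃ ν ∈ V, a <
        ∑ i ∈ Finset.range m, ‖sphMean d (rad α k ν) (bandP (k - (i + 1 : ℕ)) f) x‖ₑ} ⊆
      ⋃ n : ℕ, ⋃ i : ℕ, S (n + 1) i := by
    rintro x ⟨k, hk, ν, hν, hx⟩
    by_contra hcon
    simp only [mem_iUnion, not_exists] at hcon
    have hle : ∀ n : ℕ, ‖sphMean d (rad α k ν) (bandP (k - (n + 1 : ℕ)) f) x‖ₑ ≤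
        (K + 1)⁻¹ * a * 2 ^ (-(e * |((n + 1 : ℕ) : ℝ) - scaleClass α (n + 1) ν|)) := by
      intro n
      by_contra hlt
      exact hcon n _ ⟨k, hk, ν, hν, rfl, not_le.1 hlt⟩
    refine hx.not_ge ?_
    calc ∑ i ∈ Finset.range m, ‖sphMean d (rad α k ν) (bandP (k - (i + 1 : ℕ)) f) x‖ₑ
        ≤ ∑ i ∈ Finset.range m, (K + 1)⁻¹ * a *
          2 ^ (-(e * |((i + 1 : ℕ) : ℝ) - scaleClass α (i + 1) ν|)) :=
          Finset.sum_le_sum fun i _ => hle i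
      _ = (K + 1)⁻¹ * a * ∑ i ∈ Finset.range m, (2 : ℝ≥0∞) ^
          (-(e * |((i + 1 : ℕ) : ℝ) - scaleClass α (i + 1) ν|)) := by rw [Finset.mul_sum]
      _ ≤ (K + 1)⁻¹ * a * K := by
          gcongr
          exact (ENNReal.sum_le_tsum _).trans <| (ENNReal.tsum_comp_le_tsum_of_injective
            (add_left_injective 1) fun n : ℕ => (2 : ℝ≥0∞) ^
              (-(e * |(n : ℝ) - scaleClass α n ν|))).trans (hKs ν)
      _ ≤ (K + 1)⁻¹ * a * (K + 1) := by gcongr; exact le_self_add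
      _ = a := by
          rw [mul_right_comm, ENNReal.inv_mul_cancel (by simp) (by finiteness), one_mul]
  set X : ℝ → ℝ≥0∞ := fun n => (a * 2 ^ (((d : ℝ) - 1) * n)) ^ (q - 2 * q / (1 + q)) *
    ∫⁻ x in {x | a * 2 ^ (((d : ℝ) - 1) * n) < ‖f x‖ₑ}, ‖f x‖ₑ ^ (2 * q / (1 + q)) with hX
  set Y : ℝ → ℝ≥0∞ := fun n => (a * 2 ^ (((d : ℝ) - 1) * n)) ^ (-(2 - q)) *
    ∫⁻ x in {x | ‖f x‖ₑ ≤ a * 2 ^ (((d : ℝ) - 1) * n)}, ‖f x‖ₑ ^ (2 : ℝ) with hY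
  set b := B ^ (1 / (1 + q))
  have hinj : Function.Injective fun n : ℕ => ((n + 1 : ℕ) : ℤ) := fun i j h => by simpa using h
  have hXs : ∑' n : ℕ, X (n + 1 : ℕ) ≤ C₁ * ∫⁻ x, ‖f x‖ₑ ^ q := by
    have h1 := hC₁s _ hf.measurable.enorm a ha0 ha
    rw [add_sub_cancel] at h1
    exact (ENNReal.tsum_comp_le_tsum_of_injective hinj fun z : ℤ => X z).trans h1
  have hYs : ∑' n : ℕ, Y (n + 1 : ℕ) ≤ C₂ * ∫⁻ x, ‖f x‖ₑ ^ q := by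
    have h1 := hC₂s _ hf.measurable.enorm a ha0 ha
    rw [sub_sub_cancel] at h1
    exact (ENNReal.tsum_comp_le_tsum_of_injective hinj fun z : ℤ => Y z).trans h1
  calc a ^ q * volume {x | ∃ k ∈ F, ∃ ν ∈ V, a <
        ∑ i ∈ Finset.range m, ‖sphMean d (rad α k ν) (bandP (k - (i + 1 : ℕ)) f) x‖ₑ}
      ≤ a ^ q * ∑' n : ℕ, ∑' i : ℕ, volume (S (n + 1) i) := by
        gcongr
        exact (measure_mono hsub).trans <| (measure_iUnion_le _).trans <|
          ENNReal.tsum_le_tsum fun n => measure_iUnion_le _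
    _ = ∑' n : ℕ, ∑' i : ℕ, a ^ q * volume (S (n + 1) i) := by
        simp_rw [ENNReal.tsum_mul_left]
    _ ≤ ∑' n : ℕ, ∑' i : ℕ,
        (D * b * (2 ^ (-(2 * q / (1 + q) * e * |((n + 1 : ℕ) : ℝ) - i|)) * X (n + 1 : ℕ)) +
          D * (2 ^ (-(2 * e * |((n + 1 : ℕ) : ℝ) - i|)) * Y (n + 1 : ℕ))) :=
        ENNReal.tsum_le_tsum fun n => ENNReal.tsum_le_tsum fun i =>
          hDs F V hV B hB0 hB hW f hf a ha0 ha (n + 1) (Nat.le_add_left 1 n) i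
    _ ≤ ∑' n : ℕ, (D * b * K₁ * X (n + 1 : ℕ) + D * K₂ * Y (n + 1 : ℕ)) := by
        refine ENNReal.tsum_le_tsum fun n => ?_
        rw [ENNReal.tsum_add, ENNReal.tsum_mul_left, ENNReal.tsum_mul_left, ENNReal.tsum_mul_right,
          ENNReal.tsum_mul_right, mul_assoc (D * b) K₁, mul_assoc D K₂]
        gcongr
        · exact hK₁s _
        · exact hK₂s _
    _ = D * b * K₁ * ∑' n : ℕ, X (n + 1 : ℕ) + D * K₂ * ∑' n : ℕ, Y (n + 1 : ℕ) := by
        rw [ENNReal.tsum_add, ENNReal.tsum_mul_left, ENNReal.tsum_mul_left]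
    _ ≤ D * b * K₁ * (C₁ * ∫⁻ x, ‖f x‖ₑ ^ q) + D * K₂ * (C₂ * ∫⁻ x, ‖f x‖ₑ ^ q) := by gcongr
    _ = (D * (K₁ * C₁) * b + D * (K₂ * C₂) * 1) * ∫⁻ x, ‖f x‖ₑ ^ q := by ring
    _ ≤ (D * (K₁ * C₁) * (b + 1) + D * (K₂ * C₂) * (b + 1)) * ∫⁻ x, ‖f x‖ₑ ^ q := by
        gcongr
        · exact le_self_add
        · exact le_add_self
    _ = D * (K₁ * C₁ + K₂ * C₂) * (b + 1) * ∫⁻ x, ‖f x‖ₑ ^ q := by ring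

end

section

open FourierTransform

variable {d : ℕ}

theorem posMean_rpow_le (hd : 1 ≤ d) {p : ℝ} (hp : 1 < p) (t : ℝ) {h : Ed d → ℝ≥0∞}
    (hh : Measurable h) (x : Ed d) : posMean t h x ^ p ≤ posMean t (fun x => h x ^ p) x := by
  have := isProbabilityMeasure_sphereProb hd
  have hm : Measurable fun y : sphere (0 : Ed d) 1 => h (x - t • (y : Ed d)) := by fun_prop
  have := ENNReal.lintegral_mul_le_Lp_mul_Lq (sphereProb d)
    (Real.HolderConjugate.conjExponent hp) hm.aemeasurable (g := fun _ => 1) aemeasurable_const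
  simp only [Pi.mul_apply, mul_one, ENNReal.one_rpow, lintegral_const, measure_univ] at this
  calc posMean t h x ^ p ≤ (posMean t (fun x => h x ^ p) x ^ (1 / p)) ^ p :=
        ENNReal.rpow_le_rpow this (by linarith)
    _ = _ := by rw [← ENNReal.rpow_mul, one_div_mul_cancel (by linarith), ENNReal.rpow_one]

theorem rpow_mul_volume_posMean_le (hd : 1 ≤ d) {p : ℝ} (hp : 1 < p) (t : ℝ) {h : Ed d → ℝ≥0∞}
    (hh : Measurable h) {s : ℝ≥0∞} :
    s ^ p * volume {x | s < posMean t h x} ≤ ∫⁻ x, h x ^ p := by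
  have hp0 : 0 < p := by linarith
  calc s ^ p * volume {x | s < posMean t h x}
      ≤ s ^ p * volume {x | s ^ p ≤ posMean t h x ^ p} := by
        gcongr with x
        exact fun hx => ENNReal.rpow_le_rpow (le_of_lt hx) hp0.le
    _ ≤ ∫⁻ x, posMean t h x ^ p :=
        mul_meas_ge_le_lintegral₀ ((measurable_posMean hd t hh).pow_const p).aemeasurable _
    _ ≤ ∫⁻ x, posMean t (fun x => h x ^ p) x :=
        lintegral_mono fun x => posMean_rpow_le hd hp t hh x
    _ = _ := lintegral_posMean hd t (hh.pow_const p)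

theorem volume_exists_mem_le {ι : Type*} (F : Finset ι) (S : ι → Set (Ed d)) :
    volume {x | ∃ k ∈ F, x ∈ S k} ≤ ∑ k ∈ F, volume (S k) := by
  refine (measure_mono fun x => ?_).trans (measure_biUnion_finset_le F S)
  rintro ⟨k, hk, hx⟩
  exact mem_biUnion hk hx

theorem posWeak_card (hd : 1 ≤ d) (α : ℝ) (F : Finset ℤ) (V : Finset ℕ) {p : ℝ} (hp : 1 < p) :
    PosWeak d {t | ∃ k ∈ F, ∃ ν ∈ V, t = rad α k ν} p (F.card * V.card) := by
  intro h hh s _ _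
  calc s ^ p * volume {x | ∃ t ∈ {t | ∃ k ∈ F, ∃ ν ∈ V, t = rad α k ν}, s < posMean t h x}
      ≤ s ^ p * ∑ k ∈ F, ∑ ν ∈ V, volume {x | s < posMean (rad α k ν) h x} := by
        gcongr
        refine le_trans (measure_mono ?_) <| (volume_exists_mem_le F
          fun k => {x | ∃ ν ∈ V, x ∈ {x | s < posMean (rad α k ν) h x}}).trans
          (Finset.sum_le_sum fun k _ => volume_exists_mem_le V _)
        rintro x ⟨t, ⟨k, hk, ν, hν, rfl⟩, hx⟩
        exact ⟨k, hk, ν, hν, hx⟩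
    _ = ∑ k ∈ F, ∑ ν ∈ V, s ^ p * volume {x | s < posMean (rad α k ν) h x} := by
        simp_rw [Finset.mul_sum]
    _ ≤ ∑ k ∈ F, ∑ ν ∈ V, ∫⁻ x, h x ^ p :=
        Finset.sum_le_sum fun k _ => Finset.sum_le_sum fun ν _ =>
          rpow_mul_volume_posMean_le hd hp _ hh
    _ = _ := by simp [mul_assoc]

theorem tendsto_lintegral_sub_lowP {f : Ed d → ℂ} (hf : Nice f) (k : ℤ) :
    Tendsto (fun n : ℕ => ∫⁻ x, ‖f x - lowP (k - n) f x‖ₑ ^ 2) atTop (𝓝 0) := by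
  have key : ∀ n : ℕ, ∫⁻ x, ‖f x - lowP (k - n) f x‖ₑ ^ 2 =
      ∫⁻ ξ, ‖(1 - cutoff d ((2 : ℝ) ^ (k - n : ℤ) • ξ) ^ 2) * 𝓕 f ξ‖ₑ ^ 2 := by
    intro n
    have hn := hf.sub (hf.lowP (k - n))
    rw [← lintegral_fourier_sq hn.integrable hn.memLp_two]
    refine lintegral_congr fun ξ => ?_
    rw [fourier_sub hf.integrable (hf.lowP _).integrable, fourier_lowP hf, sub_mul, one_mul]
  simp_rw [key]
  have hcont := continuous_fourier_of_integrable hf.integrable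
  rw [← lintegral_zero (α := Ed d) (μ := volume)]
  refine tendsto_lintegral_of_dominated_convergence (fun ξ => 4 * ‖𝓕 f ξ‖ₑ ^ 2) ?_ ?_ ?_ ?_
  · intro n
    have h1 : Continuous fun ξ : Ed d => cutoff d ((2 : ℝ) ^ (k - n : ℤ) • ξ) :=
      contDiff_cutoff.continuous.comp (continuous_const_smul _)
    exact (((continuous_const.sub (h1.pow 2)).mul hcont).measurable.enorm).pow_const 2
  · intro n
    refine ae_of_all _ fun ξ => ?_
    have h2 : ‖1 - cutoff d ((2 : ℝ) ^ (k - n : ℤ) • ξ) ^ 2‖ₑ ≤ 2 := by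
      have h3 : ‖1 - cutoff d ((2 : ℝ) ^ (k - n : ℤ) • ξ) ^ 2‖ ≤ 2 := by
        refine (norm_sub_le _ _).trans ?_
        rw [norm_one, norm_pow]
        linarith [pow_le_one₀ (n := 2) (norm_nonneg _)
          (norm_cutoff_le ((2 : ℝ) ^ (k - n : ℤ) • ξ))]
      rw [← ofReal_norm]
      exact (ENNReal.ofReal_le_ofReal h3).trans (by norm_num)
    calc _ = ‖1 - cutoff d ((2 : ℝ) ^ (k - n : ℤ) • ξ) ^ 2‖ₑ ^ 2 * ‖𝓕 f ξ‖ₑ ^ 2 := by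
          simp only [enorm_mul, mul_pow]
      _ ≤ 2 ^ 2 * ‖𝓕 f ξ‖ₑ ^ 2 := by gcongr
      _ = _ := by norm_num
  · rw [lintegral_const_mul _ (hcont.measurable.enorm.pow_const 2),
      lintegral_fourier_sq hf.integrable hf.memLp_two]
    have h4 := hf.memLp_two.eLpNorm_lt_top
    have h5 := eLpNorm_nnreal_pow_eq_lintegral (μ := (volume : Measure (Ed d))) (f := f)
      (p := 2) (by norm_num)
    have h6 : ∫⁻ x, ‖f x‖ₑ ^ 2 = eLpNorm f 2 volume ^ 2 := by
      have := h5.symm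
      norm_num at this
      exact_mod_cast this
    rw [h6]
    finiteness
  · refine ae_of_all _ fun ξ => ?_
    have h1 : ∀ᶠ n : ℕ in atTop, ‖(2 : ℝ) ^ (k - n : ℤ) • ξ‖ ≤ 1 := by
      have h2 : Tendsto (fun n : ℕ => (2 : ℝ) ^ k * ‖ξ‖ * (1 / 2) ^ n) atTop (𝓝 0) := by
        simpa using (tendsto_pow_atTop_nhds_zero_of_lt_one (by norm_num : (0 : ℝ) ≤ 1 / 2)
          (by norm_num)).const_mul ((2 : ℝ) ^ k * ‖ξ‖)
      filter_upwards [h2.eventually (ge_mem_nhds one_pos)] with n hn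
      rw [norm_smul, zpow_sub₀ two_ne_zero, zpow_natCast, norm_div, norm_pow, Real.norm_ofNat,
        Real.norm_of_nonneg (by positivity)]
      refine le_of_eq_of_le ?_ hn
      rw [one_div, inv_pow]
      ring
    refine tendsto_const_nhds.congr' ?_
    filter_upwards [h1] with n hn
    rw [cutoff_eq_one hn]
    simp

theorem Nice.integrable_sphere_comp (hd : 1 ≤ d) {f : Ed d → ℂ} (hf : Nice f) (t : ℝ) (x : Ed d) :
    Integrable (fun y : sphere (0 : Ed d) 1 => f (x - t • (y : Ed d))) (sphereProb d) := by
  have := isProbabilityMeasure_sphereProb hd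
  obtain ⟨M, hM⟩ := hf.bounded
  have hm : Measurable fun y : sphere (0 : Ed d) 1 => f (x - t • (y : Ed d)) :=
    hf.measurable.comp (by fun_prop)
  exact (integrable_const M).mono' hm.aestronglyMeasurable (ae_of_all _ fun y => hM _)

theorem sphMean_eq_sub_add (hd : 1 ≤ d) {f : Ed d → ℂ} (hf : Nice f) (t : ℝ) (k : ℤ) (n : ℕ)
    (x : Ed d) : sphMean d t f x = sphMean d t (fun x => f x - lowP (k - n) f x) x +
      sphMean d t (lowP k f) x +
        ∑ i ∈ Finset.range n, sphMean d t (bandP (k - (i + 1 : ℕ)) f) x := by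
  have hb : ∀ i ∈ Finset.range n, Integrable (fun y : sphere (0 : Ed d) 1 =>
      bandP (k - (i + 1 : ℕ)) f (x - t • (y : Ed d))) (sphereProb d) := fun i _ =>
    (hf.bandP _).integrable_sphere_comp hd t x
  have h1 := (hf.sub (hf.lowP (k - n))).integrable_sphere_comp hd t x
  have h2 := (hf.lowP k).integrable_sphere_comp hd t x
  unfold sphMean
  rw [← integral_finsetSum _ hb, ← integral_add h1 h2,
    ← integral_add (h1.fun_add h2) (integrable_finsetSum _ hb)]
  congr 1 with y
  rw [lowP_sub_eq_sum hf]
  ring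

end

section

variable {d : ℕ}

theorem exists_weak_sphMean (hd : 2 ≤ d) {α : ℝ} (hα : 0 < α) {q : ℝ}
    (hq : q = 1 + 1 / (((d : ℝ) - 1) * (α + 1))) (hq1 : 1 ≤ q) :
    ∃ C : ℝ≥0∞, C ≠ ∞ ∧ ∀ (F : Finset ℤ) (V : Finset ℕ), (∀ ν ∈ V, 1 ≤ ν) →
      ∀ B : ℝ≥0∞, B ≠ 0 → B ≠ ∞ → PosWeak d {t | ∃ k ∈ F, ∃ ν ∈ V, t = rad α k ν} q B →
      ∀ (f : Ed d → ℂ), Nice f → ∀ a : ℝ≥0∞, a ≠ 0 → a ≠ ∞ →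
      a ^ q * volume {x | ∃ k ∈ F, ∃ ν ∈ V, a < ‖sphMean d (rad α k ν) f x‖ₑ} ≤
      C * (B ^ (1 / (1 + q)) + 1) * ∫⁻ x, ‖f x‖ₑ ^ q := by
  have hd1 : 1 ≤ d := by omega
  obtain ⟨C₁, hC₁, h₁⟩ := exists_weak_sum_sphMean_bandP hd hα hq
  obtain ⟨C₂, hC₂, h₂⟩ := exists_weak_lowMaj (d := d) hd1 hq1
  refine ⟨3 ^ q * (C₁ + C₂), by finiteness, fun F V hV B hB0 hB hW f hf a ha0 ha => ?_⟩
  set l : ℝ≥0∞ := a / 3 with hl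
  have hl0 : l ≠ 0 := (ENNReal.div_pos ha0 (by norm_num)).ne'
  have hl1 : l ≠ ∞ := ENNReal.div_ne_top ha (by norm_num)
  have hal : a = 3 * l := by rw [hl, ENNReal.mul_div_cancel (by norm_num) (by norm_num)]
  set I := ∫⁻ x, ‖f x‖ₑ ^ q
  set b := B ^ (1 / (1 + q))
  set R : ℕ → ℝ≥0∞ := fun n => ∑ k ∈ F, ∑ ν ∈ V, ∫⁻ x, ‖f x - lowP (k - n) f x‖ₑ ^ 2 with hR
  have hR0 : Tendsto R atTop (𝓝 0) := by
    have h := tendsto_finsetSum F fun k _ => tendsto_finsetSum V fun ν _ =>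
      tendsto_lintegral_sub_lowP hf k
    simpa only [Finset.sum_const_zero] using h
  have main : ∀ n : ℕ, l ^ q * volume {x | ∃ k ∈ F, ∃ ν ∈ V, a < ‖sphMean d (rad α k ν) f x‖ₑ} ≤
      l ^ (q - 2) * R n + (C₂ * I + C₁ * (b + 1) * I) := by
    intro n
    set S : ℤ → ℕ → Set (Ed d) := fun k ν =>
      {x | l < posMean (rad α k ν) (fun x => ‖f x - lowP (k - n) f x‖ₑ) x}
    set S₀ : Set (Ed d) := {x | ∃ k ∈ F, ∃ ν ∈ V, x ∈ S k ν}
    set S₁ : Set (Ed d) := {x | ∃ k ∈ F, l < lowMaj k f x}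
    set S₂ : Set (Ed d) := {x | ∃ k ∈ F, ∃ ν ∈ V, l <
        ∑ i ∈ Finset.range n, ‖sphMean d (rad α k ν) (bandP (k - (i + 1 : ℕ)) f) x‖ₑ}
    have hsub : {x | ∃ k ∈ F, ∃ ν ∈ V, a < ‖sphMean d (rad α k ν) f x‖ₑ} ⊆ S₀ ∪ (S₁ ∪ S₂) := by
      rintro x ⟨k, hk, ν, hν, hx⟩
      by_contra hcon
      simp only [mem_union, not_or] at hcon
      have e0 : posMean (rad α k ν) (fun x => ‖f x - lowP (k - n) f x‖ₑ) x ≤ l :=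
        not_lt.1 fun h => hcon.1 ⟨k, hk, ν, hν, h⟩
      have e1 : lowMaj k f x ≤ l := not_lt.1 fun h => hcon.2.1 ⟨k, hk, h⟩
      have e2 : ∑ i ∈ Finset.range n,
          ‖sphMean d (rad α k ν) (bandP (k - (i + 1 : ℕ)) f) x‖ₑ ≤ l :=
        not_lt.1 fun h => hcon.2.2 ⟨k, hk, ν, hν, h⟩
      refine hx.not_ge ?_
      have hr : |rad α k ν| ≤ 2 * 2 ^ k := by
        rw [abs_of_nonneg ((zpow_nonneg zero_le_two k).trans (zpow_le_rad α k ν))]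
        exact rad_le hα k (hV ν hν)
      rw [sphMean_eq_sub_add hd1 hf (rad α k ν) k n x, hal]
      calc _ ≤ l + l + l := by
            refine (enorm_add_le _ _).trans (add_le_add ((enorm_add_le _ _).trans
              (add_le_add ?_ ?_)) ?_)
            · exact (enorm_sphMean_le_posMean _ _ x).trans e0
            · exact (enorm_sphMean_lowP_le hd1 hr f x).trans e1
            · exact (enorm_sum_le _ _).trans e2
        _ = 3 * l := by ring
    have hS₀ : l ^ q * volume S₀ ≤ l ^ (q - 2) * R n := by
      rw [show q = q - 2 + 2 by ring, ENNReal.rpow_add _ _ hl0 hl1, mul_assoc,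
        show q - 2 + 2 - 2 = q - 2 by ring]
      gcongr
      calc l ^ (2 : ℝ) * volume S₀ ≤ l ^ (2 : ℝ) * ∑ k ∈ F, ∑ ν ∈ V, volume (S k ν) := by
            gcongr
            exact (volume_exists_mem_le F fun k => {x | ∃ ν ∈ V, x ∈ S k ν}).trans
              (Finset.sum_le_sum fun k _ => volume_exists_mem_le V _)
        _ = ∑ k ∈ F, ∑ ν ∈ V, l ^ (2 : ℝ) * volume (S k ν) := by simp_rw [Finset.mul_sum]
        _ ≤ R n := by
            refine Finset.sum_le_sum fun k _ => Finset.sum_le_sum fun ν _ => ?_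
            have := rpow_mul_volume_posMean_le hd1 one_lt_two (rad α k ν) (s := l)
              (hf.sub (hf.lowP (k - n))).measurable.enorm
            simpa only [ENNReal.rpow_two] using this
    calc _ ≤ l ^ q * (volume S₀ + (volume S₁ + volume S₂)) := by
          gcongr
          exact (measure_mono hsub).trans ((measure_union_le _ _).trans
            (add_le_add le_rfl (measure_union_le _ _)))
      _ = l ^ q * volume S₀ + (l ^ q * volume S₁ + l ^ q * volume S₂) := by ring
      _ ≤ _ := add_le_add hS₀ (add_le_add (h₂ F f hf l hl0 hl1)
          (h₁ F V hV B hB0 hB hW f hf l hl0 hl1 n))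
  have hlim : Tendsto (fun n => l ^ (q - 2) * R n + (C₂ * I + C₁ * (b + 1) * I)) atTop
      (𝓝 (l ^ (q - 2) * 0 + (C₂ * I + C₁ * (b + 1) * I))) :=
    (ENNReal.Tendsto.const_mul hR0 (Or.inr (by finiteness))).add_const _
  have hfin := ge_of_tendsto' hlim main
  rw [mul_zero, zero_add] at hfin
  calc _ = 3 ^ q * (l ^ q *
        volume {x | ∃ k ∈ F, ∃ ν ∈ V, a < ‖sphMean d (rad α k ν) f x‖ₑ}) := by
        rw [← mul_assoc, ← ENNReal.mul_rpow_of_nonneg _ _ (by linarith), ← hal]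
    _ ≤ 3 ^ q * (C₂ * I + C₁ * (b + 1) * I) := by gcongr
    _ ≤ 3 ^ q * (C₂ * (b + 1) * I + C₁ * (b + 1) * I) := by
        gcongr
        exact le_mul_of_one_le_right' le_add_self
    _ = _ := by ring

/-- Bounded, compactly supported truncations. -/
def truncFn (h : Ed d → ℝ≥0∞) (n : ℕ) : Ed d → ℝ≥0∞ :=
  (closedBall 0 n).indicator fun x => min (h x) n

theorem measurable_truncFn {h : Ed d → ℝ≥0∞} (hh : Measurable h) (n : ℕ) :
    Measurable (truncFn h n) :=
  (hh.min measurable_const).indicator measurableSet_closedBall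

theorem truncFn_le (h : Ed d → ℝ≥0∞) (n : ℕ) (x : Ed d) : truncFn h n x ≤ h x :=
  indicator_apply_le' (fun _ => min_le_left _ _) fun _ => zero_le

theorem truncFn_le_natCast (h : Ed d → ℝ≥0∞) (n : ℕ) (x : Ed d) : truncFn h n x ≤ n :=
  indicator_apply_le' (fun _ => min_le_right _ _) fun _ => zero_le

theorem monotone_truncFn (h : Ed d → ℝ≥0∞) : Monotone (truncFn h) := by
  intro m n hmn x
  have hc : (m : ℝ≥0∞) ≤ n := by exact_mod_cast hmn
  have hr : (m : ℝ) ≤ n := by exact_mod_cast hmn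
  refine (indicator_le_indicator_of_subset (closedBall_subset_closedBall hr)
    (fun _ => zero_le) x).trans ?_
  exact Set.indicator_mono (fun x => min_le_min_left (h x) hc) x

theorem iSup_truncFn (h : Ed d → ℝ≥0∞) (x : Ed d) : ⨆ n, truncFn h n x = h x := by
  refine le_antisymm (iSup_le fun n => truncFn_le h n x) ?_
  refine le_of_forall_lt fun c hc => ?_
  obtain ⟨n, hn⟩ := ENNReal.exists_nat_gt hc.ne_top
  obtain ⟨m, hm⟩ := exists_nat_ge ‖x‖
  refine lt_of_lt_of_le ?_ (le_iSup _ (max m n))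
  have hx : x ∈ closedBall (0 : Ed d) (max m n : ℕ) := by
    rw [mem_closedBall_zero_iff]
    exact hm.trans (by exact_mod_cast le_max_left m n)
  rw [truncFn, indicator_of_mem hx]
  refine lt_min hc (hn.trans_le (by exact_mod_cast le_max_right m n))

theorem measurable_sub_smul_coe (t : ℝ) (x : Ed d) :
    Measurable fun y : sphere (0 : Ed d) 1 => x - t • (y : Ed d) := by
  fun_prop

theorem posMean_eq_iSup_truncFn (t : ℝ) {h : Ed d → ℝ≥0∞} (hh : Measurable h) (x : Ed d) :
    posMean t h x = ⨆ n, posMean t (truncFn h n) x := by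
  unfold posMean
  rw [← lintegral_iSup (f := fun n (y : sphere (0 : Ed d) 1) => truncFn h n (x - t • (y : Ed d)))
    (fun n => (measurable_truncFn hh n).comp (measurable_sub_smul_coe t x))
    fun m n hmn y => monotone_truncFn h hmn _]
  simp_rw [iSup_truncFn]

theorem nice_toReal_truncFn {h : Ed d → ℝ≥0∞} (hh : Measurable h) (n : ℕ) :
    Nice fun x => ((truncFn h n x).toReal : ℂ) := by
  have hm : Measurable fun x => ((truncFn h n x).toReal : ℂ) :=
    Complex.measurable_ofReal.comp (measurable_truncFn hh n).ennreal_toReal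
  have hb : ∀ x, ‖((truncFn h n x).toReal : ℂ)‖ ≤ n := fun x => by
    rw [Complex.norm_real, Real.norm_of_nonneg ENNReal.toReal_nonneg]
    exact ENNReal.toReal_le_of_le_ofReal (by positivity) (by simpa using truncFn_le_natCast h n x)
  refine ⟨hm, ?_, n, hb⟩
  refine IntegrableOn.integrable_of_forall_notMem_eq_zero (s := closedBall 0 n)
    (Measure.integrableOn_of_bounded (M := n) measure_closedBall_lt_top.ne hm.aestronglyMeasurable
      (ae_of_all _ hb)) fun x hx => ?_
  simp [truncFn, indicator_of_notMem hx]

theorem enorm_sphMean_toReal_truncFn (hd : 1 ≤ d) {h : Ed d → ℝ≥0∞} (hh : Measurable h) (n : ℕ)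
    (t : ℝ) (x : Ed d) :
    ‖sphMean d t (fun x => ((truncFn h n x).toReal : ℂ)) x‖ₑ = posMean t (truncFn h n) x := by
  have := isProbabilityMeasure_sphereProb hd
  have hm : Measurable fun y : sphere (0 : Ed d) 1 => truncFn h n (x - t • (y : Ed d)) :=
    (measurable_truncFn hh n).comp (by fun_prop)
  have hlt : ∀ x, truncFn h n x < ∞ := fun x =>
    (truncFn_le_natCast h n x).trans_lt (ENNReal.natCast_lt_top n)
  unfold sphMean posMean
  rw [integral_complex_ofReal, integral_toReal hm.aemeasurable (ae_of_all _ fun y => hlt _),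
    ← ofReal_norm, Complex.norm_real, Real.norm_of_nonneg ENNReal.toReal_nonneg,
    ENNReal.ofReal_toReal]
  refine ne_top_of_le_ne_top (b := (n : ℝ≥0∞)) (by finiteness) ?_
  calc _ ≤ ∫⁻ _y : sphere (0 : Ed d) 1, (n : ℝ≥0∞) ∂(sphereProb d) :=
        lintegral_mono fun y => truncFn_le_natCast h n _
    _ = n := by simp

theorem posWeak_of_nice (hd : 1 ≤ d) {I : Set ℝ} {q : ℝ} (hq : 0 ≤ q) {B : ℝ≥0∞}
    (hB : ∀ (f : Ed d → ℂ), Nice f → ∀ a : ℝ≥0∞, a ≠ 0 → a ≠ ∞ →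
      a ^ q * volume {x | ∃ t ∈ I, a < ‖sphMean d t f x‖ₑ} ≤ B * ∫⁻ x, ‖f x‖ₑ ^ q) :
    PosWeak d I q B := by
  intro h hh s hs0 hs
  have hset : {x | ∃ t ∈ I, s < posMean t h x} =
      ⋃ n, {x | ∃ t ∈ I, s < posMean t (truncFn h n) x} := by
    ext x
    simp only [mem_ofPred_eq, mem_iUnion, posMean_eq_iSup_truncFn _ hh, lt_iSup_iff]
    exact ⟨fun ⟨t, ht, n, hn⟩ => ⟨n, t, ht, hn⟩, fun ⟨n, t, ht, hn⟩ => ⟨t, ht, n, hn⟩⟩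
  have hmono : Monotone fun n => {x | ∃ t ∈ I, s < posMean t (truncFn h n) x} := by
    rintro m n hmn x ⟨t, ht, hx⟩
    exact ⟨t, ht, hx.trans_le (posMean_mono (monotone_truncFn h hmn) x)⟩
  rw [hset, hmono.measure_iUnion, ENNReal.mul_iSup]
  refine iSup_le fun n => ?_
  have := hB _ (nice_toReal_truncFn hh n) s hs0 hs
  simp_rw [enorm_sphMean_toReal_truncFn hd hh] at this
  refine this.trans ?_
  gcongr with x
  rw [← ofReal_norm, Complex.norm_real, Real.norm_of_nonneg ENNReal.toReal_nonneg]
  exact ENNReal.ofReal_toReal_le.trans (truncFn_le h n x)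

end

section

variable {d : ℕ}

theorem PosWeak.mono {I : Set ℝ} {q : ℝ} {B B' : ℝ≥0∞} (h : PosWeak d I q B) (hB : B ≤ B') :
    PosWeak d I q B' := fun g hg s hs0 hs =>
  (h g hg s hs0 hs).trans (by gcongr)

theorem le_of_le_mul_rpow_half {b C : ℝ≥0∞} (hb0 : b ≠ 0) (hb : b ≠ ∞)
    (h : b ≤ C * b ^ (1 / 2 : ℝ)) : b ≤ C ^ 2 := by
  have h1 : b = b ^ (1 / 2 : ℝ) * b ^ (1 / 2 : ℝ) := by
    rw [← ENNReal.rpow_add _ _ hb0 hb]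
    norm_num
  have h2 : b ^ (1 / 2 : ℝ) ≤ C := by
    exact (ENNReal.mul_le_mul_iff_left (by simp [hb0, hb]) (by simp [hb0, hb])).1 (h1.ge.trans h)
  rw [h1, sq]
  gcongr

/-- A weak type constant that can be improved sublinearly is bounded. -/
theorem exists_posWeak_of_bootstrap {I : Set ℝ} {q θ : ℝ} {B₀ C : ℝ≥0∞} (hθ : θ ≤ 1 / 2)
    (h₀ : PosWeak d I q B₀) (hB₀ : B₀ ≠ ∞)
    (hstep : ∀ B, B ≠ 0 → B ≠ ∞ → PosWeak d I q B → PosWeak d I q (C * (B ^ θ + 1)))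
    (hC : C ≠ ∞) : PosWeak d I q (2 * (4 * (C + 1)) ^ 2) := by
  set A : Set ℝ≥0∞ := {B | 1 ≤ B ∧ B ≠ ∞ ∧ PosWeak d I q B} with hA
  have hA₀ : max 1 B₀ ∈ A := ⟨le_max_left _ _, by finiteness, h₀.mono (le_max_right _ _)⟩
  set b := sInf A with hb
  have hb1 : 1 ≤ b := le_sInf fun B hB => hB.1
  have hb0 : b ≠ 0 := (zero_lt_one.trans_le hb1).ne'
  have hbt : b ≠ ∞ := ne_top_of_le_ne_top hA₀.2.1 (sInf_le hA₀)
  obtain ⟨B, hBA, hBb⟩ := sInf_lt_iff.1 (show sInf A < 2 * b by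
    rw [← hb, two_mul]
    exact ENNReal.lt_add_right hbt hb0)
  have hB0 : B ≠ 0 := (zero_lt_one.trans_le hBA.1).ne'
  have hone : 1 ≤ b ^ (1 / 2 : ℝ) := ENNReal.one_le_rpow hb1 (by norm_num)
  have hle : b ≤ (C + 1) * (B ^ θ + 1) := by
    refine sInf_le ⟨?_, ?_, (hstep B hB0 hBA.2.1 hBA.2.2).mono (by gcongr; exact le_self_add)⟩
    · exact one_le_mul le_add_self le_add_self
    · have := hBA.2.1
      finiteness
  have hBθ : B ^ θ ≤ 2 * b ^ (1 / 2 : ℝ) := by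
    calc B ^ θ ≤ B ^ (1 / 2 : ℝ) := ENNReal.rpow_le_rpow_of_exponent_le hBA.1 hθ
      _ ≤ (2 * b) ^ (1 / 2 : ℝ) := ENNReal.rpow_le_rpow hBb.le (by norm_num)
      _ = 2 ^ (1 / 2 : ℝ) * b ^ (1 / 2 : ℝ) := ENNReal.mul_rpow_of_nonneg _ _ (by norm_num)
      _ ≤ 2 ^ (1 : ℝ) * b ^ (1 / 2 : ℝ) := by
          gcongr
          · norm_num
          · norm_num
      _ = _ := by rw [ENNReal.rpow_one]
  have hfin : b ≤ (4 * (C + 1)) ^ 2 := by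
    refine le_of_le_mul_rpow_half hb0 hbt ?_
    calc b ≤ (C + 1) * (B ^ θ + 1) := hle
      _ ≤ (C + 1) * (2 * b ^ (1 / 2 : ℝ) + 2 * b ^ (1 / 2 : ℝ)) := by
          gcongr
          exact hone.trans (le_mul_of_one_le_left' one_le_two)
      _ = _ := by ring
  exact hBA.2.2.mono (hBb.le.trans (by gcongr))

/-- The set of radii `2 ^ k * (1 + ν ^ (-α))`. -/
def radSet (α : ℝ) : Set ℝ := {t | ∃ k : ℤ, ∃ ν : ℕ, 1 ≤ ν ∧ t = rad α k ν}

theorem exists_posWeak_radSet (hd : 2 ≤ d) {α : ℝ} (hα : 0 < α) {q : ℝ}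
    (hq : q = 1 + 1 / (((d : ℝ) - 1) * (α + 1))) :
    ∃ M : ℝ≥0∞, M ≠ ∞ ∧ PosWeak d (radSet α) q M := by
  have hd1 : (1 : ℝ) ≤ (d : ℝ) - 1 := by
    have : (2 : ℝ) ≤ d := by exact_mod_cast hd
    linarith
  have hq1 : 1 < q := by rw [hq]; linarith [show 0 < 1 / (((d : ℝ) - 1) * (α + 1)) by positivity]
  obtain ⟨C, hC, h⟩ := exists_weak_sphMean hd hα hq hq1.le
  have hfin : ∀ n : ℕ, PosWeak d
      {t | ∃ k ∈ Finset.Icc (-n : ℤ) n, ∃ ν ∈ Finset.Icc 1 n, t = rad α k ν} q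
      (2 * (4 * (C + 1)) ^ 2) := by
    intro n
    refine exists_posWeak_of_bootstrap (θ := 1 / (1 + q))
      (one_div_le_one_div_of_le two_pos (by linarith)) (posWeak_card (by omega) α _ _ hq1)
      (by finiteness) (fun B hB0 hB hW => ?_) hC
    refine posWeak_of_nice (by omega) (by linarith) fun f hf a ha0 ha => ?_
    refine le_trans (le_of_eq ?_) (h (Finset.Icc (-n : ℤ) n) (Finset.Icc 1 n)
      (fun ν hν => (Finset.mem_Icc.1 hν).1) B hB0 hB hW f hf a ha0 ha)
    congr 2
    ext x
    constructor
    · rintro ⟨t, ⟨k, hk, ν, hν, rfl⟩, hx⟩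
      exact ⟨k, hk, ν, hν, hx⟩
    · rintro ⟨k, hk, ν, hν, hx⟩
      exact ⟨_, ⟨k, hk, ν, hν, rfl⟩, hx⟩
  refine ⟨2 * (4 * (C + 1)) ^ 2, by finiteness, fun g hg s hs0 hs => ?_⟩
  have hset : {x | ∃ t ∈ radSet α, s < posMean t g x} = ⋃ n : ℕ, {x | ∃ t ∈
      {t | ∃ k ∈ Finset.Icc (-n : ℤ) n, ∃ ν ∈ Finset.Icc 1 n, t = rad α k ν},
      s < posMean t g x} := by
    ext x
    simp only [mem_iUnion]
    constructor
    · rintro ⟨t, ⟨k, ν, hν, rfl⟩, hx⟩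
      refine ⟨max k.natAbs ν, _, ⟨k, ?_, ν, ?_, rfl⟩, hx⟩
      · rw [Finset.mem_Icc]
        omega
      · rw [Finset.mem_Icc]
        omega
    · rintro ⟨n, t, ⟨k, hk, ν, hν, rfl⟩, hx⟩
      exact ⟨_, ⟨k, ν, (Finset.mem_Icc.1 hν).1, rfl⟩, hx⟩
  have hmono : Monotone fun n : ℕ => {x | ∃ t ∈
      {t | ∃ k ∈ Finset.Icc (-n : ℤ) n, ∃ ν ∈ Finset.Icc 1 n, t = rad α k ν},
      s < posMean t g x} := by
    rintro m n hmn x ⟨t, ⟨k, hk, ν, hν, rfl⟩, hx⟩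
    rw [Finset.mem_Icc] at hk hν
    refine ⟨_, ⟨k, ?_, ν, ?_, rfl⟩, hx⟩
    · rw [Finset.mem_Icc]
      omega
    · rw [Finset.mem_Icc]
      omega
  rw [hset, hmono.measure_iUnion, ENNReal.mul_iSup]
  exact iSup_le fun n => hfin n g hg s hs0 hs

theorem PosWeak.exponent_mono (hd : 1 ≤ d) {I : Set ℝ} {q p : ℝ} (hq : 0 < q) (hqp : q ≤ p)
    {B : ℝ≥0∞} (h : PosWeak d I q B) : PosWeak d I p (2 ^ p * B) := by
  have := isProbabilityMeasure_sphereProb hd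
  intro g hg s hs0 hs
  have hl0 : s / 2 ≠ 0 := (ENNReal.div_pos hs0 (by norm_num)).ne'
  have hl : s / 2 ≠ ∞ := ENNReal.div_ne_top hs (by norm_num)
  set l := s / 2 with hls
  have hsl : s = 2 * l := by rw [hls, ENNReal.mul_div_cancel (by norm_num) (by norm_num)]
  set g₁ : Ed d → ℝ≥0∞ := {x | l < g x}.indicator g with hg₁
  have hms : MeasurableSet {x | l < g x} := measurableSet_lt measurable_const hg
  have hg₁m : Measurable g₁ := hg.indicator hms
  have hsub : {x | ∃ t ∈ I, s < posMean t g x} ⊆ {x | ∃ t ∈ I, l < posMean t g₁ x} := by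
    rintro x ⟨t, ht, hx⟩
    refine ⟨t, ht, ?_⟩
    by_contra hcon
    refine hx.not_ge ?_
    calc posMean t g x ≤ posMean t (fun x => 1 * g₁ x + l * 1) x := by
          refine posMean_mono (fun y => ?_) x
          by_cases hy : l < g y
          · simp [hg₁, hy]
          · simp [hg₁, hy, not_lt.1 hy]
      _ = 1 * posMean t g₁ x + l * posMean t (fun _ => 1) x :=
          posMean_mul_add_mul t hg₁m measurable_const _ _ x
      _ = posMean t g₁ x + l := by simp [posMean]
      _ ≤ l + l := by gcongr; exact not_lt.1 hcon
      _ = s := by rw [hsl, two_mul]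
  have hInt : l ^ (p - q) * ∫⁻ x, g₁ x ^ q ≤ ∫⁻ x, g x ^ p := by
    rw [← lintegral_const_mul _ (hg₁m.pow_const q)]
    refine lintegral_mono fun x => ?_
    by_cases hx : l < g x
    · have hgx : g x ≠ 0 := (hx.trans_le' zero_le).ne'
      simp only [hg₁, indicator_of_mem (show x ∈ {x | l < g x} from hx)]
      rcases eq_or_ne (g x) ∞ with htop | htop
      · rw [htop, ENNReal.top_rpow_of_pos (y := p) (by linarith)]
        exact le_top
      calc l ^ (p - q) * g x ^ q ≤ g x ^ (p - q) * g x ^ q := by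
            gcongr
        _ = g x ^ p := by rw [← ENNReal.rpow_add _ _ hgx htop, sub_add_cancel]
    · simp [hg₁, hx, hq]
  calc s ^ p * volume {x | ∃ t ∈ I, s < posMean t g x}
      ≤ s ^ p * volume {x | ∃ t ∈ I, l < posMean t g₁ x} := by gcongr
    _ = 2 ^ p * (l ^ (p - q) * (l ^ q * volume {x | ∃ t ∈ I, l < posMean t g₁ x})) := by
        rw [← mul_assoc (l ^ (p - q)), ← ENNReal.rpow_add _ _ hl0 hl, sub_add_cancel, ← mul_assoc,
          ← ENNReal.mul_rpow_of_nonneg _ _ (by linarith), hsl]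
    _ ≤ 2 ^ p * (l ^ (p - q) * (B * ∫⁻ x, g₁ x ^ q)) := by
        exact mul_le_mul_right (mul_le_mul_right (h g₁ hg₁m l hl0 hl) _) _
    _ = 2 ^ p * B * (l ^ (p - q) * ∫⁻ x, g₁ x ^ q) := by ring
    _ ≤ 2 ^ p * B * ∫⁻ x, g x ^ p := by gcongr

theorem weakTypePP_of_posWeak {I : Set ℝ} {p : ℝ} (hp : 0 < p) {B : ℝ≥0∞} (hB : B ≠ ∞)
    (h : PosWeak d I p B) : WeakTypePP d I p := by
  refine ⟨B.toReal, fun f hf hfc a ha => ?_⟩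
  have ha0 : ENNReal.ofReal a ≠ 0 := (ENNReal.ofReal_pos.2 ha).ne'
  have hInt : Integrable fun x => ‖f x‖ ^ p :=
    (hf.norm.rpow_const fun _ => Or.inr hp.le).integrable_of_hasCompactSupport
      (hfc.comp_left (g := fun z : ℂ => ‖z‖ ^ p) (by simp [hp.ne']))
  have hI : ENNReal.ofReal (∫ x, ‖f x‖ ^ p) = ∫⁻ x, ‖f x‖ₑ ^ p := by
    rw [ofReal_integral_eq_lintegral_ofReal hInt (ae_of_all _ fun x => by positivity)]
    refine lintegral_congr fun x => ?_
    rw [← ofReal_norm, ENNReal.ofReal_rpow_of_nonneg (norm_nonneg _) hp.le]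
  have hsub : {x | ENNReal.ofReal a < maxFn d I f x} ⊆
      {x | ∃ t ∈ I, ENNReal.ofReal a < posMean t (fun x => ‖f x‖ₑ) x} := by
    intro x hx
    simp only [mem_ofPred_eq, maxFn, lt_iSup_iff] at hx
    obtain ⟨t, ht, hx⟩ := hx
    exact ⟨t, ht, hx.trans_le (enorm_sphMean_le_posMean t f x)⟩
  calc volume {x | ENNReal.ofReal a < maxFn d I f x}
      ≤ ENNReal.ofReal a ^ (-p) * (B * ∫⁻ x, ‖f x‖ₑ ^ p) :=
        (measure_mono hsub).trans (le_rpow_neg_mul ha0 ENNReal.ofReal_ne_top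
          (h _ hf.measurable.enorm _ ha0 ENNReal.ofReal_ne_top))
    _ = _ := by
        rw [ENNReal.ofReal_rpow_of_pos ha, ← hI, ENNReal.ofReal_mul (by positivity),
          ENNReal.ofReal_mul ENNReal.toReal_nonneg, ENNReal.ofReal_toReal hB]
        ring

end

section

open scoped Pointwise
variable {d : ℕ}

theorem ball_subset_cone {u : Ed d} (hu : ‖u‖ = 1) {r s : ℝ} (h1 : 1 / 2 + s ≤ r) (h2 : r + s ≤ 1) :
    ball (r • u) s ⊆ Ioo (0 : ℝ) 1 • ((↑) '' {y : sphere (0 : Ed d) 1 | ‖(y : Ed d) - u‖ ≤ 4 * s}) := by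
  intro z hz
  rw [mem_ball_iff_norm] at hz
  have hs : 0 < s := (norm_nonneg _).trans_lt hz
  have hr : ‖r • u‖ = r := by rw [norm_smul, hu, mul_one, Real.norm_of_nonneg (by linarith)]
  have habs : |‖z‖ - r| < s := by
    have := abs_norm_sub_norm_le z (r • u)
    rw [hr] at this
    linarith
  obtain ⟨ha, hb⟩ := abs_lt.1 habs
  have hz2 : 1 / 2 < ‖z‖ := by linarith
  have hz0 : ‖z‖ ≠ 0 := by linarith
  have hmem : ‖z‖⁻¹ • z ∈ sphere (0 : Ed d) 1 := by
    rw [mem_sphere_zero_iff_norm, norm_smul, norm_inv, norm_norm, inv_mul_cancel₀ hz0]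
  refine Set.mem_smul.2 ⟨‖z‖, ⟨by linarith, by linarith⟩, ‖z‖⁻¹ • z, ⟨⟨_, hmem⟩, ?_, rfl⟩, ?_⟩
  · have e : ‖z‖⁻¹ • z - u = ‖z‖⁻¹ • ((z - r • u) + (r - ‖z‖) • u) := by
      rw [sub_smul, sub_add_sub_cancel, smul_sub, smul_smul, inv_mul_cancel₀ hz0, one_smul]
    change ‖‖z‖⁻¹ • z - u‖ ≤ 4 * s
    rw [e, norm_smul, norm_inv, norm_norm]
    have h3 : ‖(z - r • u) + (r - ‖z‖) • u‖ ≤ 2 * s := by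
      refine (norm_add_le _ _).trans ?_
      rw [norm_smul, hu, mul_one, Real.norm_eq_abs, abs_sub_comm]
      linarith
    rw [inv_mul_le_iff₀ (by linarith)]
    nlinarith
  · rw [smul_smul, mul_inv_cancel₀ hz0, one_smul]

theorem exists_le_sphereProb_cap (hd : 1 ≤ d) : ∃ c : ℝ, 0 < c ∧ ∀ u : Ed d, ‖u‖ = 1 →
    ∀ ρ : ℝ, 0 < ρ → ρ ≤ 1 / 2 → ENNReal.ofReal (c * ρ ^ (d - 1)) ≤
      sphereProb d {y : sphere (0 : Ed d) 1 | ‖(y : Ed d) - u‖ ≤ ρ} := by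
  have hne : Nonempty (Fin d) := ⟨⟨0, hd⟩⟩
  set T : ℝ≥0∞ := (volume : Measure (Ed d)).toSphere univ with hT
  have hT' : T ≠ ∞ := measure_ne_top _ _
  have hTv : T = d * volume (ball (0 : Ed d) 1) := by
    rw [hT, Measure.toSphere_apply_univ]
    simp
  have hT0 : T ≠ 0 := by
    rw [hTv]
    refine mul_ne_zero (by exact_mod_cast (by omega : d ≠ 0)) ?_
    exact (measure_ball_pos _ _ one_pos).ne'
  refine ⟨(1 / 8) * (1 / 4) ^ (d - 1), by positivity, fun u hu ρ hρ hρ1 => ?_⟩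
  set s := ρ / 4 with hs
  have hs0 : 0 < s := by positivity
  set J := ⌊1 / (4 * s)⌋₊ with hJ
  have hJ1 : (J : ℝ) * (4 * s) ≤ 1 := by
    have := Nat.floor_le (show 0 ≤ 1 / (4 * s) by positivity)
    rwa [le_div_iff₀ (by positivity)] at this
  have hJ2 : 1 / 8 ≤ J * s := by
    have := Nat.lt_floor_add_one (1 / (4 * s))
    rw [div_lt_iff₀ (by positivity)] at this
    change 1 < ((J : ℝ) + 1) * (4 * s) at this
    nlinarith
  have hsub : (⋃ j ∈ Finset.range J, ball ((1 / 2 + (2 * j + 1) * s) • u) s) ⊆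
      Ioo (0 : ℝ) 1 • ((↑) '' {y : sphere (0 : Ed d) 1 | ‖(y : Ed d) - u‖ ≤ ρ}) := by
    refine iUnion₂_subset fun j hj => ?_
    have hj' : (j : ℝ) + 1 ≤ J := by exact_mod_cast Finset.mem_range.1 hj
    have := ball_subset_cone hu (r := 1 / 2 + (2 * j + 1) * s) (s := s)
      (by nlinarith [show (0 : ℝ) ≤ j * s by positivity]) (by nlinarith)
    rwa [show 4 * s = ρ by rw [hs]; ring] at this
  have hdisj : (Finset.range J : Set ℕ).PairwiseDisjoint
      fun j : ℕ => ball ((1 / 2 + (2 * j + 1) * s) • u) s := by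
    intro i _ j _ hij
    refine ball_disjoint_ball ?_
    rw [dist_eq_norm, ← sub_smul, norm_smul, hu, mul_one, Real.norm_eq_abs,
      show 1 / 2 + (2 * (i : ℝ) + 1) * s - (1 / 2 + (2 * (j : ℝ) + 1) * s) =
        2 * s * ((i : ℝ) - j) by ring, abs_mul, abs_of_pos (by positivity : 0 < 2 * s)]
    have h1 : (1 : ℝ) ≤ |(i : ℝ) - j| := by
      have : (1 : ℤ) ≤ |(i : ℤ) - j| := Int.one_le_abs (by omega)
      exact_mod_cast this
    nlinarith
  have hvol : ENNReal.ofReal (J * s ^ d) * volume (ball (0 : Ed d) 1) ≤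
      volume (Ioo (0 : ℝ) 1 • (Subtype.val '' {y : sphere (0 : Ed d) 1 | ‖(y : Ed d) - u‖ ≤ ρ})) := by
    refine le_trans (le_of_eq ?_) (measure_mono hsub)
    rw [measure_biUnion_finset hdisj fun _ _ => measurableSet_ball]
    simp_rw [Measure.addHaar_ball _ _ hs0.le]
    simp [ENNReal.ofReal_mul, mul_assoc]
  have hms : MeasurableSet {y : sphere (0 : Ed d) 1 | ‖(y : Ed d) - u‖ ≤ ρ} :=
    measurableSet_le (by fun_prop) measurable_const
  have hmain : ENNReal.ofReal (J * s ^ d) ≤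
      sphereProb d {y : sphere (0 : Ed d) 1 | ‖(y : Ed d) - u‖ ≤ ρ} := by
    rw [sphereProb, Measure.smul_apply, smul_eq_mul, Measure.toSphere_apply' _ hms,
      finrank_euclideanSpace_fin]
    calc ENNReal.ofReal (J * s ^ d) = T⁻¹ * (T * ENNReal.ofReal (J * s ^ d)) := by
          rw [← mul_assoc, ENNReal.inv_mul_cancel hT0 hT', one_mul]
      _ = T⁻¹ * (d * (ENNReal.ofReal (J * s ^ d) * volume (ball (0 : Ed d) 1))) := by
          rw [mul_left_comm (d : ℝ≥0∞), ← hTv, mul_comm T]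
      _ ≤ _ := by gcongr
  refine le_trans (ENNReal.ofReal_le_ofReal ?_) hmain
  calc 1 / 8 * (1 / 4) ^ (d - 1) * ρ ^ (d - 1) = 1 / 8 * s ^ (d - 1) := by
        rw [hs, div_pow, div_pow]
        ring
    _ ≤ J * s * s ^ (d - 1) := by gcongr
    _ = J * s ^ d := by
        rw [mul_assoc, ← pow_succ', Nat.sub_add_cancel hd]

end

section

variable {d : ℕ}

/-- A continuous bump equal to `1` on the ball of radius `2 * η` and supported in the ball of radius
`4 * η`. -/
def plateau (d : ℕ) (η : ℝ) (y : Ed d) : ℝ := max 0 (min 1 (2 - ‖y‖ / (2 * η)))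

theorem continuous_plateau (η : ℝ) : Continuous (plateau d η) := by
  unfold plateau
  fun_prop

theorem plateau_nonneg (η : ℝ) (y : Ed d) : 0 ≤ plateau d η y := le_max_left _ _

theorem plateau_le_one (η : ℝ) (y : Ed d) : plateau d η y ≤ 1 :=
  max_le zero_le_one (min_le_left _ _)

theorem plateau_eq_one {η : ℝ} (hη : 0 < η) {y : Ed d} (hy : ‖y‖ ≤ 2 * η) : plateau d η y = 1 := by
  have : ‖y‖ / (2 * η) ≤ 1 := div_le_one_of_le₀ hy (by positivity)
  rw [plateau, min_eq_left (by linarith), max_eq_right zero_le_one]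

theorem plateau_eq_zero {η : ℝ} (hη : 0 < η) {y : Ed d} (hy : y ∉ closedBall 0 (4 * η)) :
    plateau d η y = 0 := by
  rw [mem_closedBall_zero_iff, not_le] at hy
  have : 2 ≤ ‖y‖ / (2 * η) := by
    rw [le_div_iff₀ (by positivity)]
    linarith
  exact max_eq_left ((min_le_right _ _).trans (by linarith))

theorem hasCompactSupport_plateau {η : ℝ} (hη : 0 < η) :
    HasCompactSupport fun y : Ed d => (plateau d η y : ℂ) :=
  HasCompactSupport.intro (isCompact_closedBall 0 (4 * η)) fun y hy => by
    simp [plateau_eq_zero hη hy]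

theorem integral_plateau_rpow_le {η p : ℝ} (hη : 0 < η) (hp : 0 < p) :
    ∫ y : Ed d, ‖(plateau d η y : ℂ)‖ ^ p ≤ (4 * η) ^ d * volume.real (ball (0 : Ed d) 1) := by
  have h0 : ∀ y : Ed d, ‖(plateau d η y : ℂ)‖ = plateau d η y := fun y => by
    rw [Complex.norm_real, Real.norm_of_nonneg (plateau_nonneg η y)]
  calc ∫ y : Ed d, ‖(plateau d η y : ℂ)‖ ^ p
      ≤ ∫ y : Ed d, (closedBall (0 : Ed d) (4 * η)).indicator (fun _ => (1 : ℝ)) y := by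
        refine integral_mono_of_nonneg (ae_of_all _ fun y => by positivity)
          ((integrable_indicator_iff measurableSet_closedBall).2
            (integrableOn_const measure_closedBall_lt_top.ne)) (ae_of_all _ fun y => ?_)
        simp only [h0]
        by_cases hy : y ∈ closedBall (0 : Ed d) (4 * η)
        · rw [indicator_of_mem hy]
          exact Real.rpow_le_one (plateau_nonneg η y) (plateau_le_one η y) hp.le
        · rw [indicator_of_notMem hy, plateau_eq_zero hη hy, Real.zero_rpow hp.ne']
    _ = volume.real (closedBall (0 : Ed d) (4 * η)) := by
        rw [integral_indicator measurableSet_closedBall]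
        simp
    _ = _ := by
        rw [Measure.real, Measure.addHaar_closedBall _ _ (by positivity), ENNReal.toReal_mul,
          ENNReal.toReal_ofReal (by positivity), finrank_euclideanSpace_fin, Measure.real]

theorem exists_le_sphMean_plateau (hd : 1 ≤ d) : ∃ c : ℝ, 0 < c ∧ ∀ η : ℝ, 0 < η → η ≤ 1 →
    ∀ (x : Ed d) (t : ℝ), 1 ≤ ‖x‖ → ‖x‖ ≤ 2 → |‖x‖ - t| ≤ η →
      ENNReal.ofReal (c * η ^ (d - 1)) ≤ ‖sphMean d t (fun y => (plateau d η y : ℂ)) x‖ₑ := by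
  have := isProbabilityMeasure_sphereProb hd
  obtain ⟨c, hc, h⟩ := exists_le_sphereProb_cap hd
  refine ⟨c * (1 / 2) ^ (d - 1), by positivity, fun η hη hη1 x t hx1 hx2 hxt => ?_⟩
  have hx0 : ‖x‖ ≠ 0 := by linarith
  have hu : ‖‖x‖⁻¹ • x‖ = 1 := by rw [norm_smul, norm_inv, norm_norm, inv_mul_cancel₀ hx0]
  have hcap := h _ hu (η / 2) (by positivity) (by linarith)
  set S : Set (sphere (0 : Ed d) 1) := {y | ‖(y : Ed d) - ‖x‖⁻¹ • x‖ ≤ η / 2} with hS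
  have hSm : MeasurableSet S := measurableSet_le (by fun_prop) measurable_const
  have hone : ∀ y ∈ S, plateau d η (x - t • (y : Ed d)) = 1 := by
    intro y hy
    refine plateau_eq_one hη ?_
    have e : x - t • (y : Ed d) = (‖x‖ - t) • (y : Ed d) - ‖x‖ • ((y : Ed d) - ‖x‖⁻¹ • x) := by
      rw [smul_sub, smul_smul, mul_inv_cancel₀ hx0, one_smul, sub_smul]
      abel
    rw [e]
    refine (norm_sub_le _ _).trans ?_
    rw [norm_smul, norm_smul, norm_eq_of_mem_sphere, norm_norm, Real.norm_eq_abs]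
    have hy' : ‖(y : Ed d) - ‖x‖⁻¹ • x‖ ≤ η / 2 := hy
    nlinarith [norm_nonneg ((y : Ed d) - ‖x‖⁻¹ • x)]
  have hcont : Continuous fun y : sphere (0 : Ed d) 1 => plateau d η (x - t • (y : Ed d)) :=
    (continuous_plateau η).comp (by fun_prop)
  have hInt : Integrable (fun y : sphere (0 : Ed d) 1 => plateau d η (x - t • (y : Ed d)))
      (sphereProb d) :=
    (integrable_const (1 : ℝ)).mono' hcont.aestronglyMeasurable (ae_of_all _ fun y => by
      rw [Real.norm_of_nonneg (plateau_nonneg η _)]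
      exact plateau_le_one η _)
  have hval : ‖sphMean d t (fun y => (plateau d η y : ℂ)) x‖ₑ =
      ∫⁻ y : sphere (0 : Ed d) 1, ENNReal.ofReal (plateau d η (x - t • (y : Ed d)))
        ∂(sphereProb d) := by
    rw [sphMean, integral_complex_ofReal, ← ofReal_norm, Complex.norm_real,
      Real.norm_of_nonneg (integral_nonneg fun y => plateau_nonneg η _),
      ofReal_integral_eq_lintegral_ofReal hInt (ae_of_all _ fun y => plateau_nonneg η _)]
  rw [hval]
  calc ENNReal.ofReal (c * (1 / 2) ^ (d - 1) * η ^ (d - 1))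
      = ENNReal.ofReal (c * (η / 2) ^ (d - 1)) := by
        rw [div_eq_mul_one_div η, mul_pow]
        ring_nf
    _ ≤ sphereProb d S := hcap
    _ = ∫⁻ y, S.indicator (fun _ => (1 : ℝ≥0∞)) y ∂(sphereProb d) := by
        rw [lintegral_indicator hSm]
        simp
    _ ≤ _ := by
        refine lintegral_mono fun y => indicator_apply_le' (fun hy => ?_) fun _ => zero_le
        rw [hone y hy, ENNReal.ofReal_one]

theorem rpow_neg_sub_succ_le {α : ℝ} (hα : 0 < α) {m : ℝ} (hm : 0 < m) :
    m ^ (-α) - (m + 1) ^ (-α) ≤ α * m ^ (-(α + 1)) := by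
  have h1 : m + 1 = m * (1 + 1 / m) := by field_simp
  have h2 : 1 - α / m ≤ (1 + 1 / m) ^ (-α) := by
    have h3 : 0 < 1 + 1 / m := by positivity
    rw [Real.rpow_def_of_pos h3]
    have h4 := Real.add_one_le_exp (Real.log (1 + 1 / m) * -α)
    have h5 := Real.log_le_sub_one_of_pos h3
    have h6 : Real.log (1 + 1 / m) * α ≤ 1 / m * α := by
      gcongr
      linarith
    have h7 : α / m = 1 / m * α := by ring
    linarith
  have h8 : m ^ (-(α + 1)) = m ^ (-α) / m := by
    rw [neg_add, Real.rpow_add hm, Real.rpow_neg_one, div_eq_mul_inv]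
  rw [h1, Real.mul_rpow hm.le (by positivity), h8]
  have h9 := mul_le_mul_of_nonneg_left h2 (Real.rpow_nonneg hm.le (-α))
  have h10 : m ^ (-α) * (1 - α / m) = m ^ (-α) - α * (m ^ (-α) / m) := by ring
  linarith

theorem exists_near_rpow_neg {α : ℝ} (hα : 0 < α) {N : ℕ} (hN : 1 ≤ N) {r : ℝ} (hr : 0 < r)
    (hrN : r < (N : ℝ) ^ (-α)) :
    ∃ ν : ℕ, 1 ≤ ν ∧ |r - (ν : ℝ) ^ (-α)| ≤ α * (N : ℝ) ^ (-(α + 1)) := by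
  have hex : ∃ m : ℕ, ((N + m : ℕ) : ℝ) ^ (-α) ≤ r := by
    have h1 : Tendsto (fun m : ℕ => (m : ℝ) ^ (-α)) atTop (𝓝 0) :=
      (tendsto_rpow_neg_atTop hα).comp tendsto_natCast_atTop_atTop
    obtain ⟨m, hm⟩ := ((h1.eventually (ge_mem_nhds hr)).and (eventually_ge_atTop N)).exists
    exact ⟨m - N, by rw [Nat.add_sub_cancel' hm.2]; exact hm.1⟩
  classical
  have hspec := Nat.find_spec hex
  rcases hm : Nat.find hex with _ | m
  · rw [hm] at hspec
    exact absurd hspec (not_le.2 (by simpa using hrN))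
  · have hmin := Nat.find_min hex (m := m) (by omega)
    rw [hm] at hspec
    rw [not_le] at hmin
    have hNpos : (0 : ℝ) < N := by exact_mod_cast hN
    have hpos : (0 : ℝ) < (N + m : ℕ) := by exact_mod_cast (by omega : 0 < N + m)
    refine ⟨N + (m + 1), by omega, ?_⟩
    have h2 := rpow_neg_sub_succ_le hα hpos
    have h3 : (((N + m : ℕ) : ℝ)) ^ (-(α + 1)) ≤ (N : ℝ) ^ (-(α + 1)) :=
      Real.rpow_le_rpow_of_nonpos hNpos (by exact_mod_cast Nat.le_add_right N m) (by linarith)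
    have h4 : ((N + m : ℕ) : ℝ) + 1 = ((N + (m + 1) : ℕ) : ℝ) := by push_cast; ring
    rw [h4] at h2
    rw [abs_of_nonneg (by linarith)]
    nlinarith

theorem ofReal_mul_volume_ball_le (hd : 1 ≤ d) {r : ℝ} (hr : 0 ≤ r) :
    ENNReal.ofReal r * volume (ball (0 : Ed d) 1) ≤
      volume (ball (0 : Ed d) (1 + r) \ closedBall 0 1) := by
  have : Nonempty (Fin d) := ⟨⟨0, hd⟩⟩
  refine le_trans ?_ le_measure_sdiff
  rw [Measure.addHaar_closedBall _ _ zero_le_one, Measure.addHaar_ball _ _ (by linarith : 0 ≤ 1 + r),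
    finrank_euclideanSpace_fin, one_pow]
  refine ENNReal.le_sub_of_add_le_right (ENNReal.mul_ne_top (by finiteness) measure_ball_lt_top.ne) ?_
  rw [← add_mul, ← ENNReal.ofReal_add hr zero_le_one]
  gcongr
  have := one_add_mul_le_pow (a := r) (by linarith) d
  have hd' : (1 : ℝ) ≤ d := by exact_mod_cast hd
  nlinarith

end

section

variable {d : ℕ}

theorem le_exponent_of_weakTypePP_radSet (hd : 2 ≤ d) {α : ℝ} (hα : 0 < α) {p : ℝ} (hp : 1 < p)
    (h : WeakTypePP d (radSet α) p) : 1 + 1 / (((d : ℝ) - 1) * (α + 1)) ≤ p := by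
  have hd1 : 1 ≤ d := by omega
  have hdr : (1 : ℝ) ≤ (d : ℝ) - 1 := by
    have : (2 : ℝ) ≤ d := by exact_mod_cast hd
    linarith
  obtain ⟨C, hC⟩ := h
  obtain ⟨c, hc, hlow⟩ := exists_le_sphMean_plateau (d := d) hd1
  set v := volume.real (ball (0 : Ed d) 1) with hv
  have hne : Nonempty (Fin d) := ⟨⟨0, hd1⟩⟩
  have hvpos : 0 < v := ENNReal.toReal_pos (measure_ball_pos _ _ one_pos).ne'
    measure_ball_lt_top.ne
  have hvol : volume (ball (0 : Ed d) 1) = ENNReal.ofReal v := by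
    rw [hv, Measure.real, ENNReal.ofReal_toReal measure_ball_lt_top.ne]
  set K := |C| * (c / 2) ^ (-p) * 4 ^ d with hK
  have key : ∀ N : ℕ, 1 ≤ N → α * (N : ℝ) ^ (-(α + 1)) ≤ 1 → (N : ℝ) ^ (-α) ≤
      K * (α * (N : ℝ) ^ (-(α + 1))) ^ ((d : ℝ) - ((d : ℝ) - 1) * p) := by
    intro N hN hη1
    have hNpos : (0 : ℝ) < N := by exact_mod_cast hN
    set η := α * (N : ℝ) ^ (-(α + 1)) with hη
    have hη0 : 0 < η := by positivity
    set r := (N : ℝ) ^ (-α) with hr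
    have hr0 : 0 < r := by positivity
    have hr1 : r ≤ 1 := Real.rpow_le_one_of_one_le_of_nonpos (by exact_mod_cast hN) (by linarith)
    set a := c / 2 * η ^ (d - 1) with ha
    have ha0 : 0 < a := by positivity
    have hsub : ball (0 : Ed d) (1 + r) \ closedBall 0 1 ⊆ {x | ENNReal.ofReal a <
        maxFn d (radSet α) (fun y => (plateau d η y : ℂ)) x} := by
      rintro x ⟨hx1, hx2⟩
      rw [mem_ball_zero_iff] at hx1
      rw [mem_closedBall_zero_iff, not_le] at hx2
      obtain ⟨ν, hν, hx⟩ := exists_near_rpow_neg hα hN (r := ‖x‖ - 1) (by linarith) (by linarith)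
      have hmem : rad α 0 ν ∈ radSet α := ⟨0, ν, hν, rfl⟩
      have hrad : ‖x‖ - rad α 0 ν = ‖x‖ - 1 - (ν : ℝ) ^ (-α) := by
        rw [rad, zpow_zero, one_mul]
        ring
      have h1 := hlow η hη0 hη1 x (rad α 0 ν) hx2.le (by linarith) (by rwa [hrad])
      refine lt_of_lt_of_le ?_ (h1.trans (le_iSup₂_of_le (rad α 0 ν) hmem le_rfl))
      rw [ENNReal.ofReal_lt_ofReal_iff (by positivity), ha]
      exact mul_lt_mul_of_pos_right (by linarith) (by positivity)
    have hbound := (ofReal_mul_volume_ball_le hd1 hr0.le).trans <| (measure_mono hsub).trans <|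
      hC _ (Complex.continuous_ofReal.comp (continuous_plateau η)) (hasCompactSupport_plateau hη0)
        a ha0
    rw [hvol, ← ENNReal.ofReal_mul hr0.le] at hbound
    have hI := integral_plateau_rpow_le (d := d) hη0 (by linarith : 0 < p)
    have hI0 : 0 ≤ ∫ y : Ed d, ‖(plateau d η y : ℂ)‖ ^ p :=
      integral_nonneg fun y => by positivity
    have hreal : r * v ≤ |C| * a ^ (-p) * ((4 * η) ^ d * v) := by
      have h2 : C * a ^ (-p) * (∫ y : Ed d, ‖(plateau d η y : ℂ)‖ ^ p) ≤
          |C| * a ^ (-p) * ((4 * η) ^ d * v) := by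
        have h3 : C * a ^ (-p) ≤ |C| * a ^ (-p) := by
          gcongr
          exact le_abs_self C
        calc _ ≤ |C| * a ^ (-p) * (∫ y : Ed d, ‖(plateau d η y : ℂ)‖ ^ p) := by gcongr
          _ ≤ _ := by gcongr
      exact (ENNReal.ofReal_le_ofReal_iff (by positivity)).1
        (hbound.trans (ENNReal.ofReal_le_ofReal h2))
    have hfin : r ≤ |C| * a ^ (-p) * (4 * η) ^ d := by
      rw [← mul_assoc] at hreal
      exact le_of_mul_le_mul_right hreal hvpos
    refine hfin.trans (le_of_eq ?_)
    have e1 : a ^ (-p) = (c / 2) ^ (-p) * η ^ (-(((d : ℝ) - 1) * p)) := by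
      rw [ha, Real.mul_rpow (by positivity) (by positivity), ← Real.rpow_natCast η (d - 1),
        ← Real.rpow_mul hη0.le, Nat.cast_sub hd1, Nat.cast_one, mul_neg]
    rw [e1, mul_pow, sub_eq_add_neg (d : ℝ) (((d : ℝ) - 1) * p), Real.rpow_add hη0, Real.rpow_natCast, hK]
    ring
  by_contra hcon
  rw [not_le] at hcon
  set β := (d : ℝ) - ((d : ℝ) - 1) * p with hβ
  have hexp : 0 < (α + 1) * β - α := by
    have h1 : p - 1 < 1 / (((d : ℝ) - 1) * (α + 1)) := by linarith
    rw [lt_div_iff₀ (by positivity)] at h1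
    have h2 : (α + 1) * β - α = 1 - (p - 1) * (((d : ℝ) - 1) * (α + 1)) := by
      rw [hβ]
      ring
    linarith
  have ht1 : Tendsto (fun N : ℕ => α * (N : ℝ) ^ (-(α + 1))) atTop (𝓝 0) := by
    simpa using ((tendsto_rpow_neg_atTop (by linarith : 0 < α + 1)).comp
      tendsto_natCast_atTop_atTop).const_mul α
  have ht2 : Tendsto (fun N : ℕ => (N : ℝ) ^ ((α + 1) * β - α)) atTop atTop :=
    (tendsto_rpow_atTop hexp).comp tendsto_natCast_atTop_atTop
  obtain ⟨N, ⟨hN1, hN2⟩, hN3⟩ := (((ht1.eventually (ge_mem_nhds one_pos)).and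
    (eventually_ge_atTop 1)).and (ht2.eventually_gt_atTop (K * α ^ β))).exists
  have hNpos : (0 : ℝ) < N := by exact_mod_cast hN2
  have h1 := key N hN2 hN1
  rw [Real.mul_rpow hα.le (by positivity), ← Real.rpow_mul hNpos.le, ← mul_assoc] at h1
  have h2 : (N : ℝ) ^ ((α + 1) * β - α) ≤ K * α ^ β := by
    have h3 : (N : ℝ) ^ ((α + 1) * β - α) = (N : ℝ) ^ (-α) * (N : ℝ) ^ ((α + 1) * β) := by
      rw [← Real.rpow_add hNpos]
      ring_nf
    have h4 : (N : ℝ) ^ (-(α + 1) * β) * (N : ℝ) ^ ((α + 1) * β) = 1 := by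
      rw [← Real.rpow_add hNpos]
      ring_nf
      simp
    rw [h3]
    calc _ ≤ K * α ^ β * (N : ℝ) ^ (-(α + 1) * β) * (N : ℝ) ^ ((α + 1) * β) := by gcongr
      _ = _ := by rw [mul_assoc, h4, mul_one]
  linarith

end

/-- Theorem 1.1 (i): for `E(α) = {2^k (1 + ν^{-α})}`, the spherical maximal operator is of
weak type `(p,p)` iff `p ≥ 1 + 1/((d-1)(α+1))`. -/
theorem spherical_maximal_weak_type_Ealpha (d : ℕ) (hd : 2 ≤ d) (α : ℝ) (hα : 0 < α)
    (p : ℝ) (hp : 1 < p) :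
    WeakTypePP d {x : ℝ | ∃ k : ℤ, ∃ ν : ℕ, 1 ≤ ν ∧ x = (2:ℝ)^k * (1 + (ν:ℝ) ^ (-α))} p ↔
      1 + 1 / (((d:ℝ) - 1) * (α + 1)) ≤ p := by
  refine ⟨fun h => le_exponent_of_weakTypePP_radSet hd hα hp h, fun h => ?_⟩
  obtain ⟨M, hM, hW⟩ := exists_posWeak_radSet hd hα rfl
  have hd1 : (1 : ℝ) ≤ (d : ℝ) - 1 := by
    have : (2 : ℝ) ≤ d := by exact_mod_cast hd
    linarith
  have hp0 : 0 < p := by linarith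
  exact weakTypePP_of_posWeak hp0 (by finiteness)
    (hW.exponent_mono (by omega) (by positivity) h)
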